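/- Bulk universality for the product of M−1 Ginibre matrices with one truncated unitary matrix (Theorem 4.2): Fix an integer M ≥ 2, integers ν_1, …, ν_M ≥ 0, and a fixed integer κ > ν_1. Let x0 ∈ (0, (M+1)^{(M+1)/2}/(2·(M−1)^{(M−1)/2})) and let φ ∈ (0, 2π/(M+1)) satisfy x0 = [sin((M+1)φ/2)]^{(M+1)/2} / ( sin φ · [sin((M−1)φ/2)]^{(M−1)/2} ), and set ρ(φ) = (1/(π·x0)) · [sin((M+1)φ/2)/sin((M−1)φ/2)]^{1/2} · sin(φ/2). Then, as n → ∞, e^{−π(ξ−η)·cot(φ/2)} · (n^{M−2}/ρ(φ)) · K_n( n^{M−1}·(x0 + ξ/(n·ρ(φ))), n^{M−1}·(x0 + η/(n·ρ(φ))) ) converges to the sine kernel K_sin(ξ, η) = sin(π(ξ−η))/(π(ξ−η)) (interpreted as 1 when ξ = η), uniformly for (ξ, η) in any compact subset of ℝ². -/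

import Mathlib

open Complex Real Set Filter MeasureTheory

/-- The point on the vertical contour `𝒞`: `s = -1/2 + iσ`. -/
noncomputable def sC (σ : ℝ) : ℂ := -(1/2) + σ * Complex.I

/-- The point on the circular contour `Σ` (center `(n-1)/2`, radius `n/2 - 1/8`). -/
noncomputable def tC (n : ℕ) (θ : ℝ) : ℂ :=
  ((n : ℂ) - 1) / 2 + ((n : ℂ) / 2 - 1/8) * Complex.exp (θ * Complex.I)

/-- The integrand of the double contour integral defining the kernel for the product of
`M - 1` Ginibre matrices with one truncated unitary matrix. -/
noncomputable def integrandTU (M : ℕ) (ν : ℕ → ℕ) (κ : ℕ) (n : ℕ) (x y : ℝ) (s t : ℂ) : ℂ :=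
  (∏ j ∈ Finset.range (M + 1),
      Complex.Gamma (s + (ν j : ℂ) + 1) / Complex.Gamma (t + (ν j : ℂ) + 1)) *
    (Complex.Gamma (t - (n : ℂ) + 1) / Complex.Gamma (s - (n : ℂ) + 1)) *
    (Complex.Gamma (t + (n : ℂ) + (κ : ℂ)) / Complex.Gamma (s + (n : ℂ) + (κ : ℂ))) *
    Complex.exp (t * Real.log x) * Complex.exp (-(s + 1) * Real.log y) / (s - t)

/-- The correlation kernel for the product of `M - 1` Ginibre matrices with one truncated
unitary matrix. -/
noncomputable def KnTU (M : ℕ) (ν : ℕ → ℕ) (κ : ℕ) (n : ℕ) (x y : ℝ) : ℂ :=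
  (1 / (2 * (Real.pi : ℂ) * Complex.I) ^ 2) *
    ∫ σ : ℝ, Complex.I *
      ∫ θ in (0 : ℝ)..(2 * Real.pi),
        (((n : ℂ) / 2 - 1/8) * Complex.I * Complex.exp (θ * Complex.I)) *
          integrandTU M ν κ n x y (sC σ) (tC n θ)

/-- The sine kernel, interpreted as `1` on the diagonal. -/
noncomputable def Ksin (ξ η : ℝ) : ℝ :=
  if ξ = η then 1 else Real.sin (Real.pi * (ξ - η)) / (Real.pi * (ξ - η))

/-- The limiting density `ρ(φ)` for the truncated-unitary model. -/
noncomputable def ρTU (M : ℕ) (x0 φ : ℝ) : ℝ :=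
  (1 / (Real.pi * x0)) *
    (Real.sin (((M : ℝ) + 1) * φ / 2) / Real.sin (((M : ℝ) - 1) * φ / 2)) ^ ((1 : ℝ)/2) *
    Real.sin (φ / 2)

open Topology

/-- The leading part `v log v - v` of Stirling's approximation to `log Γ(v + 1/2)`. -/
noncomputable def stirlingT (v : ℂ) : ℂ := v * Complex.log v - v

theorem norm_GammaSeq (s : ℂ) {n : ℕ} (hn : 0 < n) :
    ‖Complex.GammaSeq s n‖ =
      (n : ℝ) ^ s.re * n.factorial / ∏ j ∈ Finset.range (n + 1), ‖s + j‖ := by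
  rw [Complex.GammaSeq, norm_div, norm_mul, Complex.norm_natCast_cpow_of_pos hn, norm_prod]
  simp

theorem norm_Gamma_le_Gamma_re {s : ℂ} (hs : 0 < s.re) :
    ‖Complex.Gamma s‖ ≤ Real.Gamma s.re := by
  refine le_of_tendsto_of_tendsto (Complex.GammaSeq_tendsto_Gamma s).norm
    (Real.GammaSeq_tendsto_Gamma s.re) ?_
  filter_upwards [eventually_gt_atTop 0] with n hn
  rw [norm_GammaSeq s hn, Real.GammaSeq]
  refine div_le_div_of_nonneg_left (by positivity)
    (Finset.prod_pos fun j _ => by positivity) ?_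
  refine Finset.prod_le_prod (fun j _ => by positivity) fun j _ => ?_
  simpa using Complex.re_le_norm (s + j)

theorem norm_Gamma_mul_le {x y : ℝ} (hx : 0 ≤ x) :
    Real.Gamma (1 / 2 + x) * ‖Complex.Gamma ((1 / 2 : ℝ) + y * Complex.I)‖ ≤
      Real.Gamma (1 / 2) * ‖Complex.Gamma ((1 / 2 + x : ℝ) + y * Complex.I)‖ := by
  refine le_of_tendsto_of_tendsto
    ((Real.GammaSeq_tendsto_Gamma _).mul (Complex.GammaSeq_tendsto_Gamma _).norm)
    ((Real.GammaSeq_tendsto_Gamma _).mul (Complex.GammaSeq_tendsto_Gamma _).norm) ?_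
  filter_upwards [eventually_gt_atTop 0] with n hn
  rw [norm_GammaSeq _ hn, norm_GammaSeq _ hn, Real.GammaSeq, Real.GammaSeq, div_mul_div_comm,
    div_mul_div_comm, ← Finset.prod_mul_distrib, ← Finset.prod_mul_distrib]
  have e : ∀ a : ℝ, ((a : ℂ) + y * Complex.I).re = a := by simp
  have hne : ∀ a : ℝ, ∀ j : ℕ, 0 < a → 0 < ‖(a : ℂ) + y * Complex.I + j‖ := by
    intro a j ha
    rw [norm_pos_iff]
    intro h
    have := congrArg Complex.re h
    simp at this
    have h0 : 0 < a + j := by positivity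
    exact h0.ne' this
  rw [e, e]
  refine div_le_div₀ (by positivity) (le_of_eq (by ring))
    (Finset.prod_pos fun j _ => ?_) (Finset.prod_le_prod (fun j _ => by positivity) fun j _ => ?_)
  · have := hne (1 / 2 + x) j (by positivity)
    positivity
  · have h1 : ∀ a : ℝ, ‖(a : ℂ) + y * Complex.I + j‖ = √((a + j) ^ 2 + y ^ 2) := by
      intro a
      have : (a : ℂ) + y * Complex.I + j = ((a + j : ℝ) : ℂ) + y * Complex.I := by
        push_cast; ring
      rw [this, Complex.norm_add_mul_I]
    rw [h1, h1]
    set b : ℝ := 1 / 2 + j with hb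
    have hb0 : 0 < b := by positivity
    have e2 : 1 / 2 + x + (j : ℝ) = b + x := by rw [hb]; ring
    rw [e2]
    calc b * √((b + x) ^ 2 + y ^ 2) = √(b ^ 2 * ((b + x) ^ 2 + y ^ 2)) := by
          rw [Real.sqrt_mul (by positivity), Real.sqrt_sq hb0.le]
      _ ≤ √((b + x) ^ 2 * (b ^ 2 + y ^ 2)) := by
          apply Real.sqrt_le_sqrt
          nlinarith [mul_nonneg (mul_nonneg hx (by positivity : 0 ≤ 2 * b + x)) (sq_nonneg y)]
      _ = (b + x) * √(b ^ 2 + y ^ 2) := by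
          rw [Real.sqrt_mul (by positivity), Real.sqrt_sq (by positivity)]

theorem norm_Gamma_half_add_I_sq (y : ℝ) :
    ‖Complex.Gamma ((1 / 2 : ℝ) + y * Complex.I)‖ ^ 2 = π / Real.cosh (π * y) := by
  have h := Complex.Gamma_mul_Gamma_one_sub ((1 / 2 : ℝ) + y * Complex.I)
  have e1 : 1 - (((1 / 2 : ℝ) : ℂ) + y * Complex.I) =
      (starRingEnd ℂ) (((1 / 2 : ℝ) : ℂ) + y * Complex.I) := by
    simp only [map_add, map_mul, Complex.conj_ofReal, Complex.conj_I]
    push_cast; ring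
  have e2 : Complex.sin (π * (((1 / 2 : ℝ) : ℂ) + y * Complex.I)) = Real.cosh (π * y) := by
    have : (π : ℂ) * (((1 / 2 : ℝ) : ℂ) + y * Complex.I) =
        π / 2 - (-((π * y : ℝ) : ℂ) * Complex.I) := by push_cast; ring
    rw [this, Complex.sin_pi_div_two_sub, neg_mul, Complex.cos_neg, Complex.cos_mul_I,
      Complex.ofReal_cosh]
  rw [e1, Complex.Gamma_conj, Complex.mul_conj, e2, Complex.normSq_eq_norm_sq] at h
  exact_mod_cast h

theorem norm_Gamma_half_add_I_le (y : ℝ) :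
    ‖Complex.Gamma ((1 / 2 : ℝ) + y * Complex.I)‖ ≤ √(2 * π) * Real.exp (-(π * |y| / 2)) := by
  refine abs_le_of_sq_le_sq' ?_ (by positivity) |>.2
  rw [norm_Gamma_half_add_I_sq, mul_pow, Real.sq_sqrt (by positivity), ← Real.exp_nat_mul,
    div_le_iff₀ (Real.cosh_pos _), ← Real.cosh_abs, abs_mul, abs_of_pos Real.pi_pos, Real.cosh_eq]
  have : Real.exp ((2 : ℕ) * -(π * |y| / 2)) * Real.exp (π * |y|) = 1 := by
    rw [← Real.exp_add, Real.exp_eq_one_iff]; push_cast; ring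
  have h2 : 0 < Real.exp ((2 : ℕ) * -(π * |y| / 2)) * Real.exp (-(π * |y|)) := by positivity
  nlinarith [Real.pi_pos]

theorem le_norm_Gamma_half_add_I (y : ℝ) :
    Real.exp (-(π * |y| / 2)) ≤ ‖Complex.Gamma ((1 / 2 : ℝ) + y * Complex.I)‖ := by
  refine abs_le_of_sq_le_sq' ?_ (by positivity) |>.2
  rw [norm_Gamma_half_add_I_sq, ← Real.exp_nat_mul,
    le_div_iff₀ (Real.cosh_pos _), ← Real.cosh_abs, abs_mul, abs_of_pos Real.pi_pos, Real.cosh_eq]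
  have : Real.exp ((2 : ℕ) * -(π * |y| / 2)) * Real.exp (π * |y|) = 1 := by
    rw [← Real.exp_add, Real.exp_eq_one_iff]; push_cast; ring
  have h2 : Real.exp ((2 : ℕ) * -(π * |y| / 2)) * Real.exp (-(π * |y|)) ≤ 1 := by
    rw [← Real.exp_add]
    apply Real.exp_le_one_iff.2
    have : 0 ≤ π * |y| := by positivity
    push_cast
    linarith
  nlinarith [Real.pi_gt_three]

theorem Gamma_half_add_le {x : ℝ} (hx : 2 ≤ x) :
    Real.Gamma (1 / 2 + x) ≤ 2 * x * (Real.exp 1 * x) * Real.exp (x * Real.log x - x) := by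
  set n := ⌊x⌋₊
  have hn : (n : ℝ) ≤ x := Nat.floor_le (by linarith)
  have hn2 : x < n + 1 := Nat.lt_floor_add_one x
  have hn1 : 1 ≤ n := Nat.le_floor (by push_cast; linarith)
  have hn1' : (1 : ℝ) ≤ n := by exact_mod_cast hn1
  have h1 : Real.Gamma (1 / 2 + x) ≤ Real.Gamma ((n + 1 : ℕ) + 1) := by
    apply Gamma_strictMonoOn_Ici.monotoneOn
    · simp only [mem_Ici]; linarith
    · simp only [mem_Ici]; push_cast; linarith
    · push_cast; linarith
  rw [Real.Gamma_nat_eq_factorial, Nat.factorial_succ] at h1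
  have h2 : (n.factorial : ℝ) ≤ Real.exp 1 * n * (n / Real.exp 1) ^ n := by
    have := Stirling.stirlingSeq'_antitone (Nat.zero_le (n - 1))
    simp only [Function.comp, Nat.succ_eq_add_one, Nat.sub_add_cancel hn1, zero_add,
      Stirling.stirlingSeq_one] at this
    rw [Stirling.stirlingSeq, div_le_div_iff₀ (by positivity) (by positivity)] at this
    rw [Real.sqrt_mul (by norm_num)] at this
    have h3 : (n.factorial : ℝ) ≤ Real.exp 1 * (√n * (n / Real.exp 1) ^ n) := by
      have h2 : 0 < √(2 : ℝ) := by positivity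
      refine le_of_mul_le_mul_right ?_ h2
      linarith
    refine h3.trans ?_
    rw [mul_assoc]
    gcongr
    rw [Real.sqrt_le_left (by positivity)]
    nlinarith
  have h3 : ((n : ℝ) / Real.exp 1) ^ n ≤ Real.exp (x * Real.log x - x) := by
    have e : ((n : ℝ) / Real.exp 1) ^ n = Real.exp (n * (Real.log n - 1)) := by
      rw [Real.exp_nat_mul, Real.exp_sub, Real.exp_log (by positivity)]
    rw [e]
    apply Real.exp_le_exp.2
    have hl : Real.log n ≤ Real.log x := Real.log_le_log (by positivity) hn
    have hx0 : 0 < x := by linarith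
    have hl2 : 1 - x / n ≤ Real.log n - Real.log x := by
      have := Real.one_sub_inv_le_log_of_pos (show 0 < (n : ℝ) / x by positivity)
      rw [Real.log_div (by positivity) (by positivity), inv_div] at this
      exact this
    have hl0 : 0 ≤ Real.log n := Real.log_nonneg hn1'
    have hlx : 1 - n / x ≤ Real.log x - Real.log n := by
      have := Real.one_sub_inv_le_log_of_pos (show 0 < x / (n : ℝ) by positivity)
      rw [Real.log_div (by positivity) (by positivity), inv_div] at this
      exact this
    have : x - n ≤ x * (Real.log x - Real.log n) := by
      have := mul_le_mul_of_nonneg_left hlx hx0.le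
      rw [mul_sub, mul_one, mul_div_cancel₀ _ hx0.ne'] at this
      exact this
    nlinarith
  calc Real.Gamma (1 / 2 + x) ≤ ((n + 1) * n.factorial : ℕ) := h1
    _ = ((n : ℝ) + 1) * n.factorial := by push_cast; ring
    _ ≤ (2 * x) * (Real.exp 1 * n * (n / Real.exp 1) ^ n) := by gcongr; linarith
    _ ≤ (2 * x) * (Real.exp 1 * x * Real.exp (x * Real.log x - x)) := by gcongr
    _ = _ := by ring

theorem le_Gamma_half_add {x : ℝ} (hx : 2 ≤ x) :
    Real.exp (x * Real.log x - x) ≤ 2 * x * x * Real.Gamma (1 / 2 + x) := by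
  set n := ⌊x⌋₊
  have hn : (n : ℝ) ≤ x := Nat.floor_le (by linarith)
  have hn2 : x < n + 1 := Nat.lt_floor_add_one x
  have hn1 : 2 ≤ n := Nat.le_floor (by push_cast; linarith)
  have hn1' : (2 : ℝ) ≤ n := by exact_mod_cast hn1
  have h1 : Real.Gamma n ≤ Real.Gamma (1 / 2 + x) := by
    apply Gamma_strictMonoOn_Ici.monotoneOn
    · simpa using hn1'
    · simp only [mem_Ici]; linarith
    · linarith
  have h2 : ((n + 1).factorial : ℝ) = (n + 1) * n * Real.Gamma n := by
    clear_value n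
    obtain ⟨m, rfl⟩ : ∃ m, n = m + 1 := ⟨n - 1, by omega⟩
    have : ((m + 1 : ℕ) : ℝ) = m + 1 := by push_cast; ring
    rw [this, Real.Gamma_nat_eq_factorial, Nat.factorial_succ, Nat.factorial_succ]
    push_cast; ring
  have h3 := Stirling.le_factorial_stirling (n + 1)
  have h4 : Real.exp (x * Real.log x - x) ≤ ((n + 1).factorial : ℝ) := by
    have e : (((n + 1 : ℕ) : ℝ) / Real.exp 1) ^ (n + 1) =
        Real.exp ((n + 1 : ℕ) * (Real.log (n + 1 : ℕ) - 1)) := by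
      rw [Real.exp_nat_mul, Real.exp_sub, Real.exp_log (by positivity)]
    have h5 : 1 ≤ √(2 * π * (n + 1 : ℕ)) := by
      rw [Real.one_le_sqrt]
      push_cast
      nlinarith [Real.pi_gt_three]
    refine le_trans ?_ ((le_mul_of_one_le_left (by positivity) h5).trans h3)
    rw [e]
    apply Real.exp_le_exp.2
    push_cast
    have hx0 : 0 < x := by linarith
    have hlx : 1 - x / (n + 1) ≤ Real.log (n + 1) - Real.log x := by
      have := Real.one_sub_inv_le_log_of_pos (show 0 < ((n : ℝ) + 1) / x by positivity)
      rw [Real.log_div (by positivity) (by positivity), inv_div] at this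
      exact this
    have : (n + 1) - x ≤ (n + 1) * (Real.log (n + 1) - Real.log x) := by
      have := mul_le_mul_of_nonneg_left hlx (show (0 : ℝ) ≤ n + 1 by positivity)
      rw [mul_sub, mul_one, mul_div_cancel₀ _ (by positivity)] at this
      exact this
    have hlog : 0 ≤ Real.log x := Real.log_nonneg (by linarith)
    nlinarith
  refine h4.trans (h2.trans_le ?_)
  have : 0 < Real.Gamma n := Real.Gamma_pos_of_pos (by positivity)
  gcongr
  linarith

theorem stirlingT_re (v : ℂ) :
    (stirlingT v).re = v.re * Real.log ‖v‖ - v.im * Complex.arg v - v.re := by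
  simp [stirlingT, Complex.log_re, Complex.log_im]

theorem stirlingT_mul_I_re (y : ℝ) : (stirlingT (y * Complex.I)).re = -(π * |y| / 2) := by
  rw [stirlingT_re]
  rcases lt_trichotomy y 0 with h | rfl | h
  · rw [show (y : ℂ) * Complex.I = ((-y : ℝ) : ℂ) * -Complex.I by push_cast; ring,
      Complex.arg_real_mul _ (by linarith)]
    simp [abs_of_neg h]
    ring
  · simp
  · rw [Complex.arg_real_mul _ h]
    simp [abs_of_pos h]
    ring

theorem norm_stirlingT_le (v : ℂ) : ‖stirlingT v‖ ≤ ‖v‖ * (|Real.log ‖v‖| + π + 1) := by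
  have h : ‖Complex.log v‖ ≤ |Real.log ‖v‖| + π := by
    refine (Complex.norm_le_abs_re_add_abs_im _).trans ?_
    rw [Complex.log_re, Complex.log_im]
    gcongr
    exact Complex.abs_arg_le_pi v
  calc ‖stirlingT v‖ ≤ ‖v‖ * ‖Complex.log v‖ + ‖v‖ := by
        rw [← norm_mul]; exact norm_sub_le _ _
    _ ≤ ‖v‖ * (|Real.log ‖v‖| + π) + ‖v‖ := by gcongr
    _ = _ := by ring

theorem continuousAt_stirlingT {v : ℂ} (hv : v = 0 ∨ v ∈ Complex.slitPlane) :
    ContinuousAt stirlingT v := by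
  rcases hv with rfl | hv
  · have h0 : stirlingT 0 = 0 := by simp [stirlingT]
    rw [ContinuousAt, h0]
    refine squeeze_zero_norm norm_stirlingT_le ?_
    have h1 : Tendsto (fun v : ℂ => ‖v‖) (𝓝 0) (𝓝 0) := by
      simpa using (continuous_norm (E := ℂ)).tendsto 0
    have h2 : Tendsto (fun r : ℝ => |r * Real.log r| + |r| * (π + 1)) (𝓝 0) (𝓝 0) := by
      have hc : Continuous fun r : ℝ => |r * Real.log r| + |r| * (π + 1) :=
        Real.continuous_mul_log.abs.add (continuous_abs.mul continuous_const)
      have := hc.tendsto 0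
      simp only [Real.log_zero, mul_zero, abs_zero, zero_mul, add_zero] at this
      exact this
    refine (h2.comp h1).congr fun v => ?_
    simp only [Function.comp, abs_mul, abs_norm]
    ring
  · unfold stirlingT
    exact (continuousAt_id.mul (continuousAt_clog hv)).sub continuousAt_id

theorem hasDerivAt_stirlingT {v : ℂ} (hv : v ∈ Complex.slitPlane) :
    HasDerivAt stirlingT (Complex.log v) v := by
  have h0 : v ≠ 0 := Complex.slitPlane_ne_zero hv
  have := ((hasDerivAt_id v).mul (Complex.hasDerivAt_log hv)).sub (hasDerivAt_id v)
  refine this.congr_deriv ?_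
  simp [h0]

theorem eq_zero_or_mem_slitPlane {v : ℂ} (hv : 0 ≤ v.re) : v = 0 ∨ v ∈ Complex.slitPlane := by
  rcases hv.lt_or_eq with h | h
  · exact Or.inr (Or.inl h)
  · by_cases h2 : v.im = 0
    · exact Or.inl (Complex.ext h.symm h2)
    · exact Or.inr (Or.inr h2)

theorem continuousOn_stirlingT : ContinuousOn stirlingT {v | 0 ≤ v.re} := fun _ hv =>
  (continuousAt_stirlingT (eq_zero_or_mem_slitPlane hv)).continuousWithinAt

theorem exists_pos_le_Gamma : ∃ c > 0, ∀ x : ℝ, 0 < x → c ≤ Real.Gamma x := by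
  obtain ⟨x, hx, h⟩ := exists_isMinOn_Gamma_Ioi
  exact ⟨Real.Gamma x, Real.Gamma_pos_of_pos (by linarith [hx.1]), fun y hy => h hy⟩

section Growth

variable {R : ℝ}

theorem le_rpow_three_half (hR : 4 ≤ R) : R ≤ R ^ (3 / 2 : ℝ) := by
  conv_lhs => rw [← Real.rpow_one R]
  exact Real.rpow_le_rpow_of_exponent_le (by linarith) (by norm_num)

theorem mul_log_le_rpow (hR : 4 ≤ R) : R * Real.log R ≤ 2 * R ^ (3 / 2 : ℝ) := by
  have h := Real.log_le_rpow_div (show 0 ≤ R by linarith) (show (0 : ℝ) < 1 / 2 by norm_num)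
  have e : R ^ (3 / 2 : ℝ) = R * R ^ (1 / 2 : ℝ) := by
    rw [show (3 / 2 : ℝ) = 1 + 1 / 2 by norm_num, Real.rpow_add (by linarith), Real.rpow_one]
  rw [e]
  have : R * Real.log R ≤ R * (R ^ (1 / 2 : ℝ) / (1 / 2)) := by gcongr
  linarith

theorem norm_stirlingT_le_rpow {v : ℂ} (hv : 4 ≤ ‖v‖) :
    ‖stirlingT v‖ ≤ 7 * ‖v‖ ^ (3 / 2 : ℝ) := by
  refine (norm_stirlingT_le v).trans ?_
  rw [abs_of_nonneg (Real.log_nonneg (by linarith))]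
  nlinarith [mul_log_le_rpow hv, le_rpow_three_half hv, Real.pi_lt_four]

theorem norm_Gamma_half_add_le {v : ℂ} (hre : 0 < v.re) (hv : 4 ≤ ‖v‖) :
    ‖Complex.Gamma (1 / 2 + v)‖ ≤ Real.exp (7 * ‖v‖ ^ (3 / 2 : ℝ)) := by
  have h1 : ‖Complex.Gamma (1 / 2 + v)‖ ≤ Real.Gamma (1 / 2 + v.re) := by
    have := norm_Gamma_le_Gamma_re (s := 1 / 2 + v) (by norm_num; linarith)
    convert this using 2
    norm_num
  set R := ‖v‖ with hRdef
  have hxR : v.re ≤ R := Complex.re_le_norm v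
  have h2 : Real.Gamma (1 / 2 + v.re) ≤
      max (Real.Gamma (1 / 2)) (Real.Gamma (1 / 2 + R)) := by
    apply Real.convexOn_Gamma.le_max_of_mem_Icc
    · simp
    · simp only [mem_Ioi]; linarith
    · constructor <;> linarith
  have h3 := Gamma_half_add_le (show 2 ≤ R by linarith)
  have hP := le_rpow_three_half hv
  have hL := mul_log_le_rpow hv
  set P := R ^ (3 / 2 : ℝ)
  refine h1.trans (h2.trans (max_le ?_ ?_))
  · rw [Real.Gamma_one_half_eq]
    have : √π ≤ 2 := by
      rw [Real.sqrt_le_left (by norm_num)]; nlinarith [Real.pi_lt_four]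
    have h5 := Real.add_one_le_exp (7 * P)
    linarith
  · have hexp : R ≤ Real.exp P := by linarith [Real.add_one_le_exp P]
    have h2e : (2 : ℝ) ≤ Real.exp P := by linarith [Real.add_one_le_exp P]
    calc _ ≤ _ := h3
      _ ≤ (Real.exp P * Real.exp P) * (Real.exp P * Real.exp P) * Real.exp (2 * P) := by
          gcongr <;> linarith
      _ = Real.exp (6 * P) := by
          simp only [← Real.exp_add]; congr 1; ring
      _ ≤ _ := by apply Real.exp_le_exp.2; linarith

theorem norm_inv_Gamma_half_add_le : ∃ C > 0, ∀ v : ℂ, 0 ≤ v.re →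
    ‖(Complex.Gamma (1 / 2 + v))⁻¹‖ ≤ C * Real.exp (π * |v.im| / 2) := by
  obtain ⟨c, hc, h⟩ := exists_pos_le_Gamma
  refine ⟨Real.Gamma (1 / 2) / c, by positivity, fun v hv => ?_⟩
  have h1 := norm_Gamma_mul_le (x := v.re) (y := v.im) hv
  have e : ((1 / 2 + v.re : ℝ) : ℂ) + v.im * Complex.I = 1 / 2 + v := by
    conv_rhs => rw [← Complex.re_add_im v]
    push_cast; ring
  rw [e] at h1
  have h2 := le_norm_Gamma_half_add_I v.im
  have h3 := h (1 / 2 + v.re) (by linarith)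
  have h4 : c * Real.exp (-(π * |v.im| / 2)) ≤
      Real.Gamma (1 / 2) * ‖Complex.Gamma (1 / 2 + v)‖ := le_trans (by gcongr) h1
  have hG : 0 < Real.Gamma (1 / 2) := Real.Gamma_pos_of_pos (by norm_num)
  have h5 : 0 < ‖Complex.Gamma (1 / 2 + v)‖ := by
    have : 0 < c * Real.exp (-(π * |v.im| / 2)) := by positivity
    by_contra h0
    nlinarith [norm_nonneg (Complex.Gamma (1 / 2 + v))]
  rw [norm_inv, inv_le_iff_one_le_mul₀ h5, div_mul_eq_mul_div, div_mul_eq_mul_div,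
    le_div_iff₀ hc]
  rw [Real.exp_neg] at h4
  have h6 : 0 < Real.exp (π * |v.im| / 2) := Real.exp_pos _
  rw [← div_eq_mul_inv, div_le_iff₀ h6] at h4
  linarith

end Growth

theorem Gamma_half_add_differentiableAt {v : ℂ} (hv : 0 ≤ v.re) :
    DifferentiableAt ℂ (fun v => Complex.Gamma (1 / 2 + v)) v := by
  refine (Complex.differentiableAt_Gamma _ fun m h => ?_).comp v
    ((differentiableAt_const _).add differentiableAt_id)
  have := congrArg Complex.re h
  simp at this
  have hm : (0 : ℝ) ≤ m := by positivity
  linarith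

theorem Gamma_half_add_ne_zero {v : ℂ} (hv : 0 ≤ v.re) : Complex.Gamma (1 / 2 + v) ≠ 0 :=
  Complex.Gamma_ne_zero_of_re_pos (by simp; linarith)

theorem le_of_forall_exp_mul_le {a b x : ℝ} (h : ∀ ε > 0, a * Real.exp (-(ε * x)) ≤ b) :
    a ≤ b := by
  have ht : Tendsto (fun ε : ℝ => a * Real.exp (-(ε * x))) (𝓝[>] 0) (𝓝 a) := by
    have : Continuous fun ε : ℝ => a * Real.exp (-(ε * x)) := by fun_prop
    simpa using (this.tendsto 0).mono_left nhdsWithin_le_nhds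
  exact le_of_tendsto ht (eventually_nhdsWithin_of_forall h)

theorem closure_re_pos : closure {z : ℂ | 0 < z.re} = {z | 0 ≤ z.re} :=
  Complex.closure_setOfPred_lt_re 0

theorem tendsto_poly_mul_exp {ε : ℝ} (hε : 0 < ε) (C : ℝ) :
    Tendsto (fun x : ℝ => C * (x ^ 2 * Real.exp (-(ε * x)))) atTop (𝓝 0) := by
  have h := (tendsto_pow_mul_exp_neg_atTop_nhds_zero 2).comp
    (tendsto_id.const_mul_atTop hε)
  have := h.const_mul (C / ε ^ 2)
  simp only [mul_zero] at this
  refine this.congr fun x => ?_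
  simp only [Function.comp, id]
  field_simp

/-- Upper half of Stirling's formula in the closed right half-plane, up to a constant. -/
theorem norm_Gamma_half_add_le_stirling {v : ℂ} (hv : 0 ≤ v.re) :
    ‖Complex.Gamma (1 / 2 + v)‖ ≤ √(2 * π) * Real.exp (stirlingT v).re := by
  suffices h : ‖Complex.Gamma (1 / 2 + v)‖ * Real.exp (-(stirlingT v).re) ≤ √(2 * π) by
    rwa [Real.exp_neg, ← div_eq_mul_inv, div_le_iff₀ (Real.exp_pos _)] at h
  refine le_of_forall_exp_mul_le (x := v.re) fun ε hε => ?_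
  set f : ℂ → ℂ := fun v => Complex.Gamma (1 / 2 + v) * Complex.exp (-stirlingT v) *
    Complex.exp (-(ε * v)) with hf
  have hnf : ∀ v, ‖f v‖ = ‖Complex.Gamma (1 / 2 + v)‖ * Real.exp (-(stirlingT v).re) *
      Real.exp (-(ε * v.re)) := by
    intro v
    simp [hf, Complex.norm_exp]
  rw [← hnf]
  refine PhragmenLindelof.right_half_plane_of_tendsto_zero_on_real (f := f) ⟨?_, ?_⟩
    ⟨3 / 2, by norm_num, 14, ?_⟩ ?_ ?_ hv
  · intro z hz
    have hz' : 0 < z.re := hz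
    exact (((Gamma_half_add_differentiableAt hz'.le).mul
      (hasDerivAt_stirlingT (Or.inl hz')).differentiableAt.neg.cexp).mul
      (by fun_prop)).differentiableWithinAt
  · rw [closure_re_pos]
    refine ContinuousOn.mul (ContinuousOn.mul ?_ ?_) (by fun_prop)
    · exact fun z hz => (Gamma_half_add_differentiableAt hz).continuousAt.continuousWithinAt
    · exact continuousOn_stirlingT.neg.cexp
  · refine Asymptotics.IsBigO.of_bound 1 ?_
    have : ∀ᶠ z : ℂ in Bornology.cobounded ℂ, 4 ≤ ‖z‖ :=
      tendsto_norm_cobounded_atTop.eventually_ge_atTop 4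
    filter_upwards [this.filter_mono inf_le_left,
      mem_inf_of_right (mem_principal_self _)] with z hz4 hz
    have hz' : 0 < z.re := hz
    rw [hnf, one_mul, Real.norm_of_nonneg (Real.exp_pos _).le]
    calc _ ≤ Real.exp (7 * ‖z‖ ^ (3 / 2 : ℝ)) * Real.exp (7 * ‖z‖ ^ (3 / 2 : ℝ)) * 1 := by
          gcongr
          · exact norm_Gamma_half_add_le hz' hz4
          · have h1 := Complex.abs_re_le_norm (stirlingT z)
            have h2 := norm_stirlingT_le_rpow hz4
            linarith [neg_abs_le (stirlingT z).re]
          · apply Real.exp_le_one_iff.2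
            have : 0 ≤ ε * z.re := by positivity
            linarith
      _ = _ := by rw [mul_one, ← Real.exp_add]; congr 1; ring
  · rw [tendsto_zero_iff_norm_tendsto_zero]
    refine squeeze_zero' (Eventually.of_forall fun _ => norm_nonneg _) ?_
      (tendsto_poly_mul_exp hε (2 * Real.exp 1))
    filter_upwards [eventually_ge_atTop 2] with x hx
    rw [hnf, stirlingT_re, Complex.arg_ofReal_of_nonneg (by linarith)]
    have h1 : ‖Complex.Gamma (1 / 2 + (x : ℂ))‖ ≤
        2 * x * (Real.exp 1 * x) * Real.exp (x * Real.log x - x) := by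
      have := norm_Gamma_le_Gamma_re (s := 1 / 2 + (x : ℂ)) (by norm_num; linarith)
      have e : (1 / 2 + (x : ℂ)).re = 1 / 2 + x := by norm_num
      rw [e] at this
      exact this.trans (Gamma_half_add_le hx)
    simp only [Complex.ofReal_re, Complex.ofReal_im, Complex.norm_real, zero_mul, sub_zero,
      Real.norm_of_nonneg (show 0 ≤ x by linarith)]
    calc _ ≤ 2 * x * (Real.exp 1 * x) * Real.exp (x * Real.log x - x) *
          Real.exp (-(x * Real.log x - x)) * Real.exp (-(ε * x)) := by gcongr
      _ = _ := by rw [Real.exp_neg (x * Real.log x - x)]; field_simp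
  · intro y
    rw [hnf, stirlingT_mul_I_re]
    have := norm_Gamma_half_add_I_le y
    push_cast at this
    simp only [neg_neg, Complex.mul_re, Complex.ofReal_re, Complex.I_re, mul_zero,
      Complex.ofReal_im, Complex.I_im, mul_one, sub_self, neg_zero, Real.exp_zero]
    rwa [Real.exp_neg, ← div_eq_mul_inv, le_div_iff₀ (Real.exp_pos _)] at this

/-- Lower half of Stirling's formula in the closed right half-plane, up to a constant. -/
theorem stirling_le_norm_Gamma_half_add {v : ℂ} (hv : 0 ≤ v.re) :
    Real.exp (stirlingT v).re ≤ ‖Complex.Gamma (1 / 2 + v)‖ := by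
  have hGpos : 0 < ‖Complex.Gamma (1 / 2 + v)‖ := norm_pos_iff.2 (Gamma_half_add_ne_zero hv)
  suffices h : ‖(Complex.Gamma (1 / 2 + v))⁻¹‖ * Real.exp (stirlingT v).re ≤ 1 by
    rwa [norm_inv, inv_mul_le_iff₀ hGpos, mul_one] at h
  refine le_of_forall_exp_mul_le (x := v.re) fun ε hε => ?_
  set f : ℂ → ℂ := fun v => (Complex.Gamma (1 / 2 + v))⁻¹ * Complex.exp (stirlingT v) *
    Complex.exp (-(ε * v)) with hf
  have hnf : ∀ v, ‖f v‖ = ‖(Complex.Gamma (1 / 2 + v))⁻¹‖ * Real.exp (stirlingT v).re *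
      Real.exp (-(ε * v.re)) := by
    intro v
    simp [hf, Complex.norm_exp]
  rw [← hnf]
  obtain ⟨C, hC, hbd⟩ := norm_inv_Gamma_half_add_le
  refine PhragmenLindelof.right_half_plane_of_tendsto_zero_on_real (f := f) ⟨?_, ?_⟩
    ⟨3 / 2, by norm_num, 9, ?_⟩ ?_ ?_ hv
  · intro z hz
    have hz' : 0 < z.re := hz
    exact ((((Gamma_half_add_differentiableAt hz'.le).inv (Gamma_half_add_ne_zero hz'.le)).mul
      (hasDerivAt_stirlingT (Or.inl hz')).differentiableAt.cexp).mul
      (by fun_prop)).differentiableWithinAt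
  · rw [closure_re_pos]
    refine ContinuousOn.mul (ContinuousOn.mul ?_ ?_) (by fun_prop)
    · exact ContinuousOn.inv₀ (fun z hz =>
        (Gamma_half_add_differentiableAt hz).continuousAt.continuousWithinAt)
        fun z hz => Gamma_half_add_ne_zero hz
    · exact continuousOn_stirlingT.cexp
  · refine Asymptotics.IsBigO.of_bound C ?_
    have : ∀ᶠ z : ℂ in Bornology.cobounded ℂ, 4 ≤ ‖z‖ :=
      tendsto_norm_cobounded_atTop.eventually_ge_atTop 4
    filter_upwards [this.filter_mono inf_le_left,
      mem_inf_of_right (mem_principal_self _)] with z hz4 hz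
    have hz' : 0 < z.re := hz
    rw [hnf, Real.norm_of_nonneg (Real.exp_pos _).le]
    calc _ ≤ (C * Real.exp (2 * ‖z‖ ^ (3 / 2 : ℝ))) * Real.exp (7 * ‖z‖ ^ (3 / 2 : ℝ)) * 1 := by
          gcongr
          · refine (hbd z hz'.le).trans ?_
            gcongr
            have h1 := Complex.abs_im_le_norm z
            have h2 := le_rpow_three_half hz4
            have h3 : 0 ≤ |z.im| := abs_nonneg _
            nlinarith [Real.pi_lt_four]
          · have h1 := Complex.re_le_norm (stirlingT z)
            have h2 := norm_stirlingT_le_rpow hz4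
            linarith
          · apply Real.exp_le_one_iff.2
            have : 0 ≤ ε * z.re := by positivity
            linarith
      _ = _ := by rw [mul_one, mul_assoc, ← Real.exp_add]; congr 2; ring
  · rw [tendsto_zero_iff_norm_tendsto_zero]
    refine squeeze_zero' (Eventually.of_forall fun _ => norm_nonneg _) ?_
      (tendsto_poly_mul_exp hε 2)
    filter_upwards [eventually_ge_atTop 2] with x hx
    rw [hnf, stirlingT_re, Complex.arg_ofReal_of_nonneg (by linarith)]
    have h0 : 0 < Real.Gamma (1 / 2 + x) := Real.Gamma_pos_of_pos (by linarith)
    have h1 : ‖(Complex.Gamma (1 / 2 + (x : ℂ)))⁻¹‖ = (Real.Gamma (1 / 2 + x))⁻¹ := by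
      have : (1 / 2 + (x : ℂ)) = ((1 / 2 + x : ℝ) : ℂ) := by push_cast; ring
      rw [this, Complex.Gamma_ofReal, norm_inv, Complex.norm_real, Real.norm_of_nonneg h0.le]
    have h2 := le_Gamma_half_add hx
    simp only [Complex.ofReal_re, Complex.ofReal_im, Complex.norm_real, zero_mul, sub_zero,
      Real.norm_of_nonneg (show 0 ≤ x by linarith)]
    rw [h1]
    calc _ ≤ (Real.Gamma (1 / 2 + x))⁻¹ * (2 * x * x * Real.Gamma (1 / 2 + x)) *
          Real.exp (-(ε * x)) := by gcongr
      _ = _ := by field_simp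
  · intro y
    rw [hnf, stirlingT_mul_I_re]
    have h := le_norm_Gamma_half_add_I y
    push_cast at h
    simp only [Complex.mul_re, Complex.ofReal_re, Complex.I_re, mul_zero,
      Complex.ofReal_im, Complex.I_im, mul_one, sub_self, neg_zero, Real.exp_zero]
    rw [norm_inv, inv_mul_le_iff₀ (lt_of_lt_of_le (Real.exp_pos _) h), mul_one]
    exact h

theorem stirlingT_re_neg (v : ℂ) :
    (stirlingT (-v)).re = -(stirlingT v).re - π * |v.im| := by
  rw [stirlingT_re, stirlingT_re]
  simp only [Complex.neg_re, Complex.neg_im, norm_neg]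
  rcases lt_trichotomy v.im 0 with h | h | h
  · rw [Complex.arg_neg_eq_arg_add_pi_of_im_neg h, abs_of_neg h]; ring
  · rw [h]; simp; ring
  · rw [Complex.arg_neg_eq_arg_sub_pi_of_im_pos h, abs_of_pos h]; ring

theorem stirlingT_re_conj (v : ℂ) :
    (stirlingT ((starRingEnd ℂ) v)).re = (stirlingT v).re := by
  rw [stirlingT_re, stirlingT_re, Complex.arg_conj]
  split_ifs with h
  · have : v.im = 0 := by
      rw [Complex.arg_eq_pi_iff] at h; exact h.2
    simp [this]
  · simp

theorem stirlingT_re_real_mul {c : ℝ} (hc : 0 < c) (v : ℂ) :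
    (stirlingT (c * v)).re = c * (stirlingT v).re + c * Real.log c * v.re := by
  rcases eq_or_ne v 0 with rfl | hv
  · simp [stirlingT]
  rw [stirlingT_re, stirlingT_re, Complex.arg_real_mul _ hc, norm_mul, Complex.norm_real,
    Real.norm_of_nonneg hc.le, Real.log_mul hc.ne' (norm_ne_zero_iff.2 hv)]
  simp only [Complex.mul_re, Complex.ofReal_re, Complex.ofReal_im, zero_mul, sub_zero,
    Complex.mul_im, add_zero]
  ring

theorem inv_Gamma_half_add (v : ℂ) (hv : v.re ≤ 0) :
    (Complex.Gamma (1 / 2 + v))⁻¹ = Complex.Gamma (1 / 2 + -v) * Complex.cos (π * v) / π := by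
  have h := Complex.Gamma_mul_Gamma_one_sub (1 / 2 + v)
  have e1 : 1 - (1 / 2 + v) = 1 / 2 + -v := by ring
  have e2 : Complex.sin (π * (1 / 2 + v)) = Complex.cos (π * v) := by
    rw [show (π : ℂ) * (1 / 2 + v) = π * v + π / 2 by ring, Complex.sin_add_pi_div_two]
  rw [e1, e2] at h
  have hne : Complex.Gamma (1 / 2 + -v) ≠ 0 :=
    Gamma_half_add_ne_zero (by rw [Complex.neg_re]; linarith)
  have hpi : (π : ℂ) ≠ 0 := by exact_mod_cast Real.pi_ne_zero
  by_cases hc : Complex.cos (π * v) = 0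
  · rw [hc, div_zero, mul_eq_zero] at h
    rw [h.resolve_right hne, hc]; simp
  · have h1 : Complex.Gamma (1 / 2 + v) ≠ 0 := by
      intro h0
      rw [h0, zero_mul] at h
      exact div_ne_zero hpi hc h.symm
    generalize Complex.Gamma (1 / 2 + v) = a at *
    generalize Complex.Gamma (1 / 2 + -v) = b at *
    rw [eq_div_iff hc] at h
    rw [inv_eq_iff_eq_inv, inv_div, eq_div_iff (mul_ne_zero hne hc)]
    linear_combination h

theorem norm_cos_pi_mul_le (v : ℂ) : ‖Complex.cos (π * v)‖ ≤ Real.exp (π * |v.im|) := by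
  rw [Complex.cos]
  have h1 : ‖Complex.exp (π * v * Complex.I)‖ ≤ Real.exp (π * |v.im|) := by
    rw [Complex.norm_exp]
    apply Real.exp_le_exp.2
    simp only [Complex.mul_re, Complex.mul_im, Complex.ofReal_re, Complex.ofReal_im, Complex.I_re,
      Complex.I_im]
    nlinarith [Real.pi_pos, neg_abs_le v.im]
  have h2 : ‖Complex.exp (-(π * v) * Complex.I)‖ ≤ Real.exp (π * |v.im|) := by
    rw [Complex.norm_exp]
    apply Real.exp_le_exp.2
    simp only [Complex.mul_re, Complex.mul_im, Complex.ofReal_re, Complex.ofReal_im, Complex.I_re,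
      Complex.I_im, Complex.neg_re, Complex.neg_im]
    nlinarith [Real.pi_pos, le_abs_self v.im]
  rw [norm_div, Complex.norm_ofNat]
  have := norm_add_le (Complex.exp (π * v * Complex.I)) (Complex.exp (-(π * v) * Complex.I))
  linarith

theorem norm_inv_Gamma_half_add_le_stirling (v : ℂ) :
    ‖(Complex.Gamma (1 / 2 + v))⁻¹‖ ≤ Real.exp (-(stirlingT v).re) := by
  rcases le_total 0 v.re with h | h
  · rw [norm_inv, Real.exp_neg]
    exact inv_anti₀ (Real.exp_pos _) (stirling_le_norm_Gamma_half_add h)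
  · rw [inv_Gamma_half_add v h, norm_div, norm_mul, Complex.norm_real,
      Real.norm_of_nonneg Real.pi_pos.le, div_le_iff₀ Real.pi_pos]
    have h1 := norm_Gamma_half_add_le_stirling (v := -v) (by rw [Complex.neg_re]; linarith)
    have h2 : √(2 * π) ≤ π := by
      rw [Real.sqrt_le_left Real.pi_pos.le]
      nlinarith [Real.pi_gt_three]
    calc _ ≤ (π * Real.exp (stirlingT (-v)).re) * Real.exp (π * |v.im|) := by
          gcongr
          · exact h1.trans (by gcongr)
          · exact norm_cos_pi_mul_le v
      _ = _ := by
          rw [mul_assoc, ← Real.exp_add, stirlingT_re_neg]; ring_nf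

theorem le_norm_inv_Gamma_half_add_of_nonneg {v : ℂ} (hv : 0 ≤ v.re) :
    (√(2 * π))⁻¹ * Real.exp (-(stirlingT v).re) ≤ ‖(Complex.Gamma (1 / 2 + v))⁻¹‖ := by
  rw [norm_inv, Real.exp_neg, ← mul_inv]
  exact inv_anti₀ (norm_pos_iff.2 (Gamma_half_add_ne_zero hv)) (norm_Gamma_half_add_le_stirling hv)

theorem le_norm_inv_Gamma_half_add_of_nonpos {v : ℂ} (hv : v.re ≤ 0) {c : ℝ}
    (hc : c * Real.exp (π * |v.im|) ≤ ‖Complex.cos (π * v)‖) :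
    c / π * Real.exp (-(stirlingT v).re) ≤ ‖(Complex.Gamma (1 / 2 + v))⁻¹‖ := by
  rw [inv_Gamma_half_add v hv, norm_div, norm_mul, Complex.norm_real,
      Real.norm_of_nonneg Real.pi_pos.le, div_mul_eq_mul_div]
  refine div_le_div_of_nonneg_right ?_ Real.pi_pos.le
  have h1 := stirling_le_norm_Gamma_half_add (v := -v) (by rw [Complex.neg_re]; linarith)
  calc _ = Real.exp (stirlingT (-v)).re * (c * Real.exp (π * |v.im|)) := by
        rw [mul_left_comm, ← Real.exp_add, stirlingT_re_neg]; ring_nf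
    _ ≤ _ := by
        refine (mul_le_mul_of_nonneg_left hc (Real.exp_pos _).le).trans ?_
        gcongr

theorem sq_norm_cos (v : ℂ) :
    ‖Complex.cos v‖ ^ 2 = Real.cos v.re ^ 2 + Real.sinh v.im ^ 2 := by
  rw [← Complex.normSq_eq_norm_sq, Complex.normSq_apply]
  have h : Complex.cos v = (Real.cos v.re * Real.cosh v.im : ℝ) +
      (-(Real.sin v.re * Real.sinh v.im) : ℝ) * Complex.I := by
    conv_lhs => rw [← Complex.re_add_im v, Complex.cos_add_mul_I]
    push_cast; ring
  rw [h]
  simp only [Complex.add_re, Complex.add_im, Complex.ofReal_re, Complex.ofReal_im, Complex.mul_re,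
    Complex.mul_im, Complex.I_re, Complex.I_im]
  have h1 := Real.sin_sq_add_cos_sq v.re
  have h2 := Real.cosh_sq v.im
  linear_combination Real.cos v.re ^ 2 * h2 + Real.sinh v.im ^ 2 * h1

/-- In a sector around the positive real axis without the axis itself, the cosine grows at the
full exponential rate. -/
theorem exists_le_norm_cos {k : ℝ} (hk : 0 < k) : ∃ c > 0, ∀ v : ℂ, 0 ≤ v.re → v.re ≤ k * |v.im| →
    c * Real.exp |v.im| ≤ ‖Complex.cos v‖ := by
  set ε : ℝ := min 1 (1 / k) with hε
  have hε0 : 0 < ε := by positivity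
  have hε1 : ε ≤ 1 := min_le_left _ _
  have hεk : k * ε ≤ 1 := by
    have : ε ≤ 1 / k := min_le_right _ _
    rw [le_div_iff₀ hk] at this; linarith
  have h1e : Real.exp (-(2 * ε)) < 1 := by rw [Real.exp_lt_one_iff]; linarith
  refine ⟨min (Real.cos 1 * Real.exp (-1)) ((1 - Real.exp (-(2 * ε))) / 2),
    lt_min (mul_pos Real.cos_one_pos (Real.exp_pos _)) (by linarith), fun v h0 h1 => ?_⟩
  have hs := sq_norm_cos v
  rcases le_total |v.im| ε with h | h
  · have hre : v.re ≤ 1 := h1.trans ((mul_le_mul_of_nonneg_left h hk.le).trans hεk)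
    have hcos : Real.cos 1 ≤ Real.cos v.re :=
      Real.cos_le_cos_of_nonneg_of_le_pi h0 (by linarith [Real.pi_gt_three]) hre
    calc _ ≤ Real.cos 1 * Real.exp (-1) * Real.exp 1 :=
          mul_le_mul (min_le_left _ _) (Real.exp_le_exp.2 (h.trans hε1)) (Real.exp_pos _).le
            (mul_pos Real.cos_one_pos (Real.exp_pos _)).le
      _ = Real.cos 1 := by rw [mul_assoc, ← Real.exp_add]; simp
      _ ≤ Real.cos v.re := hcos
      _ ≤ _ := by
          apply le_of_sq_le_sq _ (norm_nonneg _)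
          rw [hs]; nlinarith [sq_nonneg (Real.sinh v.im)]
  · have hsinh : Real.sinh |v.im| ^ 2 = Real.sinh v.im ^ 2 := by
      rw [← Real.abs_sinh, sq_abs]
    calc _ ≤ (1 - Real.exp (-(2 * ε))) / 2 * Real.exp |v.im| :=
          mul_le_mul_of_nonneg_right (min_le_right _ _) (Real.exp_pos _).le
      _ ≤ Real.sinh |v.im| := by
          rw [Real.sinh_eq]
          have : Real.exp (-|v.im|) = Real.exp |v.im| * Real.exp (-(2 * |v.im|)) := by
            rw [← Real.exp_add]; ring_nf
          rw [this]
          have h3 : Real.exp (-(2 * |v.im|)) ≤ Real.exp (-(2 * ε)) := by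
            gcongr
          nlinarith [Real.exp_pos |v.im|]
      _ ≤ _ := by
          apply le_of_sq_le_sq _ (norm_nonneg _)
          rw [hs, hsinh]; nlinarith [sq_nonneg (Real.cos v.re)]

theorem Gamma_add_natCast {v : ℂ} (hv : 0 < v.re) (k : ℕ) :
    Complex.Gamma (v + k) = (∏ i ∈ Finset.range k, (v + i)) * Complex.Gamma v := by
  induction k with
  | zero => simp
  | succ k ih =>
    have h : v + k ≠ 0 := by
      intro h
      have := congrArg Complex.re h
      simp at this
      have : (0 : ℝ) ≤ k := k.cast_nonneg
      linarith
    rw [Finset.prod_range_succ, Nat.cast_succ, ← add_assoc, Complex.Gamma_add_one _ h, ih]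
    ring

theorem half_add_re_pos {v : ℂ} (hv : 0 ≤ v.re) : 0 < (1 / 2 + v).re := by
  rw [Complex.add_re, show (1 / 2 : ℂ).re = 1 / 2 by norm_num]
  linarith

/-- The Stirling approximation of `‖Γ(1/2 + n w)‖`. -/
noncomputable def stirlingE (n : ℕ) (w : ℂ) : ℝ :=
  Real.exp (n * (stirlingT w).re + n * Real.log n * w.re)

theorem stirlingE_pos (n : ℕ) (w : ℂ) : 0 < stirlingE n w := Real.exp_pos _

theorem exp_stirlingT_natCast_mul {n : ℕ} (hn : 1 ≤ n) (w : ℂ) :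
    Real.exp (stirlingT (n * w)).re = stirlingE n w := by
  have := stirlingT_re_real_mul (c := n) (by exact_mod_cast hn) w
  push_cast at this
  rw [this, stirlingE]

theorem norm_Gamma_half_add_natCast_le {n : ℕ} (hn : 1 ≤ n) {w : ℂ} (hw : 0 ≤ w.re) (k : ℕ) :
    ‖Complex.Gamma (1 / 2 + n * w + k)‖ ≤
      √(2 * π) * (k : ℝ) ^ k * (n * (1 + ‖w‖)) ^ k * stirlingE n w := by
  have hn0 : (1 : ℝ) ≤ n := by exact_mod_cast hn
  have hre : 0 ≤ ((n : ℂ) * w).re := by simp; positivity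
  rw [Gamma_add_natCast (half_add_re_pos hre), norm_mul, norm_prod,
    ← exp_stirlingT_natCast_mul hn]
  have h1 : ∏ i ∈ Finset.range k, ‖1 / 2 + (n : ℂ) * w + i‖ ≤
      (k : ℝ) ^ k * (n * (1 + ‖w‖)) ^ k := by
    rw [← mul_pow]
    refine (Finset.prod_le_prod (g := fun _ => k * (n * (1 + ‖w‖))) (fun _ _ => norm_nonneg _)
      fun i hi => ?_).trans_eq (by simp)
    have hi' : (i : ℝ) + 1 ≤ k := by exact_mod_cast Finset.mem_range.1 hi
    have hi0 : (0 : ℝ) ≤ i := i.cast_nonneg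
    calc ‖1 / 2 + (n : ℂ) * w + i‖ ≤ ‖(1 / 2 : ℂ)‖ + ‖(n : ℂ) * w‖ + ‖(i : ℂ)‖ := norm_add₃_le
      _ = 1 / 2 + n * ‖w‖ + i := by simp
      _ ≤ (i + 1) * (n * (1 + ‖w‖)) := by
          have : 0 ≤ ‖w‖ := norm_nonneg w
          have h3 : 0 ≤ n * ‖w‖ := by positivity
          nlinarith [mul_nonneg hi0 h3, mul_nonneg hi0 (sub_nonneg.2 hn0)]
      _ ≤ _ := by gcongr
  calc _ ≤ ((k : ℝ) ^ k * (n * (1 + ‖w‖)) ^ k) * (√(2 * π) * Real.exp (stirlingT (n * w)).re) :=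
        mul_le_mul h1 (norm_Gamma_half_add_le_stirling hre) (norm_nonneg _) (by positivity)
    _ = _ := by ring

theorem le_norm_Gamma_half_add_natCast {n : ℕ} (hn : 1 ≤ n) {w : ℂ} (hw : 0 ≤ w.re) (k : ℕ) :
    (max (1 / 2) (n * w.re)) ^ k * stirlingE n w ≤ ‖Complex.Gamma (1 / 2 + n * w + k)‖ := by
  have hre : 0 ≤ ((n : ℂ) * w).re := by simp; positivity
  rw [Gamma_add_natCast (half_add_re_pos hre), norm_mul, norm_prod,
    ← exp_stirlingT_natCast_mul hn]
  refine mul_le_mul ?_ (stirling_le_norm_Gamma_half_add hre) (Real.exp_pos _).le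
    (Finset.prod_nonneg fun _ _ => norm_nonneg _)
  rw [← Finset.card_range k, ← Finset.prod_const, Finset.card_range]
  refine Finset.prod_le_prod (fun _ _ => by positivity) fun i _ => ?_
  refine le_trans ?_ (Complex.re_le_norm _)
  have hi0 : (0 : ℝ) ≤ i := i.cast_nonneg
  have h2 : (1 / 2 + (n : ℂ) * w + i).re = 1 / 2 + n * w.re + i := by simp
  have h3 : 0 ≤ n * w.re := by positivity
  rw [h2]
  exact max_le (by linarith) (by linarith)

/-- The one-variable factor of the integrand. -/
noncomputable def factorTU (M : ℕ) (ν : ℕ → ℕ) (κ n : ℕ) (s : ℂ) : ℂ :=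
  (∏ j ∈ Finset.range (M + 1), Complex.Gamma (s + (ν j : ℂ) + 1)) *
    (Complex.Gamma (s - (n : ℂ) + 1))⁻¹ * (Complex.Gamma (s + (n : ℂ) + (κ : ℂ)))⁻¹

theorem integrandTU_eq (M : ℕ) (ν : ℕ → ℕ) (κ n : ℕ) (x y : ℝ) (s t : ℂ) :
    integrandTU M ν κ n x y s t = factorTU M ν κ n s * (factorTU M ν κ n t)⁻¹ *
      Complex.exp (t * Real.log x) * Complex.exp (-(s + 1) * Real.log y) / (s - t) := by
  rw [integrandTU, factorTU, factorTU, Finset.prod_div_distrib]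
  simp only [mul_inv, inv_inv]
  ring

/-- The real part of the phase function. -/
noncomputable def phaseG (M : ℕ) (x0 : ℝ) (w : ℂ) : ℝ :=
  w.re * Real.log x0 + (stirlingT (w - 1)).re + (stirlingT (w + 1)).re -
    (M + 1) * (stirlingT w).re

theorem stirlingE_eq (M : ℕ) (x0 : ℝ) {n : ℕ} (w : ℂ) :
    stirlingE n w ^ (M + 1) * Real.exp (-(n * (stirlingT (w - 1)).re + n * Real.log n * (w.re - 1))) *
      (stirlingE n (w + 1))⁻¹ =
    Real.exp (-(n * phaseG M x0 w) + n * w.re * (Real.log x0 + (M - 1) * Real.log n)) := by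
  rw [stirlingE, stirlingE, ← Real.exp_nat_mul, ← Real.exp_neg, ← Real.exp_add, ← Real.exp_add,
    phaseG]
  congr 1
  simp only [Complex.add_re, Complex.one_re]
  push_cast
  ring

theorem factorTU_half (M : ℕ) (ν : ℕ → ℕ) {κ : ℕ} (hκ : 1 ≤ κ) (n : ℕ) (w : ℂ) :
    factorTU M ν κ n (n * w - 1 / 2) =
      (∏ j ∈ Finset.range (M + 1), Complex.Gamma (1 / 2 + n * w + (ν j : ℕ))) *
      (Complex.Gamma (1 / 2 + n * (w - 1)))⁻¹ *
      (Complex.Gamma (1 / 2 + n * (w + 1) + (κ - 1 : ℕ)))⁻¹ := by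
  rw [factorTU]
  push_cast [Nat.cast_sub hκ]
  congr 3
  · funext j
    ring_nf
  · ring_nf
  · ring_nf

theorem exists_norm_factorTU_le (M : ℕ) (ν : ℕ → ℕ) {κ : ℕ} (hκ : 1 ≤ κ) (x0 : ℝ) :
    ∃ C > 0, ∀ n : ℕ, 1 ≤ n → ∀ w : ℂ, 0 ≤ w.re →
      ‖factorTU M ν κ n (n * w - 1 / 2)‖ * (n : ℝ) ^ (κ - 1) ≤
        C * (n * (1 + ‖w‖)) ^ (∑ j ∈ Finset.range (M + 1), ν j) *
        Real.exp (-(n * phaseG M x0 w) + n * w.re * (Real.log x0 + (M - 1) * Real.log n)) := by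
  refine ⟨∏ j ∈ Finset.range (M + 1), (√(2 * π) * (ν j : ℝ) ^ ν j), Finset.prod_pos fun j _ => ?_,
    fun n hn w hw => ?_⟩
  · rcases Nat.eq_zero_or_pos (ν j) with h | h
    · rw [h]; simp; positivity
    · positivity
  have hn0 : (1 : ℝ) ≤ n := by exact_mod_cast hn
  rw [factorTU_half M ν hκ, norm_mul, norm_mul, norm_prod]
  have h1 : ∏ j ∈ Finset.range (M + 1), ‖Complex.Gamma (1 / 2 + n * w + (ν j : ℕ))‖ ≤
      (∏ j ∈ Finset.range (M + 1), (√(2 * π) * (ν j : ℝ) ^ ν j)) *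
        (n * (1 + ‖w‖)) ^ (∑ j ∈ Finset.range (M + 1), ν j) * stirlingE n w ^ (M + 1) := by
    refine (Finset.prod_le_prod (fun _ _ => norm_nonneg _)
      fun j _ => norm_Gamma_half_add_natCast_le hn hw (ν j)).trans_eq ?_
    rw [Finset.prod_mul_distrib, Finset.prod_mul_distrib, Finset.prod_pow_eq_pow_sum]
    simp
  have h2 : ‖(Complex.Gamma (1 / 2 + n * (w - 1)))⁻¹‖ ≤
      Real.exp (-(n * (stirlingT (w - 1)).re + n * Real.log n * (w.re - 1))) := by
    refine (norm_inv_Gamma_half_add_le_stirling _).trans_eq ?_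
    rw [Real.exp_neg, exp_stirlingT_natCast_mul hn, Real.exp_neg, stirlingE]
    simp
  have h3 : ‖(Complex.Gamma (1 / 2 + n * (w + 1) + (κ - 1 : ℕ)))⁻¹‖ * (n : ℝ) ^ (κ - 1) ≤
      (stirlingE n (w + 1))⁻¹ := by
    have hw1 : 0 ≤ (w + 1).re := by simp; linarith
    have h := le_norm_Gamma_half_add_natCast hn hw1 (κ - 1)
    have hE := stirlingE_pos n (w + 1)
    have h4 : (n : ℝ) ^ (κ - 1) * stirlingE n (w + 1) ≤
        ‖Complex.Gamma (1 / 2 + n * (w + 1) + (κ - 1 : ℕ))‖ := by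
      refine le_trans ?_ h
      gcongr
      refine le_trans ?_ (le_max_right _ _)
      simp only [Complex.add_re, Complex.one_re]
      nlinarith
    have hpos : 0 < ‖Complex.Gamma (1 / 2 + n * (w + 1) + (κ - 1 : ℕ))‖ :=
      lt_of_lt_of_le (by positivity) h4
    rw [norm_inv, inv_mul_le_iff₀ hpos, ← div_eq_mul_inv, le_div_iff₀ hE]
    exact h4
  rw [mul_assoc]
  calc _ ≤ ((∏ j ∈ Finset.range (M + 1), (√(2 * π) * (ν j : ℝ) ^ ν j)) *
        (n * (1 + ‖w‖)) ^ (∑ j ∈ Finset.range (M + 1), ν j) * stirlingE n w ^ (M + 1)) *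
        Real.exp (-(n * (stirlingT (w - 1)).re + n * Real.log n * (w.re - 1))) *
        (stirlingE n (w + 1))⁻¹ := by
        have := stirlingE_pos n w
        have hnn : (0 : ℝ) ≤ ∏ j ∈ Finset.range (M + 1), (√(2 * π) * (ν j : ℝ) ^ ν j) :=
          Finset.prod_nonneg fun _ _ => by positivity
        gcongr
    _ = _ := by
        rw [← stirlingE_eq]
        ring

theorem exists_le_norm_factorTU (M : ℕ) (ν : ℕ → ℕ) {κ : ℕ} (hκ : 1 ≤ κ) (x0 : ℝ) {B c : ℝ}
    (hB : 0 < B) (hc : 0 < c) :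
    ∃ C > 0, ∀ n : ℕ, 1 ≤ n → ∀ w : ℂ, 0 ≤ w.re → ‖w‖ ≤ B →
      c * Real.exp (-(stirlingT (n * (w - 1))).re) ≤ ‖(Complex.Gamma (1 / 2 + n * (w - 1)))⁻¹‖ →
      C * (max (1 / 2) (n * w.re)) ^ (∑ j ∈ Finset.range (M + 1), ν j) *
        Real.exp (-(n * phaseG M x0 w) + n * w.re * (Real.log x0 + (M - 1) * Real.log n)) ≤
      ‖factorTU M ν κ n (n * w - 1 / 2)‖ * (n : ℝ) ^ (κ - 1) := by
  have hd : (0 : ℝ) < √(2 * π) * ((κ - 1 : ℕ) : ℝ) ^ (κ - 1) * (2 + B) ^ (κ - 1) := by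
    rcases Nat.eq_zero_or_pos (κ - 1) with h | h
    · rw [h]; simp; positivity
    · positivity
  refine ⟨c * (√(2 * π) * ((κ - 1 : ℕ) : ℝ) ^ (κ - 1) * (2 + B) ^ (κ - 1))⁻¹, by positivity,
    fun n hn w hw hwB hG => ?_⟩
  set D := √(2 * π) * ((κ - 1 : ℕ) : ℝ) ^ (κ - 1) * (2 + B) ^ (κ - 1) with hD
  have hn0 : (1 : ℝ) ≤ n := by exact_mod_cast hn
  rw [factorTU_half M ν hκ, norm_mul, norm_mul, norm_prod]
  have h1 : (max (1 / 2) (n * w.re)) ^ (∑ j ∈ Finset.range (M + 1), ν j) *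
      stirlingE n w ^ (M + 1) ≤
      ∏ j ∈ Finset.range (M + 1), ‖Complex.Gamma (1 / 2 + n * w + (ν j : ℕ))‖ := by
    refine le_trans (le_of_eq ?_) (Finset.prod_le_prod (fun j _ => ?_)
      fun j _ => le_norm_Gamma_half_add_natCast hn hw (ν j))
    · rw [Finset.prod_mul_distrib, Finset.prod_pow_eq_pow_sum]
      simp
    · have := stirlingE_pos n w
      positivity
  have h2 : c * Real.exp (-(n * (stirlingT (w - 1)).re + n * Real.log n * (w.re - 1))) ≤
      ‖(Complex.Gamma (1 / 2 + n * (w - 1)))⁻¹‖ := by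
    refine le_trans (le_of_eq ?_) hG
    rw [Real.exp_neg, Real.exp_neg (stirlingT _).re, exp_stirlingT_natCast_mul hn, stirlingE]
    simp
  have h3 : D⁻¹ * (stirlingE n (w + 1))⁻¹ ≤
      ‖(Complex.Gamma (1 / 2 + n * (w + 1) + (κ - 1 : ℕ)))⁻¹‖ * (n : ℝ) ^ (κ - 1) := by
    have hw1 : 0 ≤ (w + 1).re := by simp; linarith
    have h := norm_Gamma_half_add_natCast_le hn hw1 (κ - 1)
    have hE := stirlingE_pos n (w + 1)
    have hpos : 0 < ‖Complex.Gamma (1 / 2 + n * (w + 1) + (κ - 1 : ℕ))‖ := by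
      refine lt_of_lt_of_le ?_ (le_norm_Gamma_half_add_natCast hn hw1 (κ - 1))
      positivity
    rw [norm_inv, ← mul_inv, inv_mul_eq_div, ← one_div, div_le_div_iff₀ (by positivity) hpos, one_mul]
    refine h.trans ?_
    rw [mul_pow]
    have h5 : 1 + ‖w + 1‖ ≤ 2 + B := by
      have := norm_add_le w 1
      rw [norm_one] at this
      linarith
    calc _ ≤ √(2 * π) * ((κ - 1 : ℕ) : ℝ) ^ (κ - 1) * ((n : ℝ) ^ (κ - 1) * (2 + B) ^ (κ - 1)) *
          stirlingE n (w + 1) := by gcongr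
      _ = _ := by rw [hD]; ring
  calc _ = ((max (1 / 2) (n * w.re)) ^ (∑ j ∈ Finset.range (M + 1), ν j) *
        stirlingE n w ^ (M + 1)) *
        (c * Real.exp (-(n * (stirlingT (w - 1)).re + n * Real.log n * (w.re - 1)))) *
        (D⁻¹ * (stirlingE n (w + 1))⁻¹) := by
        rw [← stirlingE_eq]
        ring
    _ ≤ (∏ j ∈ Finset.range (M + 1), ‖Complex.Gamma (1 / 2 + n * w + (ν j : ℕ))‖) *
        ‖(Complex.Gamma (1 / 2 + n * (w - 1)))⁻¹‖ *
        (‖(Complex.Gamma (1 / 2 + n * (w + 1) + (κ - 1 : ℕ)))⁻¹‖ * (n : ℝ) ^ (κ - 1)) := by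
        have h4 := stirlingE_pos n (w + 1)
        have h5 : (0 : ℝ) ≤ ∏ j ∈ Finset.range (M + 1),
            ‖Complex.Gamma (1 / 2 + n * w + (ν j : ℕ))‖ :=
          Finset.prod_nonneg fun _ _ => norm_nonneg _
        exact mul_le_mul (mul_le_mul h1 h2 (by positivity) h5) h3 (by positivity)
          (mul_nonneg h5 (norm_nonneg _))
    _ = _ := by ring

/-- The squared modulus of the steepest descent arc at angle `α`: it equals
`sin ((M+1) α) / sin ((M-1) α)`, written with Chebyshev polynomials to include `α = 0`. -/
noncomputable def arcS (M : ℕ) (α : ℝ) : ℝ :=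
  (Polynomial.Chebyshev.U ℝ M).eval (Real.cos α) /
    (Polynomial.Chebyshev.U ℝ ((M : ℤ) - 2)).eval (Real.cos α)

/-- The modulus of the steepest descent arc at angle `α`. -/
noncomputable def arcR (M : ℕ) (α : ℝ) : ℝ := √(arcS M α)

/-- The half-opening of the steepest descent arc. -/
noncomputable def arcMax (M : ℕ) : ℝ := π / (M + 1)

/-- The steepest descent arc. -/
noncomputable def arcZ (M : ℕ) (α : ℝ) : ℂ := arcR M α * Complex.exp (α * Complex.I)

/-- The velocity of the steepest descent arc. -/
noncomputable def arcZ' (M : ℕ) (α : ℝ) : ℂ :=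
  (deriv (arcR M) α + arcR M α * Complex.I) * Complex.exp (α * Complex.I)

section Arc

variable {M : ℕ}

theorem arcS_neg (α : ℝ) : arcS M (-α) = arcS M α := by simp [arcS]

theorem arcR_neg (α : ℝ) : arcR M (-α) = arcR M α := by simp [arcR, arcS_neg]

theorem arcZ_re (α : ℝ) : (arcZ M α).re = arcR M α * Real.cos α := by
  rw [arcZ, Complex.re_ofReal_mul, Complex.exp_ofReal_mul_I_re]

theorem arcZ_im (α : ℝ) : (arcZ M α).im = arcR M α * Real.sin α := by
  rw [arcZ, Complex.im_ofReal_mul, Complex.exp_ofReal_mul_I_im]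

theorem arcZ_neg (α : ℝ) : arcZ M (-α) = (starRingEnd ℂ) (arcZ M α) := by
  apply Complex.ext <;> simp [arcZ_re, arcZ_im, arcR_neg]

theorem arcR_nonneg (α : ℝ) : 0 ≤ arcR M α := Real.sqrt_nonneg _

theorem norm_arcZ (α : ℝ) : ‖arcZ M α‖ = arcR M α := by
  rw [arcZ, norm_mul, Complex.norm_exp_ofReal_mul_I, mul_one, Complex.norm_real,
    Real.norm_of_nonneg (arcR_nonneg α)]

theorem norm_arcZ'_le (α : ℝ) : ‖arcZ' M α‖ ≤ |deriv (arcR M) α| + arcR M α := by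
  rw [arcZ', norm_mul, Complex.norm_exp_ofReal_mul_I, mul_one]
  refine (norm_add_le _ _).trans_eq ?_
  rw [norm_mul, Complex.norm_I, mul_one, Complex.norm_real, Complex.norm_real,
    Real.norm_of_nonneg (arcR_nonneg α), Real.norm_eq_abs]

variable (hM : 2 ≤ M)
include hM

theorem arcMax_pos : 0 < arcMax M := by unfold arcMax; positivity

theorem arcMax_mul : arcMax M * (M + 1) = π := by unfold arcMax; field_simp

theorem arcMax_le : arcMax M ≤ π / 3 := by
  have : (2 : ℝ) ≤ M := by exact_mod_cast hM
  unfold arcMax; gcongr; linarith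

theorem sin_pos_of_le_arcMax {α : ℝ} (h : α ∈ Ioc 0 (arcMax M)) :
    0 < Real.sin α ∧ 0 < Real.sin ((M - 1) * α) ∧ 0 < Real.sin (2 * α) ∧ 0 < Real.cos α := by
  have h2 : (2 : ℝ) ≤ M := by exact_mod_cast hM
  have h3 := arcMax_le hM
  have h4 := arcMax_mul hM
  have hp := Real.pi_pos
  obtain ⟨h0, h1⟩ := h
  refine ⟨Real.sin_pos_of_pos_of_lt_pi h0 (by linarith), Real.sin_pos_of_pos_of_lt_pi
    (mul_pos (by linarith) h0) ?_, Real.sin_pos_of_pos_of_lt_pi (by linarith) (by linarith),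
    Real.cos_pos_of_mem_Ioo ⟨by linarith, by linarith⟩⟩
  have : α * (M + 1) ≤ π := h4 ▸ mul_le_mul_of_nonneg_right h1 (by linarith)
  nlinarith

theorem sin_add_one_pos {α : ℝ} (h : α ∈ Ioo 0 (arcMax M)) : 0 < Real.sin ((M + 1) * α) := by
  have h4 := arcMax_mul hM
  refine Real.sin_pos_of_pos_of_lt_pi (mul_pos (by positivity) h.1) ?_
  rw [← h4, mul_comm]
  exact mul_lt_mul_of_pos_right h.2 (by positivity)

omit hM in
theorem U_sub_two_eval_cos (α : ℝ) :
    (Polynomial.Chebyshev.U ℝ ((M : ℤ) - 2)).eval (Real.cos α) * Real.sin α =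
      Real.sin ((M - 1) * α) := by
  rw [Polynomial.Chebyshev.U_real_cos]
  push_cast
  ring_nf

omit hM in
theorem U_eval_cos (α : ℝ) :
    (Polynomial.Chebyshev.U ℝ (M : ℤ)).eval (Real.cos α) * Real.sin α =
      Real.sin ((M + 1) * α) := by
  rw [Polynomial.Chebyshev.U_real_cos]
  push_cast
  ring_nf

theorem U_sub_two_pos {α : ℝ} (h : α ∈ Icc (-arcMax M) (arcMax M)) :
    0 < (Polynomial.Chebyshev.U ℝ ((M : ℤ) - 2)).eval (Real.cos α) := by
  have key : ∀ β ∈ Ioc 0 (arcMax M),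
      0 < (Polynomial.Chebyshev.U ℝ ((M : ℤ) - 2)).eval (Real.cos β) := by
    intro β hβ
    have h1 := sin_pos_of_le_arcMax hM hβ
    have h2 := U_sub_two_eval_cos (M := M) β
    rw [← h2] at h1
    exact pos_of_mul_pos_left h1.2.1 h1.1.le
  rcases lt_trichotomy α 0 with h0 | h0 | h0
  · rw [← Real.cos_neg]
    exact key _ ⟨by linarith, by linarith [h.1]⟩
  · rw [h0, Real.cos_zero, Polynomial.Chebyshev.U_eval_one]
    have : (2 : ℝ) ≤ M := by exact_mod_cast hM
    push_cast; linarith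
  · exact key _ ⟨h0, h.2⟩

theorem arcS_eq {α : ℝ} (h : α ∈ Ioc 0 (arcMax M)) :
    arcS M α = Real.sin ((M + 1) * α) / Real.sin ((M - 1) * α) := by
  have h1 := (sin_pos_of_le_arcMax hM h).1
  rw [arcS, ← U_eval_cos, ← U_sub_two_eval_cos, mul_div_mul_right _ _ h1.ne']

omit hM in
theorem arcS_zero : arcS M 0 = (M + 1) / (M - 1) := by
  rw [arcS, Real.cos_zero, Polynomial.Chebyshev.U_eval_one, Polynomial.Chebyshev.U_eval_one]
  push_cast; ring

theorem arcS_arcMax : arcS M (arcMax M) = 0 := by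
  rw [arcS_eq hM ⟨arcMax_pos hM, le_rfl⟩, mul_comm _ (arcMax M), arcMax_mul hM, Real.sin_pi,
    zero_div]

theorem arcS_pos {α : ℝ} (h : α ∈ Ioo (-arcMax M) (arcMax M)) : 0 < arcS M α := by
  have key : ∀ β ∈ Ioo 0 (arcMax M), 0 < arcS M β := fun β hβ => by
    rw [arcS_eq hM ⟨hβ.1, hβ.2.le⟩]
    exact div_pos (sin_add_one_pos hM hβ) (sin_pos_of_le_arcMax hM ⟨hβ.1, hβ.2.le⟩).2.1
  rcases lt_trichotomy α 0 with h0 | h0 | h0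
  · rw [← arcS_neg]
    exact key _ ⟨by linarith, by linarith [h.1]⟩
  · rw [h0, arcS_zero]
    have : (2 : ℝ) ≤ M := by exact_mod_cast hM
    exact div_pos (by linarith) (by linarith)
  · exact key _ ⟨h0, h.2⟩

theorem arcR_pos {α : ℝ} (h : α ∈ Ioo (-arcMax M) (arcMax M)) : 0 < arcR M α :=
  Real.sqrt_pos.2 (arcS_pos hM h)

theorem arcR_arcMax : arcR M (arcMax M) = 0 := by rw [arcR, arcS_arcMax hM, Real.sqrt_zero]

theorem continuousOn_arcR : ContinuousOn (arcR M) (Icc (-arcMax M) (arcMax M)) := by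
  refine Real.continuous_sqrt.comp_continuousOn (ContinuousOn.div ?_ ?_ fun α hα =>
    (U_sub_two_pos hM hα).ne')
  · exact (Polynomial.continuous_eval₂ _ _ |>.comp Real.continuous_cos).continuousOn
  · exact (Polynomial.continuous_eval₂ _ _ |>.comp Real.continuous_cos).continuousOn

theorem hasDerivAt_arcR {α : ℝ} (h : α ∈ Ioo (-arcMax M) (arcMax M)) :
    HasDerivAt (arcR M) (deriv (arcR M) α) α := by
  refine DifferentiableAt.hasDerivAt (DifferentiableAt.sqrt ?_ (arcS_pos hM h).ne')
  refine DifferentiableAt.div ?_ ?_ (U_sub_two_pos hM ⟨h.1.le, h.2.le⟩).ne'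
  · exact ((Polynomial.differentiable _).comp Real.differentiable_cos) α
  · exact ((Polynomial.differentiable _).comp Real.differentiable_cos) α

theorem hasDerivAt_arcZ {α : ℝ} (h : α ∈ Ioo (-arcMax M) (arcMax M)) :
    HasDerivAt (arcZ M) (arcZ' M α) α := by
  have h1 : HasDerivAt (fun a : ℝ => Complex.exp (a * Complex.I))
      (Complex.exp (α * Complex.I) * (1 * Complex.I)) α :=
    ((Complex.ofRealCLM.hasDerivAt (x := α)).mul_const Complex.I).cexp
  refine ((hasDerivAt_arcR hM h).ofReal_comp.mul h1).congr_deriv ?_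
  rw [arcZ']; ring

theorem continuousOn_arcZ : ContinuousOn (arcZ M) (Icc (-arcMax M) (arcMax M)) :=
  (Complex.continuous_ofReal.comp_continuousOn (continuousOn_arcR hM)).mul (by fun_prop)

/-- The modulus of the arc decreases with the angle. -/
theorem deriv_arcR_neg {α : ℝ} (h : α ∈ Ioo 0 (arcMax M)) : deriv (arcR M) α < 0 := by
  have h2 : (2 : ℝ) ≤ M := by exact_mod_cast hM
  have hB := (sin_pos_of_le_arcMax hM ⟨h.1, h.2.le⟩).2.1
  have hA := sin_add_one_pos hM h
  set F : ℝ → ℝ := fun a => (M + 1) * Real.cos ((M + 1) * a) * Real.sin ((M - 1) * a) -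
    (M - 1) * Real.cos ((M - 1) * a) * Real.sin ((M + 1) * a) with hF
  have hF' : ∀ a, HasDerivAt F (-(4 * M * (Real.sin ((M + 1) * a) * Real.sin ((M - 1) * a)))) a := by
    intro a
    have e1 : HasDerivAt (fun a : ℝ => (M + 1) * a) ((M : ℝ) + 1) a := by
      simpa using (hasDerivAt_id a).const_mul ((M : ℝ) + 1)
    have e2 : HasDerivAt (fun a : ℝ => (M - 1) * a) ((M : ℝ) - 1) a := by
      simpa using (hasDerivAt_id a).const_mul ((M : ℝ) - 1)
    refine (((e1.cos.const_mul _).mul e2.sin).sub ((e2.cos.const_mul _).mul e1.sin)).congr_deriv ?_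
    ring
  have hFneg : F α < 0 := by
    have hanti : StrictAntiOn F (Icc 0 α) := by
      refine strictAntiOn_of_deriv_neg (convex_Icc _ _)
        (fun a _ => (hF' a).continuousAt.continuousWithinAt) fun a ha => ?_
      rw [interior_Icc] at ha
      rw [(hF' a).deriv]
      have h3 := sin_add_one_pos hM (α := a) ⟨ha.1, ha.2.trans h.2⟩
      have h4 := (sin_pos_of_le_arcMax hM (α := a) ⟨ha.1, (ha.2.trans h.2).le⟩).2.1
      have : 0 < 4 * M * (Real.sin ((M + 1) * a) * Real.sin ((M - 1) * a)) := by positivity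
      linarith
    have := hanti ⟨le_rfl, h.1.le⟩ ⟨h.1.le, le_rfl⟩ h.1
    simpa [hF] using this
  have hS : HasDerivAt (arcS M) (F α / Real.sin ((M - 1) * α) ^ 2) α := by
    have e1 : HasDerivAt (fun a : ℝ => (M + 1) * a) ((M : ℝ) + 1) α := by
      simpa using (hasDerivAt_id α).const_mul ((M : ℝ) + 1)
    have e2 : HasDerivAt (fun a : ℝ => (M - 1) * a) ((M : ℝ) - 1) α := by
      simpa using (hasDerivAt_id α).const_mul ((M : ℝ) - 1)
    have := (e1.sin.div e2.sin hB.ne').congr_of_eventuallyEq (f₁ := arcS M) (by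
      filter_upwards [Ioo_mem_nhds h.1 h.2] with a ha
      rw [arcS_eq hM ⟨ha.1, ha.2.le⟩]; rfl)
    refine this.congr_deriv ?_
    rw [hF]; ring
  have hα : α ∈ Ioo (-arcMax M) (arcMax M) := ⟨by linarith [arcMax_pos hM, h.1], h.2⟩
  have hR := hS.sqrt (arcS_pos hM hα).ne'
  have : deriv (arcR M) α = F α / Real.sin ((M - 1) * α) ^ 2 / (2 * √(arcS M α)) := hR.deriv
  rw [this]
  exact div_neg_of_neg_of_pos (div_neg_of_neg_of_pos hFneg (by positivity))
    (mul_pos two_pos (arcR_pos hM hα))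

omit hM in
theorem deriv_arcR_neg_eq (α : ℝ) : deriv (arcR M) (-α) = -deriv (arcR M) α := by
  have : arcR M = fun a => arcR M (-a) := by funext a; rw [arcR_neg]
  conv_rhs => rw [this, deriv_comp_neg]
  simp

theorem intervalIntegrable_deriv_arcR :
    IntervalIntegrable (deriv (arcR M)) volume (-arcMax M) (arcMax M) := by
  have hp := arcMax_pos hM
  have h1 : IntervalIntegrable (deriv (arcR M)) volume 0 (arcMax M) := by
    have : IntervalIntegrable (fun a => -deriv (arcR M) a) volume 0 (arcMax M) := by
      refine intervalIntegral.intervalIntegrable_deriv_of_nonneg (g := fun a => -arcR M a) ?_ ?_ ?_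
      · rw [uIcc_of_le hp.le]
        exact ((continuousOn_arcR hM).mono (Icc_subset_Icc (by linarith) le_rfl)).neg
      · rw [min_eq_left hp.le, max_eq_right hp.le]
        exact fun x hx => (hasDerivAt_arcR hM ⟨by linarith [hx.1], hx.2⟩).neg
      · rw [min_eq_left hp.le, max_eq_right hp.le]
        exact fun x hx => by linarith [deriv_arcR_neg hM hx]
    simpa [Pi.neg_def] using this.neg
  refine IntervalIntegrable.trans (b := 0) ?_ h1
  have h2 := (IntervalIntegrable.iff_comp_neg (by simp)).1 h1
  simp only [deriv_arcR_neg_eq, neg_zero] at h2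
  simpa [Pi.neg_def] using h2.neg.symm

theorem intervalIntegrable_arcZ' :
    IntervalIntegrable (arcZ' M) volume (-arcMax M) (arcMax M) := by
  have hp := arcMax_pos hM
  have h1 : IntervalIntegrable (fun a => ((deriv (arcR M) a : ℝ) : ℂ)) volume
      (-arcMax M) (arcMax M) := by
    have h := intervalIntegrable_deriv_arcR hM
    rw [intervalIntegrable_iff] at h ⊢
    exact h.ofReal
  refine (h1.add ?_).mul_continuousOn (by fun_prop)
  refine ContinuousOn.intervalIntegrable ?_
  rw [uIcc_of_le (by linarith)]
  exact (Complex.continuous_ofReal.comp_continuousOn (continuousOn_arcR hM)).mul continuousOn_const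

theorem hasDerivAt_arcZ_re {α : ℝ} (h : α ∈ Ioo (-arcMax M) (arcMax M)) :
    HasDerivAt (fun a => (arcZ M a).re) (arcZ' M α).re α :=
  Complex.reCLM.hasFDerivAt.comp_hasDerivAt α (hasDerivAt_arcZ hM h)

theorem hasDerivAt_arcZ_im {α : ℝ} (h : α ∈ Ioo (-arcMax M) (arcMax M)) :
    HasDerivAt (fun a => (arcZ M a).im) (arcZ' M α).im α :=
  Complex.imCLM.hasFDerivAt.comp_hasDerivAt α (hasDerivAt_arcZ hM h)

omit hM in
theorem arcZ'_re (α : ℝ) :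
    (arcZ' M α).re = deriv (arcR M) α * Real.cos α - arcR M α * Real.sin α := by
  rw [arcZ', Complex.mul_re, Complex.exp_ofReal_mul_I_re, Complex.exp_ofReal_mul_I_im]
  simp

omit hM in
theorem arcZ'_im (α : ℝ) :
    (arcZ' M α).im = deriv (arcR M) α * Real.sin α + arcR M α * Real.cos α := by
  rw [arcZ', Complex.mul_im, Complex.exp_ofReal_mul_I_re, Complex.exp_ofReal_mul_I_im]
  simp

theorem arcZ'_re_neg {α : ℝ} (h : α ∈ Ioo 0 (arcMax M)) : (arcZ' M α).re < 0 := by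
  have h1 := sin_pos_of_le_arcMax hM ⟨h.1, h.2.le⟩
  have h2 := arcR_pos hM (α := α) ⟨by linarith [arcMax_pos hM, h.1], h.2⟩
  have h3 := deriv_arcR_neg hM h
  rw [arcZ'_re]
  nlinarith [mul_neg_of_neg_of_pos h3 h1.2.2.2, mul_pos h2 h1.1]

theorem strictAntiOn_arcZ_re : StrictAntiOn (fun a => (arcZ M a).re) (Icc 0 (arcMax M)) := by
  have hp := arcMax_pos hM
  refine strictAntiOn_of_deriv_neg (convex_Icc _ _) ?_ fun a ha => ?_
  · exact Complex.continuous_re.comp_continuousOn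
      ((continuousOn_arcZ hM).mono (Icc_subset_Icc (by linarith) le_rfl))
  · rw [interior_Icc] at ha
    rw [(hasDerivAt_arcZ_re hM ⟨by linarith [ha.1], ha.2⟩).deriv]
    exact arcZ'_re_neg hM ha

theorem one_lt_arcZ_zero_re : 1 < (arcZ M 0).re := by
  have h2 : (2 : ℝ) ≤ M := by exact_mod_cast hM
  rw [arcZ_re, Real.cos_zero, mul_one, arcR, arcS_zero, Real.lt_sqrt zero_le_one, one_pow,
    lt_div_iff₀ (by linarith)]
  linarith

theorem arcZ_arcMax : arcZ M (arcMax M) = 0 := by rw [arcZ, arcR_arcMax hM]; simp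

theorem arcR_le {α : ℝ} (h : α ∈ Icc (-arcMax M) (arcMax M)) : arcR M α ≤ arcR M 0 := by
  have hp := arcMax_pos hM
  have key : AntitoneOn (arcR M) (Icc 0 (arcMax M)) := by
    refine antitoneOn_of_deriv_nonpos (convex_Icc _ _)
      ((continuousOn_arcR hM).mono (Icc_subset_Icc (by linarith) le_rfl)) ?_ ?_
    · rw [interior_Icc]
      exact fun x hx => (hasDerivAt_arcR hM ⟨by linarith [hx.1], hx.2⟩).differentiableAt.differentiableWithinAt
    · rw [interior_Icc]
      exact fun x hx => (deriv_arcR_neg hM hx).le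
  rcases le_total 0 α with h0 | h0
  · exact key ⟨le_rfl, hp.le⟩ ⟨h0, h.2⟩ h0
  · rw [← arcR_neg α]
    exact key ⟨le_rfl, hp.le⟩ ⟨by linarith, by linarith [h.1]⟩ (by linarith)

theorem arcZ_re_pos {α : ℝ} (h : α ∈ Ioo (-arcMax M) (arcMax M)) : 0 < (arcZ M α).re := by
  have h3 := arcMax_le hM
  have hp := Real.pi_pos
  rw [arcZ_re]
  exact mul_pos (arcR_pos hM h) (Real.cos_pos_of_mem_Ioo ⟨by linarith [h.1], by linarith [h.2]⟩)

theorem arcZ_im_pos {α : ℝ} (h : α ∈ Ioo 0 (arcMax M)) : 0 < (arcZ M α).im := by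
  rw [arcZ_im]
  exact mul_pos (arcR_pos hM ⟨by linarith [arcMax_pos hM, h.1], h.2⟩)
    (sin_pos_of_le_arcMax hM ⟨h.1, h.2.le⟩).1

end Arc

theorem phaseG_conj (M : ℕ) (x0 : ℝ) (w : ℂ) :
    phaseG M x0 ((starRingEnd ℂ) w) = phaseG M x0 w := by
  rw [phaseG, phaseG, stirlingT_re_conj, Complex.conj_re]
  have h1 : (starRingEnd ℂ) w - 1 = (starRingEnd ℂ) (w - 1) := by simp
  have h2 : (starRingEnd ℂ) w + 1 = (starRingEnd ℂ) (w + 1) := by simp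
  rw [h1, h2, stirlingT_re_conj, stirlingT_re_conj]

/-- The derivative of the complex phase. -/
noncomputable def phaseH' (M : ℕ) (x0 : ℝ) (w : ℂ) : ℂ :=
  Real.log x0 + Complex.log (w - 1) + Complex.log (w + 1) - (M + 1) * Complex.log w

theorem hasDerivAt_phaseG {M : ℕ} {x0 : ℝ} {γ : ℝ → ℂ} {γ' : ℂ} {t : ℝ} (hγ : HasDerivAt γ γ' t)
    (h : 0 < (γ t).im) :
    HasDerivAt (fun a => phaseG M x0 (γ a)) (γ' * phaseH' M x0 (γ t)).re t := by
  have h0 := (hasDerivAt_stirlingT (v := γ t) (Or.inr h.ne')).comp t hγ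
  have h1 := (hasDerivAt_stirlingT (v := γ t - 1) (Or.inr (by simpa using h.ne'))).comp t
    (hγ.sub_const 1)
  have h2 := (hasDerivAt_stirlingT (v := γ t + 1) (Or.inr (by simpa using h.ne'))).comp t
    (hγ.add_const 1)
  have h3 := ((hγ.mul_const (Real.log x0 : ℂ)).add h1).add h2
  have h4 := Complex.reCLM.hasFDerivAt.comp_hasDerivAt t (h3.sub (h0.const_mul ((M : ℂ) + 1)))
  refine (h4.congr_of_eventuallyEq (Eventually.of_forall fun a => ?_)).congr_deriv ?_
  · simp [phaseG]
  · simp only [phaseH', Complex.reCLM_apply]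
    ring_nf

theorem arg_sub_add_arg_add {w : ℂ} (hre : 0 < w.re) (him : 0 < w.im) :
    0 < Complex.arg (w - 1) + Complex.arg (w + 1) ∧
      Complex.arg (w - 1) + Complex.arg (w + 1) < π := by
  have h1 : 0 < (w - 1).im := by simpa using him
  have h2 : 0 < (w + 1).im := by simpa using him
  have a1 : 0 < Complex.arg (w - 1) :=
    lt_of_le_of_ne (Complex.arg_nonneg_iff.2 h1.le) fun h => by
      have := Complex.arg_eq_zero_iff.1 h.symm; linarith [this.2]
  have a2 : 0 < Complex.arg (w + 1) :=
    lt_of_le_of_ne (Complex.arg_nonneg_iff.2 h2.le) fun h => by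
      have := Complex.arg_eq_zero_iff.1 h.symm; linarith [this.2]
  refine ⟨by linarith, ?_⟩
  by_contra! hge
  have b1 := Complex.arg_le_pi (w - 1)
  have b2 := Complex.arg_le_pi (w + 1)
  have hsin : Real.sin (Complex.arg (w - 1) + Complex.arg (w + 1)) ≤ 0 := by
    have := Real.sin_nonneg_of_nonneg_of_le_pi
      (x := Complex.arg (w - 1) + Complex.arg (w + 1) - π) (by linarith) (by linarith)
    rw [Real.sin_sub_pi] at this
    linarith
  rw [Real.sin_add] at hsin
  have e1 := Complex.norm_mul_sin_arg (w - 1)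
  have e2 := Complex.norm_mul_sin_arg (w + 1)
  have e3 := Complex.norm_mul_cos_arg (w - 1)
  have e4 := Complex.norm_mul_cos_arg (w + 1)
  have key : ‖w - 1‖ * ‖w + 1‖ * (Real.sin (Complex.arg (w - 1)) * Real.cos (Complex.arg (w + 1)) +
      Real.cos (Complex.arg (w - 1)) * Real.sin (Complex.arg (w + 1))) = 2 * w.re * w.im := by
    calc _ = (‖w - 1‖ * Real.sin (Complex.arg (w - 1))) * (‖w + 1‖ * Real.cos (Complex.arg (w + 1))) +
        (‖w - 1‖ * Real.cos (Complex.arg (w - 1))) * (‖w + 1‖ * Real.sin (Complex.arg (w + 1))) := by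
          ring
      _ = _ := by
          rw [e1, e2, e3, e4]; simp; ring
  have : 0 < 2 * w.re * w.im := by positivity
  nlinarith [mul_nonneg (norm_nonneg (w - 1)) (norm_nonneg (w + 1))]

theorem log_sub_add_log_add {w : ℂ} (hre : 0 < w.re) (him : 0 < w.im) :
    Complex.log (w - 1) + Complex.log (w + 1) = Complex.log (w ^ 2 - 1) := by
  obtain ⟨h1, h2⟩ := arg_sub_add_arg_add hre him
  have n1 : w - 1 ≠ 0 := fun h => by
    have := congrArg Complex.im h; simp at this; linarith
  have n2 : w + 1 ≠ 0 := fun h => by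
    have := congrArg Complex.im h; simp at this; linarith
  rw [← Complex.log_mul n1 n2 ⟨by linarith [Real.pi_pos], h2.le⟩]
  ring_nf

section Phase

variable {M : ℕ}

/-- The logarithm of the value of `x0` whose saddle point has angle `α`. -/
noncomputable def saddleLog (M : ℕ) (α : ℝ) : ℝ :=
  (M + 1) / 2 * Real.log (Real.sin ((M + 1) * α)) -
    (M - 1) / 2 * Real.log (Real.sin ((M - 1) * α)) - Real.log (Real.sin (2 * α))

variable (hM : 2 ≤ M)
include hM

theorem arcR_sq {α : ℝ} (h : α ∈ Ioc 0 (arcMax M)) :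
    arcR M α ^ 2 = Real.sin ((M + 1) * α) / Real.sin ((M - 1) * α) := by
  have h1 : 0 ≤ arcS M α := by
    rcases h.2.lt_or_eq with h2 | h2
    · exact (arcS_pos hM ⟨by linarith [arcMax_pos hM, h.1], h2⟩).le
    · rw [h2, arcS_arcMax hM]
  rw [arcR, Real.sq_sqrt h1, arcS_eq hM h]

theorem arcZ_sq_sub_one {α : ℝ} (h : α ∈ Ioc 0 (arcMax M)) :
    arcZ M α ^ 2 - 1 = ((Real.sin (2 * α) / Real.sin ((M - 1) * α) : ℝ) : ℂ) *
      Complex.exp (((M + 1) * α : ℝ) * Complex.I) := by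
  have hB := (sin_pos_of_le_arcMax hM h).2.1
  have e : arcZ M α ^ 2 = ((Real.sin ((M + 1) * α) / Real.sin ((M - 1) * α) : ℝ) : ℂ) *
      Complex.exp ((2 * α : ℝ) * Complex.I) := by
    rw [arcZ, mul_pow, ← Complex.ofReal_pow, arcR_sq hM h, ← Complex.exp_nat_mul]
    push_cast; ring_nf
  have hsub : Real.sin ((M - 1) * α) = Real.sin ((M + 1) * α) * Real.cos (2 * α) -
      Real.cos ((M + 1) * α) * Real.sin (2 * α) := by
    rw [← Real.sin_sub]; ring_nf
  rw [e]
  apply Complex.ext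
  · rw [Complex.sub_re, Complex.re_ofReal_mul, Complex.re_ofReal_mul, Complex.exp_ofReal_mul_I_re,
      Complex.exp_ofReal_mul_I_re, Complex.one_re, div_mul_eq_mul_div, div_mul_eq_mul_div,
      div_sub_one hB.ne']
    congr 1
    rw [hsub]
    ring
  · rw [Complex.sub_im, Complex.im_ofReal_mul, Complex.im_ofReal_mul, Complex.exp_ofReal_mul_I_im,
      Complex.exp_ofReal_mul_I_im, Complex.one_im]
    ring

theorem phaseH'_arcZ {α : ℝ} (x0 : ℝ) (h : α ∈ Ioo 0 (arcMax M)) :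
    phaseH' M x0 (arcZ M α) = ((Real.log x0 - saddleLog M α : ℝ) : ℂ) := by
  have hα : α ∈ Ioo (-arcMax M) (arcMax M) := ⟨by linarith [arcMax_pos hM, h.1], h.2⟩
  obtain ⟨h1, h2, h3, h4⟩ := sin_pos_of_le_arcMax hM ⟨h.1, h.2.le⟩
  have hA := sin_add_one_pos hM h
  have hR := arcR_pos hM hα
  have hAm : (M + 1) * α < π := by
    rw [← arcMax_mul (M := M) hM, mul_comm]
    exact mul_lt_mul_of_pos_right h.2 (by positivity)
  have hAp : 0 < (M + 1) * α := mul_pos (by positivity) h.1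
  have hp := Real.pi_pos
  have hlogZ : Complex.log (arcZ M α) = (Real.log (arcR M α) : ℂ) + α * Complex.I := by
    rw [arcZ, Complex.log_ofReal_mul hR (Complex.exp_ne_zero _), Complex.log_exp]
    · simp; linarith [h.1]
    · simp; linarith [arcMax_le hM, h.2]
  have hlogR : Real.log (arcR M α) =
      1 / 2 * (Real.log (Real.sin ((M + 1) * α)) - Real.log (Real.sin ((M - 1) * α))) := by
    rw [← Real.log_div hA.ne' h2.ne', ← arcR_sq hM ⟨h.1, h.2.le⟩, Real.log_pow]
    push_cast; ring
  have him : (((M + 1) * α : ℝ) * Complex.I : ℂ).im = (M + 1) * α := by simp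
  rw [phaseH', add_assoc, log_sub_add_log_add (arcZ_re_pos hM hα) (arcZ_im_pos hM h),
    arcZ_sq_sub_one hM ⟨h.1, h.2.le⟩, Complex.log_ofReal_mul (div_pos h3 h2) (Complex.exp_ne_zero _),
    Complex.log_exp (by rw [him]; linarith) (by rw [him]; exact hAm.le), hlogZ, hlogR,
    Real.log_div h3.ne' h2.ne', saddleLog]
  push_cast
  ring

theorem strictAntiOn_saddleLog : StrictAntiOn (saddleLog M) (Ioo 0 (arcMax M)) := by
  have hm : (2 : ℝ) ≤ M := by exact_mod_cast hM
  have hd : ∀ α ∈ Ioo 0 (arcMax M), HasDerivAt (saddleLog M)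
      ((M + 1) / 2 * ((M + 1) * Real.cos ((M + 1) * α) / Real.sin ((M + 1) * α)) -
        (M - 1) / 2 * ((M - 1) * Real.cos ((M - 1) * α) / Real.sin ((M - 1) * α)) -
        2 * Real.cos (2 * α) / Real.sin (2 * α)) α := by
    intro α h
    obtain ⟨h1, h2, h3, h4⟩ := sin_pos_of_le_arcMax hM ⟨h.1, h.2.le⟩
    have hA := sin_add_one_pos hM h
    have e : ∀ c : ℝ, HasDerivAt (fun a : ℝ => c * a) c α := fun c => by
      simpa using (hasDerivAt_id α).const_mul c
    refine (((((e (M + 1)).sin.log hA.ne').const_mul _).sub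
      (((e (M - 1)).sin.log h2.ne').const_mul _)).sub ((e 2).sin.log h3.ne')).congr_deriv ?_
    ring
  refine strictAntiOn_of_deriv_neg (convex_Ioo _ _)
    (fun a ha => (hd a ha).continuousAt.continuousWithinAt) fun α hα => ?_
  rw [interior_Ioo] at hα
  rw [(hd α hα).deriv]
  obtain ⟨h1, h2, h3, h4⟩ := sin_pos_of_le_arcMax hM ⟨hα.1, hα.2.le⟩
  have hA := sin_add_one_pos hM hα
  have e1 : ((M : ℝ) + 1) * α = (M - 1) * α + 2 * α := by ring
  rw [e1] at hA ⊢
  generalize (M - 1) * α = B at *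
  generalize 2 * α = C at *
  have hs := Real.sin_add B C
  have hc := Real.cos_add B C
  have key : (((M : ℝ) + 1) ^ 2 * Real.cos (B + C) * Real.sin B * Real.sin C -
      ((M - 1) ^ 2 * Real.cos B * Real.sin C + 4 * Real.cos C * Real.sin B) * Real.sin (B + C)) =
      -(((M - 1) * Real.cos B * Real.sin C - 2 * Real.cos C * Real.sin B) ^ 2 +
        ((M + 1) * Real.sin B * Real.sin C) ^ 2) := by
    rw [hs, hc]; ring
  have hneg : -(((M - 1) * Real.cos B * Real.sin C - 2 * Real.cos C * Real.sin B) ^ 2 +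
        ((M + 1) * Real.sin B * Real.sin C) ^ 2) < 0 := by
    have : 0 < (M + 1) * Real.sin B * Real.sin C := by positivity
    nlinarith [sq_nonneg ((M - 1) * Real.cos B * Real.sin C - 2 * Real.cos C * Real.sin B)]
  rw [← key] at hneg
  have : ((M + 1) / 2 * ((M + 1) * Real.cos (B + C) / Real.sin (B + C)) -
        (M - 1) / 2 * ((M - 1) * Real.cos B / Real.sin B) - 2 * Real.cos C / Real.sin C) =
      (((M : ℝ) + 1) ^ 2 * Real.cos (B + C) * Real.sin B * Real.sin C -
      ((M - 1) ^ 2 * Real.cos B * Real.sin C + 4 * Real.cos C * Real.sin B) * Real.sin (B + C)) /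
      (2 * Real.sin (B + C) * Real.sin B * Real.sin C) := by
    field_simp
    ring
  rw [this]
  exact div_neg_of_neg_of_pos hneg (by positivity)

theorem hasDerivAt_phaseG_arcZ {α : ℝ} (x0 : ℝ) (h : α ∈ Ioo 0 (arcMax M)) :
    HasDerivAt (fun a => phaseG M x0 (arcZ M a))
      ((arcZ' M α).re * (Real.log x0 - saddleLog M α)) α := by
  refine (hasDerivAt_phaseG (hasDerivAt_arcZ hM ⟨by linarith [arcMax_pos hM, h.1], h.2⟩)
    (arcZ_im_pos hM h)).congr_deriv ?_
  rw [phaseH'_arcZ hM x0 h, Complex.re_mul_ofReal]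

variable {β x0 : ℝ} (hβ : β ∈ Ioo 0 (arcMax M)) (hx0 : Real.log x0 = saddleLog M β)
include hβ hx0

theorem strictMonoOn_phaseG_arcZ : StrictMonoOn (fun a => phaseG M x0 (arcZ M a)) (Ioc 0 β) := by
  have hd : ∀ α ∈ Ioc 0 β, _ := fun α hα =>
    hasDerivAt_phaseG_arcZ hM x0 (α := α) ⟨hα.1, hα.2.trans_lt hβ.2⟩
  refine strictMonoOn_of_deriv_pos (convex_Ioc _ _)
    (fun a ha => (hd a ha).continuousAt.continuousWithinAt) fun α hα => ?_
  rw [interior_Ioc] at hα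
  have hα' : α ∈ Ioo 0 (arcMax M) := ⟨hα.1, hα.2.trans hβ.2⟩
  rw [(hd α ⟨hα.1, hα.2.le⟩).deriv, hx0]
  exact mul_pos_of_neg_of_neg (arcZ'_re_neg hM hα')
    (sub_neg.2 (strictAntiOn_saddleLog hM hα' hβ hα.2))

theorem strictAntiOn_phaseG_arcZ :
    StrictAntiOn (fun a => phaseG M x0 (arcZ M a)) (Ico β (arcMax M)) := by
  have hd : ∀ α ∈ Ico β (arcMax M), _ := fun α hα =>
    hasDerivAt_phaseG_arcZ hM x0 (α := α) ⟨hβ.1.trans_le hα.1, hα.2⟩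
  refine strictAntiOn_of_deriv_neg (convex_Ico _ _)
    (fun a ha => (hd a ha).continuousAt.continuousWithinAt) fun α hα => ?_
  rw [interior_Ico] at hα
  have hα' : α ∈ Ioo 0 (arcMax M) := ⟨hβ.1.trans hα.1, hα.2⟩
  rw [(hd α ⟨hα.1.le, hα.2⟩).deriv, hx0]
  exact mul_neg_of_neg_of_pos (arcZ'_re_neg hM hα')
    (sub_pos.2 (strictAntiOn_saddleLog hM hβ hα' hα.1))

end Phase

theorem phaseH'_im (M : ℕ) (x0 : ℝ) (w : ℂ) : (phaseH' M x0 w).im =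
    Complex.arg (w - 1) + Complex.arg (w + 1) - (M + 1) * Complex.arg w := by
  have : ((M : ℂ) + 1) = ((M + 1 : ℝ) : ℂ) := by push_cast; rfl
  rw [phaseH', this]
  simp only [Complex.sub_im, Complex.add_im, Complex.im_ofReal_mul, Complex.log_im,
    Complex.ofReal_im, zero_add]

theorem arg_mem_Ioo {w : ℂ} (hre : 0 < w.re) (him : 0 < w.im) :
    Complex.arg w ∈ Ioo 0 (π / 2) := by
  refine ⟨lt_of_le_of_ne (Complex.arg_nonneg_iff.2 him.le) fun h => ?_,
    (abs_lt.1 (Complex.abs_arg_lt_pi_div_two_iff.2 (Or.inl hre))).2⟩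
  linarith [(Complex.arg_eq_zero_iff.1 h.symm).2]

theorem norm_mul_sin_phaseH'_im (M : ℕ) (x0 : ℝ) {w : ℂ} (hre : 0 < w.re) (him : 0 < w.im) :
    ‖w ^ 2 - 1‖ * Real.sin (phaseH' M x0 w).im =
      Real.sin ((M + 1) * Complex.arg w) - ‖w‖ ^ 2 * Real.sin ((M - 1) * Complex.arg w) := by
  have hS : Complex.arg (w - 1) + Complex.arg (w + 1) = Complex.arg (w ^ 2 - 1) := by
    have := congrArg Complex.im (log_sub_add_log_add hre him)
    simpa [Complex.log_im] using this
  rw [phaseH'_im, hS]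
  set θ := Complex.arg w
  have h1 : ((w ^ 2 - 1) * Complex.exp ((-((M + 1) * θ) : ℝ) * Complex.I)).im =
      ‖w ^ 2 - 1‖ * Real.sin (Complex.arg (w ^ 2 - 1) - (M + 1) * θ) := by
    conv_lhs => rw [← Complex.norm_mul_exp_arg_mul_I (w ^ 2 - 1)]
    rw [mul_assoc, ← Complex.exp_add, ← add_mul, ← Complex.ofReal_add, Complex.im_ofReal_mul,
      Complex.exp_ofReal_mul_I_im, sub_eq_add_neg _ ((M + 1) * θ)]
  rw [← h1, sub_mul, one_mul, Complex.sub_im, Complex.exp_ofReal_mul_I_im, Real.sin_neg]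
  have h2 : w ^ 2 = ((‖w‖ ^ 2 : ℝ) : ℂ) * Complex.exp ((2 * θ : ℝ) * Complex.I) := by
    conv_lhs => rw [← Complex.norm_mul_exp_arg_mul_I w]
    rw [mul_pow, ← Complex.exp_nat_mul]
    simp only [θ]
    push_cast; ring_nf
  rw [h2, mul_assoc, ← Complex.exp_add, ← add_mul, ← Complex.ofReal_add, Complex.im_ofReal_mul,
      Complex.exp_ofReal_mul_I_im, show 2 * θ + -((M + 1) * θ) = -((M - 1) * θ) by ring,
      Real.sin_neg]
  ring

section Vertical

variable {M : ℕ} (hM : 2 ≤ M)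
include hM

theorem phaseH'_im_pos (x0 : ℝ) {w : ℂ} (hre : 0 < w.re) (him : 0 < w.im)
    (h : Complex.arg w < arcMax M) (hw : ‖w‖ < arcR M (Complex.arg w)) :
    0 < (phaseH' M x0 w).im := by
  have hθ := arg_mem_Ioo hre him
  have key := norm_mul_sin_phaseH'_im M x0 hre him
  have hsq := arcR_sq hM ⟨hθ.1, h.le⟩
  have hB := (sin_pos_of_le_arcMax hM ⟨hθ.1, h.le⟩).2.1
  rw [eq_div_iff hB.ne'] at hsq
  have hlt : ‖w‖ ^ 2 < arcR M (Complex.arg w) ^ 2 := by gcongr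
  have hpos : 0 < ‖w ^ 2 - 1‖ * Real.sin (phaseH' M x0 w).im := by
    rw [key, ← hsq]
    nlinarith
  have hsin : 0 < Real.sin (phaseH' M x0 w).im := pos_of_mul_pos_right hpos (norm_nonneg _)
  by_contra! hle
  have h1 : (M + 1) * Complex.arg w < π := by
    rw [← arcMax_mul (M := M) hM, mul_comm]
    exact mul_lt_mul_of_pos_right h (by positivity)
  have h2 := Real.sin_nonpos_of_nonpos_of_neg_pi_le hle (by
    rw [phaseH'_im]; linarith [(arg_sub_add_arg_add hre him).1])
  linarith

theorem phaseH'_im_neg (x0 : ℝ) {w : ℂ} (hre : 0 < w.re) (him : 0 < w.im)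
    (hw : Complex.arg w < arcMax M → arcR M (Complex.arg w) < ‖w‖) :
    (phaseH' M x0 w).im < 0 := by
  have hθ := arg_mem_Ioo hre him
  have hS := arg_sub_add_arg_add hre him
  rcases lt_or_ge (Complex.arg w) (arcMax M) with h | h
  · have key := norm_mul_sin_phaseH'_im M x0 hre him
    have hsq := arcR_sq hM ⟨hθ.1, h.le⟩
    have hB := (sin_pos_of_le_arcMax hM ⟨hθ.1, h.le⟩).2.1
    rw [eq_div_iff hB.ne'] at hsq
    have hlt : arcR M (Complex.arg w) ^ 2 < ‖w‖ ^ 2 := by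
      have := arcR_nonneg (M := M) (Complex.arg w)
      have := hw h
      gcongr
    by_contra! hge
    have h2 := Real.sin_nonneg_of_nonneg_of_le_pi hge (by
      rw [phaseH'_im]
      have : 0 < (M + 1) * Complex.arg w := mul_pos (by positivity) hθ.1
      linarith)
    have h3 := mul_nonneg (norm_nonneg (w ^ 2 - 1)) h2
    rw [key, ← hsq] at h3
    nlinarith
  · have h1 : π ≤ (M + 1) * Complex.arg w := by
      rw [← arcMax_mul (M := M) hM, mul_comm]
      gcongr
    rw [phaseH'_im]
    linarith

variable {β : ℝ} (x0 : ℝ) (hβ : β ∈ Ioo 0 (arcMax M))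
include hβ

omit hM hβ in
theorem hasDerivAt_phaseG_vertical (M : ℕ) (u : ℝ) {τ : ℝ} (h : 0 < τ) :
    HasDerivAt (fun a : ℝ => phaseG M x0 (u + a * Complex.I))
      (-(phaseH' M x0 (u + τ * Complex.I)).im) τ := by
  have : HasDerivAt (fun a : ℝ => (u : ℂ) + a * Complex.I) Complex.I τ := by
    simpa using ((Complex.ofRealCLM.hasDerivAt (x := τ)).mul_const Complex.I).const_add (u : ℂ)
  exact (hasDerivAt_phaseG this (by simpa using h)).congr_deriv (by simp)

theorem cos_arg_vertical {τ : ℝ} (hτ : 0 < τ) :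
    let w : ℂ := (arcZ M β).re + τ * Complex.I
    0 < w.re ∧ 0 < w.im ∧ ‖w‖ * Real.cos (Complex.arg w) = (arcZ M β).re := by
  have h := arcZ_re_pos hM (α := β) ⟨by linarith [hβ.1, hβ.2], hβ.2⟩
  refine ⟨by simpa using h, by simpa using hτ, ?_⟩
  rw [Complex.norm_mul_cos_arg]
  simp

theorem phaseH'_vertical_pos {τ : ℝ} (hτ : τ ∈ Ioo 0 (arcZ M β).im) :
    0 < (phaseH' M x0 ((arcZ M β).re + τ * Complex.I)).im := by
  obtain ⟨h1, h2, h3⟩ := cos_arg_vertical hM hβ hτ.1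
  set w : ℂ := (arcZ M β).re + τ * Complex.I with hw
  have hθ := arg_mem_Ioo h1 h2
  have hR := arcR_pos hM (α := β) ⟨by linarith [hβ.1, hβ.2], hβ.2⟩
  have hβ2 : β < π / 2 := by linarith [arcMax_le hM, hβ.2, Real.pi_pos]
  have hcβ : 0 < Real.cos β := Real.cos_pos_of_mem_Ioo ⟨by linarith [hβ.1, Real.pi_pos], hβ2⟩
  have hcθ : 0 < Real.cos (Complex.arg w) :=
    Real.cos_pos_of_mem_Ioo ⟨by linarith [hθ.1, Real.pi_pos], hθ.2⟩
  have hwn : ‖w‖ < arcR M β := by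
    rw [← norm_arcZ (M := M), ← sq_lt_sq₀ (norm_nonneg _) (norm_nonneg _), Complex.sq_norm,
      Complex.sq_norm, Complex.normSq_apply, Complex.normSq_apply]
    have a : w.re = (arcZ M β).re := by simp [hw]
    have b : w.im = τ := by simp [hw]
    rw [a, b]
    nlinarith [hτ.1, hτ.2]
  have hlt : Complex.arg w < β := by
    by_contra! hge
    have hpp := Real.pi_pos
    have := Real.strictAntiOn_cos.antitoneOn ⟨hβ.1.le, by linarith⟩ ⟨hθ.1.le, by linarith [hθ.2]⟩ hge
    rw [arcZ_re] at h3
    nlinarith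
  refine phaseH'_im_pos hM x0 h1 h2 (hlt.trans hβ.2) ?_
  have := strictAntiOn_arcZ_re hM ⟨hθ.1.le, hlt.le.trans hβ.2.le⟩ ⟨hβ.1.le, hβ.2.le⟩ hlt
  simp only at this
  rw [← h3, arcZ_re] at this
  exact lt_of_mul_lt_mul_right this hcθ.le

theorem phaseH'_vertical_neg {τ : ℝ} (hτ : (arcZ M β).im < τ) :
    (phaseH' M x0 ((arcZ M β).re + τ * Complex.I)).im < 0 := by
  have hσ := arcZ_im_pos hM hβ
  obtain ⟨h1, h2, h3⟩ := cos_arg_vertical hM hβ (hσ.trans hτ)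
  set w : ℂ := (arcZ M β).re + τ * Complex.I with hw
  have hθ := arg_mem_Ioo h1 h2
  have hR := arcR_pos hM (α := β) ⟨by linarith [hβ.1, hβ.2], hβ.2⟩
  have hβ2 : β < π / 2 := by linarith [arcMax_le hM, hβ.2, Real.pi_pos]
  have hcβ : 0 < Real.cos β := Real.cos_pos_of_mem_Ioo ⟨by linarith [hβ.1, Real.pi_pos], hβ2⟩
  have hcθ : 0 < Real.cos (Complex.arg w) :=
    Real.cos_pos_of_mem_Ioo ⟨by linarith [hθ.1, Real.pi_pos], hθ.2⟩
  have hwn : arcR M β < ‖w‖ := by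
    rw [← norm_arcZ (M := M), ← sq_lt_sq₀ (norm_nonneg _) (norm_nonneg _), Complex.sq_norm,
      Complex.sq_norm, Complex.normSq_apply, Complex.normSq_apply]
    have a : w.re = (arcZ M β).re := by simp [hw]
    have b : w.im = τ := by simp [hw]
    rw [a, b]
    nlinarith
  have hlt : β < Complex.arg w := by
    by_contra! hge
    have hpp := Real.pi_pos
    have := Real.strictAntiOn_cos.antitoneOn ⟨hθ.1.le, by linarith [hθ.2]⟩ ⟨hβ.1.le, by linarith⟩ hge
    rw [arcZ_re] at h3
    nlinarith
  refine phaseH'_im_neg hM x0 h1 h2 fun hm => ?_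
  have := strictAntiOn_arcZ_re hM ⟨hβ.1.le, hβ.2.le⟩ ⟨hθ.1.le, hm.le⟩ hlt
  simp only at this
  rw [← h3, arcZ_re] at this
  exact lt_of_mul_lt_mul_right this hcθ.le

theorem phaseG_vertical_ge_of_pos {τ : ℝ} (hτ : 0 < τ) :
    phaseG M x0 (arcZ M β) ≤ phaseG M x0 ((arcZ M β).re + τ * Complex.I) := by
  have hσ := arcZ_im_pos hM hβ
  conv_lhs => rw [← Complex.re_add_im (arcZ M β)]
  rcases le_total τ (arcZ M β).im with h | h
  · have := antitoneOn_of_deriv_nonpos (D := Ioc 0 (arcZ M β).im)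
      (f := fun a : ℝ => phaseG M x0 ((arcZ M β).re + a * Complex.I)) (convex_Ioc _ _)
      (fun a ha => (hasDerivAt_phaseG_vertical x0 M _ ha.1).continuousAt.continuousWithinAt)
      (fun a ha => by
        rw [interior_Ioc] at ha
        exact (hasDerivAt_phaseG_vertical x0 M _ ha.1).differentiableAt.differentiableWithinAt)
      (fun a ha => by
        rw [interior_Ioc] at ha
        rw [(hasDerivAt_phaseG_vertical x0 M _ ha.1).deriv]
        linarith [phaseH'_vertical_pos hM x0 hβ ha])
    exact this ⟨hτ, h⟩ ⟨hσ, le_rfl⟩ h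
  · have := monotoneOn_of_deriv_nonneg (D := Ici (arcZ M β).im)
      (f := fun a : ℝ => phaseG M x0 ((arcZ M β).re + a * Complex.I)) (convex_Ici _)
      (fun a ha => (hasDerivAt_phaseG_vertical x0 M _
        (hσ.trans_le ha)).continuousAt.continuousWithinAt)
      (fun a ha => by
        rw [interior_Ici] at ha
        exact (hasDerivAt_phaseG_vertical x0 M _
          (hσ.trans ha)).differentiableAt.differentiableWithinAt)
      (fun a ha => by
        rw [interior_Ici] at ha
        rw [(hasDerivAt_phaseG_vertical x0 M _ (hσ.trans ha)).deriv]
        linarith [phaseH'_vertical_neg hM x0 hβ ha])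
    exact this (mem_Ici.2 le_rfl) h h

omit hM hβ in
theorem phaseG_vertical_neg (M : ℕ) (u τ : ℝ) :
    phaseG M x0 (u + (-τ : ℝ) * Complex.I) = phaseG M x0 (u + τ * Complex.I) := by
  rw [← phaseG_conj]
  simp

theorem phaseG_vertical_ge {τ : ℝ} (hτ : τ ≠ 0) :
    phaseG M x0 (arcZ M β) ≤ phaseG M x0 ((arcZ M β).re + τ * Complex.I) := by
  rcases hτ.lt_or_gt with h | h
  · rw [← phaseG_vertical_neg]
    exact phaseG_vertical_ge_of_pos hM x0 hβ (by linarith)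
  · exact phaseG_vertical_ge_of_pos hM x0 hβ h

theorem exists_phaseG_vertical_growth : ∃ c > 0, ∃ K : ℝ, ∀ τ : ℝ, τ ≠ 0 →
    phaseG M x0 (arcZ M β) + c * |τ| - K ≤ phaseG M x0 ((arcZ M β).re + τ * Complex.I) := by
  have hp := Real.pi_pos
  have hm : (2 : ℝ) ≤ M := by exact_mod_cast hM
  have hc : 0 < Real.cos (5 * π / 12) := Real.cos_pos_of_mem_Ioo ⟨by linarith, by linarith⟩
  have hu := arcZ_re_pos hM (α := β) ⟨by linarith [hβ.1, hβ.2], hβ.2⟩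
  set τ1 := (arcZ M β).re / Real.cos (5 * π / 12) with hτ1
  have hτ1p : 0 < τ1 := by positivity
  have hd : ∀ τ, τ1 ≤ τ →
      (phaseH' M x0 ((arcZ M β).re + τ * Complex.I)).im ≤ -(π / 4) := by
    intro τ h
    obtain ⟨h1, h2, h3⟩ := cos_arg_vertical hM hβ (hτ1p.trans_le h)
    set w : ℂ := (arcZ M β).re + τ * Complex.I with hw
    have hθ := arg_mem_Ioo h1 h2
    have hn : τ ≤ ‖w‖ := by
      have := Complex.abs_im_le_norm w
      rw [show w.im = τ by simp [hw]] at this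
      exact (le_abs_self _).trans this
    have hge : 5 * π / 12 ≤ Complex.arg w := by
      by_contra! hlt
      have := Real.strictAntiOn_cos ⟨hθ.1.le, by linarith [hθ.2]⟩ ⟨by linarith, by linarith⟩ hlt
      have h4 : (arcZ M β).re = τ1 * Real.cos (5 * π / 12) := by rw [hτ1]; field_simp
      nlinarith
    rw [phaseH'_im]
    have := (arg_sub_add_arg_add h1 h2).2
    nlinarith
  have hpos : ∀ τ : ℝ, 0 < τ →
      phaseG M x0 (arcZ M β) + π / 4 * τ - π / 4 * τ1 ≤
        phaseG M x0 ((arcZ M β).re + τ * Complex.I) := by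
    intro τ h0
    rcases le_total τ τ1 with h | h
    · have := phaseG_vertical_ge_of_pos hM x0 hβ h0
      nlinarith
    · have h5 := monotoneOn_of_deriv_nonneg (D := Ici τ1)
        (f := fun a : ℝ => phaseG M x0 ((arcZ M β).re + a * Complex.I) - π / 4 * a) (convex_Ici _)
        (fun a ha => ((hasDerivAt_phaseG_vertical x0 M _ (hτ1p.trans_le ha)).sub
          ((hasDerivAt_id a).const_mul (π / 4))).continuousAt.continuousWithinAt)
        (fun a ha => by
          rw [interior_Ici] at ha
          exact ((hasDerivAt_phaseG_vertical x0 M _ (hτ1p.trans ha)).sub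
            ((hasDerivAt_id a).const_mul (π / 4))).differentiableAt.differentiableWithinAt)
        (fun a ha => by
          rw [interior_Ici] at ha
          have := ((hasDerivAt_phaseG_vertical x0 M (arcZ M β).re (hτ1p.trans ha)).sub
            ((hasDerivAt_id a).const_mul (π / 4))).deriv
          rw [show (fun a : ℝ => phaseG M x0 ((arcZ M β).re + a * Complex.I) - π / 4 * a) =
            (fun a : ℝ => phaseG M x0 ((arcZ M β).re + a * Complex.I)) -
              (fun y => π / 4 * id y) from rfl, this]
          linarith [hd a (le_of_lt ha)])
      have h6 := h5 (mem_Ici.2 le_rfl) h h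
      have := phaseG_vertical_ge_of_pos hM x0 hβ hτ1p
      simp only at h6
      linarith
  refine ⟨π / 4, by positivity, π / 4 * τ1, fun τ hτ => ?_⟩
  rcases hτ.lt_or_gt with h | h
  · rw [← phaseG_vertical_neg, abs_of_neg h]
    exact hpos _ (by linarith)
  · rw [abs_of_pos h]
    exact hpos _ h

omit hβ in
/-- A lower bound for the reciprocal Gamma function along the arc. -/
theorem exists_le_norm_inv_Gamma_arcZ : ∃ c > 0, ∀ n : ℕ, 1 ≤ n → ∀ α ∈ Ioo (-arcMax M) (arcMax M),
    α ≠ 0 → c * Real.exp (-(stirlingT (n * (arcZ M α - 1))).re) ≤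
      ‖(Complex.Gamma (1 / 2 + n * (arcZ M α - 1)))⁻¹‖ := by
  have hp := arcMax_pos hM
  have hle := arcMax_le hM
  have hpi := Real.pi_pos
  have hcont : ContinuousAt (fun a => (arcZ M a).re) 0 :=
    Complex.continuous_re.continuousAt.comp
      ((continuousOn_arcZ hM).continuousAt (Icc_mem_nhds (by linarith) hp))
  have hev := hcont.eventually (lt_mem_nhds (one_lt_arcZ_zero_re hM))
  obtain ⟨ε, hε, hball⟩ := Metric.eventually_nhds_iff.1 hev
  set δ := min ε (arcMax M) with hδ
  have hδp : 0 < δ := lt_min hε hp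
  have hδle : δ ≤ arcMax M := min_le_right _ _
  have hsδ : 0 < Real.sin δ := Real.sin_pos_of_pos_of_lt_pi hδp (by linarith)
  obtain ⟨c, hc, hcos⟩ := exists_le_norm_cos (k := 1 / Real.sin δ) (by positivity)
  refine ⟨min ((√(2 * π))⁻¹) (c / π), by positivity, fun n hn α hα hα0 => ?_⟩
  set E := Real.exp (-(stirlingT (n * (arcZ M α - 1))).re)
  have hE : 0 < E := Real.exp_pos _
  rcases le_or_gt 0 (n * (arcZ M α - 1) : ℂ).re with h | h
  · exact (mul_le_mul_of_nonneg_right (min_le_left _ _) hE.le).trans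
      (le_norm_inv_Gamma_half_add_of_nonneg h)
  · refine (mul_le_mul_of_nonneg_right (min_le_right _ _) hE.le).trans
      (le_norm_inv_Gamma_half_add_of_nonpos h.le ?_)
    have hn0 : (0 : ℝ) < n := by exact_mod_cast hn
    have hδα : δ ≤ |α| := by
      by_contra! hlt
      have : 1 < (arcZ M α).re := hball (by
        rw [Real.dist_eq, sub_zero]; exact hlt.trans_le (min_le_left _ _))
      have h' : (n * (arcZ M α - 1) : ℂ).re = n * ((arcZ M α).re - 1) := by simp
      rw [h'] at h
      nlinarith
    have hRpos := arcR_pos hM hα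
    have hsin : Real.sin δ * arcR M α ≤ |(arcZ M α).im| := by
      rw [arcZ_im, abs_mul, abs_of_pos hRpos, mul_comm]
      refine mul_le_mul_of_nonneg_left ?_ hRpos.le
      have habs : |α| ≤ π / 3 := (abs_le.2 ⟨hα.1.le, hα.2.le⟩).trans hle
      rw [Real.abs_sin_eq_sin_abs_of_abs_le_pi (by linarith)]
      exact Real.strictMonoOn_sin.monotoneOn ⟨by linarith, by linarith⟩
        ⟨by linarith [abs_nonneg α], by linarith⟩ hδα
    have e1 : ((π : ℂ) * (n * arcZ M α)).re = π * n * (arcZ M α).re := by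
      simp; ring
    have e2 : ((π : ℂ) * (n * arcZ M α)).im = π * n * (arcZ M α).im := by
      simp; ring
    have hre := arcZ_re_pos hM hα
    have := hcos (π * (n * arcZ M α)) (by rw [e1]; positivity) (by
      rw [e1, e2, abs_mul, abs_of_pos (mul_pos hpi hn0)]
      have : (arcZ M α).re ≤ 1 / Real.sin δ * |(arcZ M α).im| := by
        rw [div_mul_eq_mul_div, le_div_iff₀ hsδ, one_mul, mul_comm]
        refine le_trans (mul_le_mul_of_nonneg_left ?_ hsδ.le) hsin
        rw [← norm_arcZ]
        exact Complex.re_le_norm _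
      calc _ ≤ π * n * (1 / Real.sin δ * |(arcZ M α).im|) := by gcongr
        _ = _ := by ring)
    have e3 : (n * (arcZ M α - 1) : ℂ).im = n * (arcZ M α).im := by simp
    have e4 : (π : ℂ) * (n * (arcZ M α - 1)) = π * (n * arcZ M α) - n * π := by ring
    rw [e4, Complex.cos_antiperiodic.sub_nat_mul_eq, norm_mul, norm_pow, norm_neg, norm_one, one_pow, one_mul, e3]
    refine le_of_eq_of_le ?_ this
    rw [e2, mul_assoc, abs_mul π, abs_of_pos hpi]

end Vertical

/-- The half-plane `Re z > -1`. -/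
def halfPl : Set ℂ := {z | -1 < z.re}

theorem isOpen_halfPl : IsOpen halfPl := isOpen_lt continuous_const Complex.continuous_re

/-- A closed path in the half-plane `Re z > -1`, differentiable inside its parameter interval. -/
structure IsClosedPath (γ γ' : ℝ → ℂ) (a b : ℝ) : Prop where
  le : a ≤ b
  cont : ContinuousOn γ (Icc a b)
  hasDeriv : ∀ t ∈ Ioo a b, HasDerivAt γ (γ' t) t
  int : IntervalIntegrable γ' volume a b
  closed : γ a = γ b
  mem : ∀ t ∈ Icc a b, γ t ∈ halfPl

/-- The index of a path around a point, up to the factor `2 π i`. -/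
noncomputable def pathIndex (γ γ' : ℝ → ℂ) (a b : ℝ) (p : ℂ) : ℂ :=
  ∫ t in a..b, γ' t * (γ t - p)⁻¹

theorem exists_ball_of_isCompact {K : Set ℂ} (hK : IsCompact K) (h : K ⊆ halfPl) :
    ∃ (c : ℂ) (r : ℝ), K ⊆ Metric.ball c r ∧ Metric.ball c r ⊆ halfPl := by
  have hcont : ContinuousOn (fun z : ℂ => (‖z‖ ^ 2 - 1) / (2 * (z.re + 1))) K := by
    refine ContinuousOn.div (by fun_prop) (by fun_prop) fun z hz => ?_
    have : -1 < z.re := h hz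
    linarith
  obtain ⟨C, hC⟩ := (hK.image_of_continuousOn hcont).isBounded.bddAbove
  set c : ℝ := max 0 (C + 1) with hc
  have hc0 : 0 ≤ c := le_max_left _ _
  refine ⟨c, c + 1, fun z hz => ?_, fun z hz => ?_⟩
  · have hz1 : -1 < z.re := h hz
    have h1 : (‖z‖ ^ 2 - 1) / (2 * (z.re + 1)) < c := by
      have : (‖z‖ ^ 2 - 1) / (2 * (z.re + 1)) ≤ C := hC ⟨z, hz, rfl⟩
      linarith [le_max_right 0 (C + 1)]
    rw [div_lt_iff₀ (by linarith)] at h1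
    rw [mem_ball_iff_norm, ← sq_lt_sq₀ (norm_nonneg _) (by linarith)]
    rw [Complex.sq_norm, Complex.normSq_apply] at h1 ⊢
    simp only [Complex.sub_re, Complex.ofReal_re, Complex.sub_im, Complex.ofReal_im, sub_zero]
    nlinarith
  · rw [mem_ball_iff_norm] at hz
    have := (Complex.abs_re_le_norm (z - c)).trans_lt hz
    rw [Complex.sub_re, Complex.ofReal_re, abs_lt] at this
    show -1 < z.re
    linarith [this.1]

namespace IsClosedPath

variable {γ γ' : ℝ → ℂ} {a b : ℝ} (h : IsClosedPath γ γ' a b)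
include h

theorem integrable_mul {f : ℂ → ℂ} (hf : ∀ t ∈ Icc a b, ContinuousAt f (γ t)) :
    IntervalIntegrable (fun t => γ' t * f (γ t)) volume a b := by
  refine h.int.mul_continuousOn ?_
  rw [uIcc_of_le h.le]
  exact fun t ht => (hf t ht).comp_continuousWithinAt (h.cont t ht)

theorem integral_eq_zero {F : ℂ → ℂ} (hF : DifferentiableOn ℂ F halfPl) :
    ∫ t in a..b, γ' t * F (γ t) = 0 := by
  obtain ⟨c, r, h1, h2⟩ := exists_ball_of_isCompact (isCompact_Icc.image_of_continuousOn h.cont)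
    (by rintro _ ⟨t, ht, rfl⟩; exact h.mem t ht)
  obtain ⟨g, hg⟩ := (hF.mono h2).isExactOn_ball
  have hg' : ∀ t ∈ Icc a b, HasDerivAt g (F (γ t)) (γ t) := fun t ht => hg _ (h1 ⟨t, ht, rfl⟩)
  rw [intervalIntegral.integral_eq_sub_of_hasDerivAt_of_le h.le (f := g ∘ γ), Function.comp_apply,
    Function.comp_apply, h.closed, sub_self]
  · exact fun t ht => (hg' t ht).continuousAt.comp_continuousWithinAt (h.cont t ht)
  · intro t ht
    rw [mul_comm]
    exact (hg' t (Ioo_subset_Icc_self ht)).comp t (h.hasDeriv t ht)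
  · exact h.integrable_mul fun t ht =>
      (hF.differentiableAt (isOpen_halfPl.mem_nhds (h.mem t ht))).continuousAt

theorem integral_mul_inv_sub {N : ℂ → ℂ} (hN : DifferentiableOn ℂ N halfPl) {p : ℂ}
    (hp : p ∈ halfPl) (hγ : ∀ t ∈ Icc a b, γ t ≠ p) :
    ∫ t in a..b, γ' t * (N (γ t) * (γ t - p)⁻¹) = N p * pathIndex γ γ' a b p := by
  have hd := (Complex.differentiableOn_dslope (isOpen_halfPl.mem_nhds hp)).2 hN
  have h0 := h.integral_eq_zero hd
  have e : ∫ t in a..b, γ' t * (N (γ t) * (γ t - p)⁻¹) =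
      ∫ t in a..b, (γ' t * dslope N p (γ t) + N p * (γ' t * (γ t - p)⁻¹)) := by
    refine intervalIntegral.integral_congr fun t ht => ?_
    rw [uIcc_of_le h.le] at ht
    have hne := sub_ne_zero.2 (hγ t ht)
    rw [dslope_of_ne _ (hγ t ht), slope_def_field]
    field_simp
    ring
  rw [e, intervalIntegral.integral_add, h0, zero_add, intervalIntegral.integral_const_mul, pathIndex]
  · exact h.integrable_mul fun t ht =>
      (hd.differentiableAt (isOpen_halfPl.mem_nhds (h.mem t ht))).continuousAt
  · exact (h.integrable_mul (f := fun z => (z - p)⁻¹) fun t ht =>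
      ContinuousAt.inv₀ (by fun_prop) (sub_ne_zero.2 (hγ t ht))).const_mul _

end IsClosedPath

/-- The polynomial function `∏_{k<n} (t - k)`. -/
noncomputable def nodeP (n : ℕ) (t : ℂ) : ℂ := ∏ k ∈ Finset.range n, (t - k)

/-- The interpolant of `N` at the nodes `0, …, n-1`. -/
noncomputable def nodeL (n : ℕ) (N : ℂ → ℂ) : Polynomial ℂ :=
  Lagrange.interpolate (Finset.range n) (fun k => (k : ℂ)) (fun k => N k)

theorem injOn_natCast_range (n : ℕ) :
    Set.InjOn (fun k : ℕ => (k : ℂ)) (Finset.range n : Set ℕ) :=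
  fun _ _ _ _ hab => Nat.cast_injective hab

/-- The barycentric weights of the nodes `0, …, n-1`. -/
noncomputable def nodeW (n k : ℕ) : ℂ :=
  Lagrange.nodalWeight (Finset.range n) (fun k => (k : ℂ)) k

theorem nodeL_eval {n : ℕ} (N : ℂ → ℂ) {s : ℂ} (hs : ∀ k < n, s ≠ k) :
    (nodeL n N).eval s =
      nodeP n s * ∑ k ∈ Finset.range n, nodeW n k * (s - k)⁻¹ * N k := by
  rw [nodeL, Lagrange.eval_interpolate_not_at_node _ fun i hi => hs i (Finset.mem_range.1 hi),
    Lagrange.eval_nodal]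
  rfl

theorem nodeP_ne_zero {n : ℕ} {s : ℂ} (hs : ∀ k < n, s ≠ k) : nodeP n s ≠ 0 :=
  Finset.prod_ne_zero_iff.2 fun k hk => sub_ne_zero.2 (hs k (Finset.mem_range.1 hk))

theorem inv_nodeP {n : ℕ} (hn : 1 ≤ n) {s : ℂ} (hs : ∀ k < n, s ≠ k) :
    (nodeP n s)⁻¹ = ∑ k ∈ Finset.range n, nodeW n k * (s - k)⁻¹ := by
  have h := nodeL_eval (fun _ => 1) hs
  have h1 : nodeL n (fun _ => 1) = 1 :=
    Lagrange.interpolate_one (injOn_natCast_range n) ⟨0, Finset.mem_range.2 hn⟩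
  rw [h1, Polynomial.eval_one] at h
  simp only [mul_one] at h
  exact inv_eq_of_mul_eq_one_right h.symm

/-- The contour integral that appears in the double contour integral formula, computed through
the partial fraction decomposition of `1 / ∏ (t - k)`. -/
theorem IsClosedPath.integral_nodeP {γ γ' : ℝ → ℂ} {a b : ℝ} (h : IsClosedPath γ γ' a b)
    {N : ℂ → ℂ} (hN : DifferentiableOn ℂ N halfPl) {n : ℕ} (hn : 1 ≤ n)
    (hk : ∀ k < n, ∀ t ∈ Icc a b, γ t ≠ (k : ℕ))
    (hW : ∀ k < n, pathIndex γ γ' a b (k : ℕ) = 2 * π * Complex.I)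
    {s : ℂ} (hs : s ∈ halfPl) (hsγ : ∀ t ∈ Icc a b, γ t ≠ s) (hsk : ∀ k < n, s ≠ (k : ℕ)) :
    ∫ t in a..b, γ' t * (N (γ t) * (nodeP n (γ t))⁻¹ * (s - γ t)⁻¹) =
      (2 * π * Complex.I * (nodeL n N).eval s - N s * pathIndex γ γ' a b s) / nodeP n s := by
  have hNc : ∀ t ∈ Icc a b, ContinuousAt N (γ t) := fun t ht =>
    (hN.differentiableAt (isOpen_halfPl.mem_nhds (h.mem t ht))).continuousAt
  have h_int : ∀ p : ℂ, (∀ t ∈ Icc a b, γ t ≠ p) →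
      IntervalIntegrable (fun t => γ' t * (N (γ t) * (γ t - p)⁻¹)) volume a b := fun p hp =>
    h.integrable_mul (f := fun z => N z * (z - p)⁻¹) fun t ht =>
      (hNc t ht).mul (ContinuousAt.inv₀ (by fun_prop) (sub_ne_zero.2 (hp t ht)))
  have hkm : ∀ k : ℕ, (k : ℂ) ∈ halfPl := fun k => by
    show -1 < (k : ℂ).re
    rw [Complex.natCast_re]
    linarith [(k.cast_nonneg : (0 : ℝ) ≤ k)]
  have e : ∫ t in a..b, γ' t * (N (γ t) * (nodeP n (γ t))⁻¹ * (s - γ t)⁻¹) =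
      ∫ t in a..b, ∑ k ∈ Finset.range n, nodeW n k * (s - k)⁻¹ *
        (γ' t * (N (γ t) * (γ t - k)⁻¹) - γ' t * (N (γ t) * (γ t - s)⁻¹)) := by
    refine intervalIntegral.integral_congr fun t ht => ?_
    rw [uIcc_of_le h.le] at ht
    rw [inv_nodeP hn fun k hkn => hk k hkn t ht, Finset.mul_sum, Finset.sum_mul, Finset.mul_sum]
    refine Finset.sum_congr rfl fun k hkr => ?_
    have h1 := sub_ne_zero.2 (hk k (Finset.mem_range.1 hkr) t ht)
    have h2 := sub_ne_zero.2 (hsγ t ht)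
    have h3 := sub_ne_zero.2 (hsγ t ht).symm
    have h4 := sub_ne_zero.2 (hsk k (Finset.mem_range.1 hkr))
    have key : (γ t - k)⁻¹ * (s - γ t)⁻¹ = (s - k)⁻¹ * ((γ t - k)⁻¹ - (γ t - s)⁻¹) := by
      rw [← neg_sub s (γ t), inv_neg, sub_neg_eq_add]
      field_simp
      ring
    linear_combination γ' t * N (γ t) * nodeW n k * key
  rw [e, intervalIntegral.integral_finsetSum]
  · have e2 : ∀ k ∈ Finset.range n, ∫ t in a..b, nodeW n k * (s - k)⁻¹ *
        (γ' t * (N (γ t) * (γ t - k)⁻¹) - γ' t * (N (γ t) * (γ t - s)⁻¹)) =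
        2 * π * Complex.I * (nodeW n k * (s - k)⁻¹ * N k) -
          N s * pathIndex γ γ' a b s * (nodeW n k * (s - k)⁻¹) := by
      intro k hkr
      have hkn := Finset.mem_range.1 hkr
      rw [intervalIntegral.integral_const_mul,
        intervalIntegral.integral_sub (h_int _ (hk k hkn)) (h_int _ hsγ),
        h.integral_mul_inv_sub hN (hkm k) (hk k hkn), h.integral_mul_inv_sub hN hs hsγ, hW k hkn]
      ring
    rw [Finset.sum_congr rfl e2, Finset.sum_sub_distrib, ← Finset.mul_sum, ← Finset.mul_sum,
      ← inv_nodeP hn hsk, nodeL_eval N hsk]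
    have := nodeP_ne_zero hsk
    field_simp
  · intro k hkr
    exact ((h_int _ (hk k (Finset.mem_range.1 hkr))).sub (h_int _ hsγ)).const_mul _

/-- The part of the one-variable factor of the kernel without zeros. -/
noncomputable def gTU (M : ℕ) (ν : ℕ → ℕ) (κ n : ℕ) (s : ℂ) : ℂ :=
  (∏ j ∈ Finset.range M, Complex.Gamma (s + (ν (j + 1) : ℂ) + 1)) *
    (Complex.Gamma (s + (n : ℂ) + (κ : ℂ)))⁻¹

theorem inv_Gamma_sub_natCast (n : ℕ) (s : ℂ) :
    (Complex.Gamma (s - n + 1))⁻¹ = (Complex.Gamma (s + 1))⁻¹ * nodeP n s := by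
  induction n with
  | zero => simp [nodeP]
  | succ n ih =>
    have h : s - ((n + 1 : ℕ) : ℂ) + 1 = s - n := by push_cast; ring
    rw [h, Complex.one_div_Gamma_eq_self_mul_one_div_Gamma_add_one, ih, nodeP, nodeP,
      Finset.prod_range_succ]
    ring

theorem add_one_re_pos {s : ℂ} (hs : s ∈ halfPl) (k : ℕ) : 0 < (s + (k : ℂ) + 1).re := by
  have h : -1 < s.re := hs
  have := (k.cast_nonneg : (0 : ℝ) ≤ k)
  simp
  linarith

theorem add_add_re_pos {s : ℂ} (hs : s ∈ halfPl) {n : ℕ} (hn : 1 ≤ n) (κ : ℕ) :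
    0 < (s + (n : ℂ) + κ).re := by
  have h : -1 < s.re := hs
  have := (κ.cast_nonneg : (0 : ℝ) ≤ κ)
  have : (1 : ℝ) ≤ n := by exact_mod_cast hn
  simp
  linarith

theorem factorTU_eq_gTU (M : ℕ) {ν : ℕ → ℕ} (hν0 : ν 0 = 0) (κ n : ℕ) {s : ℂ} (hs : s ∈ halfPl) :
    factorTU M ν κ n s = gTU M ν κ n s * nodeP n s := by
  have h1 := Complex.Gamma_ne_zero_of_re_pos (add_one_re_pos hs 0)
  rw [factorTU, gTU, inv_Gamma_sub_natCast, Finset.prod_range_succ', hν0]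
  simp only [Nat.cast_zero, add_zero] at h1 ⊢
  field_simp

theorem gTU_ne_zero (M : ℕ) (ν : ℕ → ℕ) (κ : ℕ) {n : ℕ} (hn : 1 ≤ n) {s : ℂ} (hs : s ∈ halfPl) :
    gTU M ν κ n s ≠ 0 :=
  mul_ne_zero (Finset.prod_ne_zero_iff.2 fun _ _ =>
    Complex.Gamma_ne_zero_of_re_pos (add_one_re_pos hs _))
    (inv_ne_zero (Complex.Gamma_ne_zero_of_re_pos (add_add_re_pos hs hn κ)))

theorem differentiableAt_Gamma_of_re_pos {s : ℂ} (hs : 0 < s.re) :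
    DifferentiableAt ℂ Complex.Gamma s :=
  Complex.differentiableAt_Gamma s fun m h => by
    have := congrArg Complex.re h
    simp at this
    linarith [(m.cast_nonneg : (0 : ℝ) ≤ m)]

theorem gTU_differentiableOn (M : ℕ) (ν : ℕ → ℕ) (κ : ℕ) {n : ℕ} :
    DifferentiableOn ℂ (gTU M ν κ n) halfPl := by
  intro s hs
  refine DifferentiableAt.differentiableWithinAt (DifferentiableAt.mul ?_ ?_)
  · refine DifferentiableAt.fun_finsetProd fun _ _ => ?_
    exact (differentiableAt_Gamma_of_re_pos (add_one_re_pos hs _)).comp s (by fun_prop)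
  · exact (Complex.differentiable_one_div_Gamma _).comp s
      (f := fun s => s + (n : ℂ) + (κ : ℂ)) (by fun_prop)

/-- The numerator `x^t / g(t)`. -/
noncomputable def numTU (M : ℕ) (ν : ℕ → ℕ) (κ n : ℕ) (x : ℝ) (t : ℂ) : ℂ :=
  Complex.exp (t * Real.log x) * (gTU M ν κ n t)⁻¹

theorem numTU_differentiableOn (M : ℕ) (ν : ℕ → ℕ) (κ : ℕ) {n : ℕ} (hn : 1 ≤ n) (x : ℝ) :
    DifferentiableOn ℂ (numTU M ν κ n x) halfPl :=
  DifferentiableOn.mul (by fun_prop)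
    ((gTU_differentiableOn M ν κ).inv fun _ hs => gTU_ne_zero M ν κ hn hs)

/-- The integral of the double contour integrand over a closed path winding around the nodes. -/
theorem IsClosedPath.integral_integrandTU {γ γ' : ℝ → ℂ} {a b : ℝ} (h : IsClosedPath γ γ' a b)
    (M : ℕ) {ν : ℕ → ℕ} (hν0 : ν 0 = 0) (κ : ℕ) {n : ℕ} (hn : 1 ≤ n) (x y : ℝ)
    (hk : ∀ k < n, ∀ t ∈ Icc a b, γ t ≠ (k : ℕ))
    (hW : ∀ k < n, pathIndex γ γ' a b (k : ℕ) = 2 * π * Complex.I)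
    {s : ℂ} (hs : s ∈ halfPl) (hsγ : ∀ t ∈ Icc a b, γ t ≠ s) (hsk : ∀ k < n, s ≠ (k : ℕ)) :
    ∫ t in a..b, γ' t * integrandTU M ν κ n x y s (γ t) =
      2 * π * Complex.I * (gTU M ν κ n s * (nodeL n (numTU M ν κ n x)).eval s *
        Complex.exp (-(s + 1) * Real.log y)) -
      pathIndex γ γ' a b s * (Complex.exp (s * Real.log x) *
        Complex.exp (-(s + 1) * Real.log y)) := by
  have key := h.integral_nodeP (numTU_differentiableOn M ν κ hn x) hn hk hW hs hsγ hsk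
  have e : ∫ t in a..b, γ' t * integrandTU M ν κ n x y s (γ t) =
      ∫ t in a..b, factorTU M ν κ n s * Complex.exp (-(s + 1) * Real.log y) *
        (γ' t * (numTU M ν κ n x (γ t) * (nodeP n (γ t))⁻¹ * (s - γ t)⁻¹)) := by
    refine intervalIntegral.integral_congr fun t ht => ?_
    rw [uIcc_of_le h.le] at ht
    simp only [integrandTU_eq, numTU]
    rw [factorTU_eq_gTU M hν0 κ n (h.mem t ht), mul_inv]
    ring
  rw [e, intervalIntegral.integral_const_mul, key, factorTU_eq_gTU M hν0 κ n hs, numTU]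
  have h1 := nodeP_ne_zero hsk
  have h2 := gTU_ne_zero M ν κ hn hs
  field_simp

section Circle

variable {n : ℕ} (hn : 1 ≤ n)

theorem tC_eq_circleMap (n : ℕ) (θ : ℝ) :
    tC n θ = circleMap (((n : ℂ) - 1) / 2) ((n : ℝ) / 2 - 1 / 8) θ := by
  rw [tC, circleMap]; push_cast; rfl

/-- The velocity of the circular contour. -/
noncomputable def tC' (n : ℕ) (θ : ℝ) : ℂ :=
  ((n : ℂ) / 2 - 1/8) * Complex.I * Complex.exp (θ * Complex.I)

theorem hasDerivAt_tC (n : ℕ) (θ : ℝ) : HasDerivAt (tC n) (tC' n θ) θ := by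
  rw [funext (tC_eq_circleMap n)]
  refine (hasDerivAt_circleMap _ _ θ).congr_deriv ?_
  rw [circleMap, tC']; push_cast; ring

theorem pathIndex_tC (n : ℕ) (p : ℂ) : pathIndex (tC n) (tC' n) 0 (2 * π) p =
    ∮ z in C(((n : ℂ) - 1) / 2, (n : ℝ) / 2 - 1 / 8), (z - p)⁻¹ := by
  rw [pathIndex, circleIntegral]
  refine intervalIntegral.integral_congr fun θ _ => ?_
  simp only [smul_eq_mul]
  rw [← (hasDerivAt_tC n θ).deriv, ← tC_eq_circleMap, funext (tC_eq_circleMap n)]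

include hn

theorem norm_tC_sub (θ : ℝ) : ‖tC n θ - ((n : ℂ) - 1) / 2‖ = (n : ℝ) / 2 - 1 / 8 := by
  have : (1 : ℝ) ≤ n := by exact_mod_cast hn
  rw [tC_eq_circleMap, circleMap_sub_center, norm_circleMap_zero, abs_of_pos (by linarith)]

theorem norm_natCast_sub_lt {k : ℕ} (hk : k < n) :
    ‖(k : ℂ) - ((n : ℂ) - 1) / 2‖ < (n : ℝ) / 2 - 1 / 8 := by
  have h1 : (1 : ℝ) ≤ n := by exact_mod_cast hn
  have h2 : (k : ℝ) + 1 ≤ n := by exact_mod_cast hk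
  have h3 : (0 : ℝ) ≤ k := k.cast_nonneg
  have e : (k : ℂ) - ((n : ℂ) - 1) / 2 = ((k - (n - 1) / 2 : ℝ) : ℂ) := by push_cast; rfl
  rw [e, Complex.norm_real, Real.norm_eq_abs, abs_lt]
  constructor <;> linarith

theorem lt_norm_sC_sub (σ : ℝ) : (n : ℝ) / 2 - 1 / 8 < ‖sC σ - ((n : ℂ) - 1) / 2‖ := by
  have h1 : (1 : ℝ) ≤ n := by exact_mod_cast hn
  have := Complex.abs_re_le_norm (sC σ - ((n : ℂ) - 1) / 2)
  have e : (sC σ - ((n : ℂ) - 1) / 2).re = -(n / 2) := by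
    have : ((n : ℂ) - 1) / 2 = (((n - 1) / 2 : ℝ) : ℂ) := by push_cast; rfl
    rw [this, Complex.sub_re, Complex.ofReal_re]
    simp [sC]; ring
  rw [e, abs_neg, abs_of_pos (by linarith)] at this
  linarith

theorem isClosedPath_tC : IsClosedPath (tC n) (tC' n) 0 (2 * π) where
  le := by positivity
  cont := fun θ _ => (hasDerivAt_tC n θ).continuousAt.continuousWithinAt
  hasDeriv := fun θ _ => hasDerivAt_tC n θ
  int := by
    refine Continuous.intervalIntegrable ?_ _ _
    unfold tC'; fun_prop
  closed := by simp [tC]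
  mem := fun θ _ => by
    have h1 : (1 : ℝ) ≤ n := by exact_mod_cast hn
    have := Complex.abs_re_le_norm (tC n θ - ((n : ℂ) - 1) / 2)
    have e : ((n : ℂ) - 1) / 2 = (((n - 1) / 2 : ℝ) : ℂ) := by push_cast; rfl
    rw [norm_tC_sub hn, e, Complex.sub_re, Complex.ofReal_re, abs_le] at this
    show -1 < (tC n θ).re
    linarith [this.1]

theorem pathIndex_tC_natCast {k : ℕ} (hk : k < n) :
    pathIndex (tC n) (tC' n) 0 (2 * π) k = 2 * π * Complex.I := by
  rw [pathIndex_tC, circleIntegral.integral_sub_inv_of_mem_ball]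
  rw [mem_ball_iff_norm]
  exact norm_natCast_sub_lt hn hk

theorem pathIndex_tC_sC (σ : ℝ) : pathIndex (tC n) (tC' n) 0 (2 * π) (sC σ) = 0 := by
  have h1 : (1 : ℝ) ≤ n := by exact_mod_cast hn
  have hne : ∀ z ∈ Metric.closedBall (((n : ℂ) - 1) / 2) ((n : ℝ) / 2 - 1 / 8), z - sC σ ≠ 0 := by
    intro z hz h0
    rw [mem_closedBall_iff_norm, sub_eq_zero.1 h0] at hz
    linarith [lt_norm_sC_sub hn σ]
  rw [pathIndex_tC]
  refine Complex.circleIntegral_eq_zero_of_differentiable_on_off_countable (by linarith)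
    countable_empty (ContinuousOn.inv₀ (by fun_prop) hne) fun z hz => ?_
  exact DifferentiableAt.inv (by fun_prop) (hne z (Metric.ball_subset_closedBall hz.1))

omit hn in
theorem sC_mem (σ : ℝ) : sC σ ∈ halfPl := by
  show -1 < (sC σ).re
  simp [sC]; norm_num

/-- The kernel as a single contour integral. -/
theorem KnTU_eq_integral (M : ℕ) {ν : ℕ → ℕ} (hν0 : ν 0 = 0) (κ : ℕ) (x y : ℝ) :
    KnTU M ν κ n x y = 1 / (2 * π) * ∫ σ : ℝ, gTU M ν κ n (sC σ) *
      (nodeL n (numTU M ν κ n x)).eval (sC σ) * Complex.exp (-(sC σ + 1) * Real.log y) := by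
  have key : ∀ σ : ℝ, Complex.I * ∫ θ in (0 : ℝ)..(2 * π),
      (((n : ℂ) / 2 - 1/8) * Complex.I * Complex.exp (θ * Complex.I)) *
        integrandTU M ν κ n x y (sC σ) (tC n θ) = -(2 * π) * (gTU M ν κ n (sC σ) *
      (nodeL n (numTU M ν κ n x)).eval (sC σ) * Complex.exp (-(sC σ + 1) * Real.log y)) := by
    intro σ
    have h := (isClosedPath_tC hn).integral_integrandTU M hν0 κ hn x y (s := sC σ)
      (fun k hk t _ he => by
        have := norm_tC_sub hn t
        rw [he] at this
        exact (norm_natCast_sub_lt hn hk).ne this)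
      (fun k hk => pathIndex_tC_natCast hn hk) (sC_mem σ)
      (fun t _ he => by
        have := norm_tC_sub hn t
        rw [he] at this
        exact (lt_norm_sC_sub hn σ).ne' this)
      (fun k hk he => by
        have := congrArg Complex.re he
        simp [sC] at this
        linarith [(k.cast_nonneg : (0 : ℝ) ≤ k)])
    rw [pathIndex_tC_sC hn, zero_mul, sub_zero] at h
    simp only [tC'] at h
    rw [h]
    linear_combination (2 * π * (gTU M ν κ n (sC σ) * (nodeL n (numTU M ν κ n x)).eval (sC σ) *
      Complex.exp (-(sC σ + 1) * Real.log y))) * Complex.I_mul_I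
  rw [KnTU]
  simp_rw [key]
  rw [integral_const_mul]
  have hp : (π : ℂ) ≠ 0 := by exact_mod_cast Real.pi_ne_zero
  rw [mul_pow, mul_pow, Complex.I_sq, ← mul_assoc]
  congr 1
  field_simp

end Circle

section ArcIndex

variable {M : ℕ} (hM : 2 ≤ M)
include hM

omit hM in
theorem arcZ_re_abs (α : ℝ) : (arcZ M |α|).re = (arcZ M α).re := by
  rcases abs_choice α with h | h <;> rw [h]
  rw [arcZ_neg, Complex.conj_re]

theorem isClosedPath_arc {n : ℕ} (hn : 1 ≤ n) :
    IsClosedPath (fun α => n * arcZ M α - 1 / 2) (fun α => n * arcZ' M α)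
      (-arcMax M) (arcMax M) where
  le := by linarith [arcMax_pos hM]
  cont := ((continuousOn_arcZ hM).const_smul (n : ℂ)).sub continuousOn_const
  hasDeriv := fun t ht => ((hasDerivAt_arcZ hM ht).const_mul (n : ℂ)).sub_const _
  int := (intervalIntegrable_arcZ' hM).const_mul _
  closed := by rw [arcZ_neg, arcZ_arcMax hM, map_zero]
  mem := fun t ht => by
    have h0 : 0 ≤ (arcZ M t).re := by
      rcases eq_or_lt_of_le ht.2 with h | h
      · rw [h, arcZ_arcMax hM]; simp
      · rcases eq_or_lt_of_le ht.1 with h' | h'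
        · rw [← h', arcZ_neg, arcZ_arcMax hM]; simp
        · exact (arcZ_re_pos hM ⟨h', h⟩).le
    show -1 < ((n : ℂ) * arcZ M t - 1 / 2).re
    have e : ((n : ℂ) * arcZ M t - 1 / 2).re = n * (arcZ M t).re - 1 / 2 := by
      simp
    rw [e]
    have : 0 ≤ n * (arcZ M t).re := by positivity
    linarith

theorem integral_arcZ_log {a b : ℝ} (hab : a ≤ b) (ha : -arcMax M ≤ a) (hb : b ≤ arcMax M)
    (q e : ℂ) (h : ∀ t ∈ Icc a b, e * (arcZ M t - q) ∈ Complex.slitPlane) :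
    ∫ t in a..b, arcZ' M t * (arcZ M t - q)⁻¹ =
      Complex.log (e * (arcZ M b - q)) - Complex.log (e * (arcZ M a - q)) := by
  have hsub : Icc a b ⊆ Icc (-arcMax M) (arcMax M) := Icc_subset_Icc ha hb
  have hne : ∀ t ∈ Icc a b, e ≠ 0 ∧ arcZ M t - q ≠ 0 := fun t ht =>
    mul_ne_zero_iff.1 (Complex.slitPlane_ne_zero (h t ht))
  refine intervalIntegral.integral_eq_sub_of_hasDerivAt_of_le hab
    (f := fun t => Complex.log (e * (arcZ M t - q))) ?_ ?_ ?_
  · exact ContinuousOn.clog (continuousOn_const.mul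
      (((continuousOn_arcZ hM).mono hsub).sub continuousOn_const)) h
  · intro t ht
    have ht' := Ioo_subset_Icc_self ht
    obtain ⟨h1, h2⟩ := hne t ht'
    refine ((((hasDerivAt_arcZ hM ⟨ha.trans_lt ht.1, ht.2.trans_le hb⟩).sub_const q).const_mul
      e).clog_real (h t ht')).congr_deriv ?_
    field_simp
  · refine IntervalIntegrable.mul_continuousOn ((intervalIntegrable_arcZ' hM).mono_set ?_) ?_
    · rw [uIcc_of_le hab, uIcc_of_le (by linarith [arcMax_pos hM])]
      exact hsub
    · rw [uIcc_of_le hab]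
      exact (((continuousOn_arcZ hM).mono hsub).sub continuousOn_const).inv₀ fun t ht => (hne t ht).2

omit hM in
theorem log_sub_log_neg_I {a : ℝ} (ha : a ≠ 0) :
    Complex.log (a * Complex.I) - Complex.log (-(a * Complex.I)) =
      (SignType.sign a : ℝ) * π * Complex.I := by
  have key : ∀ c : ℝ, 0 < c → Complex.log (c * Complex.I) - Complex.log (-(c * Complex.I)) =
      π * Complex.I := by
    intro c hc
    rw [← mul_neg, Complex.log_ofReal_mul hc Complex.I_ne_zero,
      Complex.log_ofReal_mul hc (neg_ne_zero.2 Complex.I_ne_zero), Complex.log_I,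
      Complex.log_neg_I]
    ring
  rcases ha.lt_or_gt with h | h
  · have := key (-a) (by linarith)
    rw [sign_neg h]
    simp only [SignType.coe_neg, SignType.coe_one, Complex.ofReal_neg, Complex.ofReal_one,
      neg_mul, neg_neg] at this ⊢
    linear_combination -this
  · rw [sign_pos h, key a h]
    simp

theorem pathIndex_arcZ {b τ : ℝ} (hb : b ∈ Ioo 0 (arcMax M)) (h1 : τ ≠ (arcZ M b).im)
    (h2 : τ ≠ -(arcZ M b).im) :
    pathIndex (arcZ M) (arcZ' M) (-arcMax M) (arcMax M) ((arcZ M b).re + τ * Complex.I) =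
      if |τ| < (arcZ M b).im then 2 * π * Complex.I else 0 := by
  set q : ℂ := (arcZ M b).re + τ * Complex.I with hq
  have hqre : q.re = (arcZ M b).re := by simp [hq]
  have hqim : q.im = τ := by simp [hq]
  have hp := arcMax_pos hM
  have hanti := strictAntiOn_arcZ_re hM
  have him : ∀ t : ℝ, |t| = b → (arcZ M t - q).im ≠ 0 := by
    intro t ht
    rw [Complex.sub_im, hqim]
    rcases abs_choice t with h | h <;> rw [h] at ht
    · rw [ht]; exact sub_ne_zero.2 h1.symm
    · have : t = -b := by linarith
      rw [this, arcZ_neg, Complex.conj_im]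
      exact sub_ne_zero.2 h2.symm
  have hin : ∀ t : ℝ, |t| ≤ b → (1 : ℂ) * (arcZ M t - q) ∈ Complex.slitPlane := by
    intro t ht
    rw [one_mul, Complex.mem_slitPlane_iff]
    rcases ht.lt_or_eq with h | h
    · left
      have := hanti ⟨abs_nonneg t, (h.trans hb.2).le⟩ ⟨hb.1.le, hb.2.le⟩ h
      simp only [arcZ_re_abs] at this
      rw [Complex.sub_re, hqre]
      linarith
    · exact Or.inr (him t h)
  have hout : ∀ t : ℝ, b ≤ |t| → |t| ≤ arcMax M → (-1 : ℂ) * (arcZ M t - q) ∈ Complex.slitPlane := by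
    intro t ht htm
    rw [neg_one_mul, Complex.mem_slitPlane_iff, Complex.neg_re, Complex.neg_im]
    rcases ht.lt_or_eq with h | h
    · left
      have := hanti ⟨hb.1.le, hb.2.le⟩ ⟨abs_nonneg t, htm⟩ h
      simp only [arcZ_re_abs] at this
      rw [Complex.sub_re, hqre]
      linarith
    · exact Or.inr (neg_ne_zero.2 (him t h.symm))
  have i1 := integral_arcZ_log hM (a := -arcMax M) (b := -b) (by linarith [hb.2]) le_rfl
    (by linarith [hb.1]) q (-1) (fun t ht => hout t (by
      rw [abs_of_nonpos (by linarith [ht.2, hb.1])]; linarith [ht.2]) (by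
      rw [abs_of_nonpos (by linarith [ht.2, hb.1])]; linarith [ht.1]))
  have i2 := integral_arcZ_log hM (a := -b) (b := b) (by linarith [hb.1]) (by linarith [hb.2])
    hb.2.le q 1 (fun t ht => hin t (abs_le.2 ht))
  have i3 := integral_arcZ_log hM (a := b) (b := arcMax M) hb.2.le (by linarith [hb.1])
    le_rfl q (-1) (fun t ht => hout t (by rw [abs_of_pos (hb.1.trans_le ht.1)]; exact ht.1) (by
      rw [abs_of_pos (hb.1.trans_le ht.1)]; exact ht.2))
  have h_int : ∀ c d : ℝ, c ∈ Icc (-arcMax M) (arcMax M) → d ∈ Icc (-arcMax M) (arcMax M) →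
      IntervalIntegrable (fun t => arcZ' M t * (arcZ M t - q)⁻¹) volume c d := by
    intro c d hc hd
    refine IntervalIntegrable.mono_set (a := -arcMax M) (b := arcMax M)
      (IntervalIntegrable.mul_continuousOn (intervalIntegrable_arcZ' hM) ?_) ?_
    · rw [uIcc_of_le (by linarith)]
      refine ((continuousOn_arcZ hM).sub continuousOn_const).inv₀ fun t ht => ?_
      rcases le_total |t| b with h | h
      · exact right_ne_zero_of_mul (Complex.slitPlane_ne_zero (hin t h))
      · exact right_ne_zero_of_mul (Complex.slitPlane_ne_zero (hout t h (abs_le.2 ht)))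
    · rw [uIcc_of_le (by linarith : -arcMax M ≤ arcMax M)]
      exact uIcc_subset_Icc hc hd
  have mb : b ∈ Icc (-arcMax M) (arcMax M) := ⟨by linarith [hb.1], hb.2.le⟩
  have mb' : -b ∈ Icc (-arcMax M) (arcMax M) := ⟨by linarith [hb.2], by linarith [hb.1]⟩
  have mp : arcMax M ∈ Icc (-arcMax M) (arcMax M) := ⟨by linarith, le_rfl⟩
  have mm : -arcMax M ∈ Icc (-arcMax M) (arcMax M) := ⟨le_rfl, by linarith⟩
  rw [pathIndex, ← intervalIntegral.integral_add_adjacent_intervals (h_int _ b mm mb)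
    (h_int _ _ mb mp), ← intervalIntegral.integral_add_adjacent_intervals (h_int _ (-b) mm mb')
    (h_int _ _ mb' mb), i1, i2, i3, arcZ_neg (arcMax M), arcZ_arcMax hM, map_zero]
  have eb : arcZ M b - q = (((arcZ M b).im - τ : ℝ) : ℂ) * Complex.I := by
    apply Complex.ext
    · rw [Complex.sub_re, hqre, Complex.re_ofReal_mul, Complex.I_re]; ring
    · rw [Complex.sub_im, hqim, Complex.im_ofReal_mul, Complex.I_im]; ring
  have eb' : arcZ M (-b) - q = ((-(arcZ M b).im - τ : ℝ) : ℂ) * Complex.I := by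
    rw [arcZ_neg]
    apply Complex.ext
    · rw [Complex.sub_re, hqre, Complex.re_ofReal_mul, Complex.I_re, Complex.conj_re]; ring
    · rw [Complex.sub_im, hqim, Complex.im_ofReal_mul, Complex.I_im, Complex.conj_im]; ring
  have l1 := log_sub_log_neg_I (sub_ne_zero.2 h1.symm)
  have l2 := log_sub_log_neg_I (sub_ne_zero.2 h2.symm)
  rw [eb, eb']
  simp only [neg_one_mul, one_mul]
  have hs := arcZ_im_pos hM hb
  have tot : ((SignType.sign ((arcZ M b).im - τ) : ℝ) : ℂ) * π * Complex.I -
      (SignType.sign (-(arcZ M b).im - τ) : ℝ) * π * Complex.I =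
      if |τ| < (arcZ M b).im then 2 * π * Complex.I else 0 := by
    split_ifs with h
    · rw [abs_lt] at h
      rw [sign_pos (by linarith [h.2]), sign_neg (by linarith [h.1])]
      simp only [SignType.coe_neg, SignType.coe_one, Complex.ofReal_neg, Complex.ofReal_one]
      ring
    · rcases lt_abs.1 (lt_of_le_of_ne (not_lt.1 h) (fun he => by
        rcases abs_choice τ with h' | h' <;> rw [h'] at he
        · exact h1 he.symm
        · exact h2 (by linarith))) with h' | h'
      · rw [sign_neg (by linarith : (arcZ M b).im - τ < 0),
          sign_neg (by linarith : -(arcZ M b).im - τ < 0)]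
        ring
      · rw [sign_pos (by linarith : 0 < (arcZ M b).im - τ),
          sign_pos (by linarith : 0 < -(arcZ M b).im - τ)]
        ring
  rw [← tot]
  linear_combination l1 - l2

theorem exists_arcZ_re_eq {x : ℝ} (hx : x ∈ Ioo 0 1) : ∃ b ∈ Ioo 0 (arcMax M), (arcZ M b).re = x := by
  have hp := arcMax_pos hM
  have hc : ContinuousOn (fun a => (arcZ M a).re) (Icc 0 (arcMax M)) :=
    Complex.continuous_re.comp_continuousOn
      ((continuousOn_arcZ hM).mono (Icc_subset_Icc (by linarith) le_rfl))
  have h := intermediate_value_Ioo' hp.le hc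
  simp only [arcZ_arcMax hM, Complex.zero_re] at h
  exact h ⟨hx.1, hx.2.trans (one_lt_arcZ_zero_re hM)⟩

omit hM in
theorem pathIndex_arc {n : ℕ} (hn : 1 ≤ n) (q : ℂ) :
    pathIndex (fun α => n * arcZ M α - 1 / 2) (fun α => n * arcZ' M α) (-arcMax M) (arcMax M)
      (n * q - 1 / 2) = pathIndex (arcZ M) (arcZ' M) (-arcMax M) (arcMax M) q := by
  have hn0 : (n : ℂ) ≠ 0 := by exact_mod_cast (by omega : n ≠ 0)
  refine intervalIntegral.integral_congr fun t _ => ?_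
  simp only
  rw [show (n : ℂ) * arcZ M t - 1 / 2 - (n * q - 1 / 2) = n * (arcZ M t - q) by ring, mul_inv]
  field_simp

theorem arcZ_ne_of_re_eq {b τ : ℝ} (hb : b ∈ Ioo 0 (arcMax M)) (h1 : τ ≠ (arcZ M b).im)
    (h2 : τ ≠ -(arcZ M b).im) {t : ℝ} (ht : t ∈ Icc (-arcMax M) (arcMax M)) :
    arcZ M t ≠ (arcZ M b).re + τ * Complex.I := by
  intro h
  have hre : (arcZ M |t|).re = (arcZ M b).re := by rw [arcZ_re_abs, h]; simp
  have := (strictAntiOn_arcZ_re hM).injOn ⟨abs_nonneg t, abs_le.2 ht⟩ ⟨hb.1.le, hb.2.le⟩ hre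
  have him : (arcZ M t).im = τ := by rw [h]; simp
  rcases abs_choice t with h' | h' <;> rw [h'] at this
  · rw [this] at him; exact h1 him.symm
  · rw [show t = -b by linarith, arcZ_neg, Complex.conj_im] at him
    exact h2 him.symm

theorem exists_node_eq {n k : ℕ} (hk : k < n) : ∃ b ∈ Ioo 0 (arcMax M),
    (k : ℂ) = n * ((arcZ M b).re + (0 : ℝ) * Complex.I) - 1 / 2 := by
  have hn0 : (0 : ℝ) < n := by exact_mod_cast (by omega : 0 < n)
  have hk' : (k : ℝ) + 1 ≤ n := by exact_mod_cast hk
  obtain ⟨b, hb, h⟩ := exists_arcZ_re_eq hM (x := (k + 1 / 2) / n)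
    ⟨by positivity, by rw [div_lt_one hn0]; linarith⟩
  refine ⟨b, hb, ?_⟩
  rw [h]
  have : (n : ℂ) ≠ 0 := by exact_mod_cast hn0.ne'
  push_cast
  field_simp
  ring

/-- The arc integral representation of the integrand of the single integral formula. -/
theorem integral_arc_integrandTU {ν : ℕ → ℕ} (hν0 : ν 0 = 0) (κ : ℕ) {n : ℕ} (hn : 1 ≤ n)
    (x y : ℝ) {β τ : ℝ} (hβ : β ∈ Ioo 0 (arcMax M)) (h0 : τ ≠ 0) (h1 : τ ≠ (arcZ M β).im)
    (h2 : τ ≠ -(arcZ M β).im) :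
    let s : ℂ := n * ((arcZ M β).re + τ * Complex.I) - 1 / 2
    gTU M ν κ n s * (nodeL n (numTU M ν κ n x)).eval s * Complex.exp (-(s + 1) * Real.log y) =
      (if |τ| < (arcZ M β).im then
        Complex.exp (s * Real.log x) * Complex.exp (-(s + 1) * Real.log y) else 0) +
      1 / (2 * π * Complex.I) * ∫ α in -arcMax M..arcMax M,
        (n * arcZ' M α) * integrandTU M ν κ n x y s (n * arcZ M α - 1 / 2) := by
  intro s
  have hn0 : (n : ℂ) ≠ 0 := by exact_mod_cast (by omega : n ≠ 0)
  have hn1 : (0 : ℝ) < n := by exact_mod_cast (by omega : 0 < n)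
  have hpath : ∀ (b σ : ℝ), b ∈ Ioo 0 (arcMax M) → σ ≠ (arcZ M b).im → σ ≠ -(arcZ M b).im →
      ∀ t ∈ Icc (-arcMax M) (arcMax M),
        (n : ℂ) * arcZ M t - 1 / 2 ≠ n * ((arcZ M b).re + σ * Complex.I) - 1 / 2 := by
    intro b σ hb hσ1 hσ2 t ht h
    exact arcZ_ne_of_re_eq hM hb hσ1 hσ2 ht (mul_left_cancel₀ hn0 (sub_left_injective h))
  have hu := arcZ_re_pos hM (α := β) ⟨by linarith [hβ.1, hβ.2], hβ.2⟩
  have hsim : s.im = n * τ := by simp [s]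
  have hsre : s.re = n * (arcZ M β).re - 1 / 2 := by simp [s]
  have h := (isClosedPath_arc hM hn).integral_integrandTU M hν0 κ hn x y (s := s)
    (fun k hk t ht => by
      obtain ⟨b, hb, e⟩ := exists_node_eq hM hk
      have := arcZ_im_pos hM hb
      rw [e]
      exact hpath b 0 hb this.ne (by linarith) t ht)
    (fun k hk => by
      obtain ⟨b, hb, e⟩ := exists_node_eq hM hk
      have := arcZ_im_pos hM hb
      rw [e, pathIndex_arc hn, pathIndex_arcZ hM hb this.ne (by linarith), abs_zero, if_pos this])
    (by
      show -1 < s.re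
      rw [hsre]
      have : 0 < n * (arcZ M β).re := by positivity
      linarith)
    (hpath β τ hβ h1 h2)
    (fun k _ he => by
      have := congrArg Complex.im he
      rw [hsim, Complex.natCast_im] at this
      exact h0 ((mul_eq_zero.1 this).resolve_left hn1.ne'))
  rw [pathIndex_arc hn, pathIndex_arcZ hM hβ h1 h2] at h
  rw [h]
  have hp : (π : ℂ) ≠ 0 := by exact_mod_cast Real.pi_ne_zero
  have hI := Complex.I_ne_zero
  split_ifs <;> field_simp <;> ring

end ArcIndex

theorem integrable_vertical_of_le {f : ℂ → ℂ} {a b C : ℝ}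
    (hf : DifferentiableOn ℂ f halfPl) (ha : -1 < a)
    (hle : ∀ σ ∈ Icc a b, ∀ τ : ℝ, ‖f (σ + τ * Complex.I)‖ ≤ C * (1 + τ ^ 2)⁻¹) {σ : ℝ}
    (hσ : σ ∈ Icc a b) : Integrable fun τ : ℝ => f (σ + τ * Complex.I) := by
  refine Integrable.mono' (integrable_inv_one_add_sq.const_mul C) ?_
    (Eventually.of_forall fun τ => hle σ hσ τ)
  refine Continuous.aestronglyMeasurable (continuous_iff_continuousAt.2 fun τ => ?_)
  have hm : (σ : ℂ) + τ * Complex.I ∈ halfPl := by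
    simp [halfPl]; linarith [hσ.1]
  have := (hf.differentiableAt (isOpen_halfPl.mem_nhds hm)).continuousAt
  exact this.comp (f := fun τ : ℝ => (σ : ℂ) + τ * Complex.I) (by fun_prop)

theorem integral_vertical_eq {f : ℂ → ℂ} {a b C : ℝ} (hab : a ≤ b)
    (hf : DifferentiableOn ℂ f halfPl) (ha : -1 < a)
    (hle : ∀ σ ∈ Icc a b, ∀ τ : ℝ, ‖f (σ + τ * Complex.I)‖ ≤ C * (1 + τ ^ 2)⁻¹) :
    ∫ τ : ℝ, f (a + τ * Complex.I) = ∫ τ : ℝ, f (b + τ * Complex.I) := by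
  have hrect : ∀ T : ℝ, (∫ τ in -T..T, f (b + τ * Complex.I)) - (∫ τ in -T..T, f (a + τ * Complex.I)) =
      Complex.I * ((∫ σ in a..b, f (σ + (-T : ℝ) * Complex.I)) - ∫ σ in a..b, f (σ + T * Complex.I)) := by
    intro T
    have h := Complex.integral_boundary_rect_eq_zero_of_differentiableOn f (a + (-T : ℝ) * Complex.I)
      (b + T * Complex.I) (hf.mono ?_)
    · simp only [Complex.add_re, Complex.add_im, Complex.ofReal_re, Complex.ofReal_im,
        Complex.re_ofReal_mul, Complex.im_ofReal_mul, Complex.I_re, Complex.I_im, mul_zero,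
        mul_one, add_zero, zero_add, smul_eq_mul] at h
      have hI := Complex.I_mul_I
      linear_combination (-Complex.I) * h + ((∫ τ in -T..T, f (b + τ * Complex.I)) -
        (∫ τ in -T..T, f (a + τ * Complex.I))) * hI
    · intro z hz
      have := hz.1
      simp only [Complex.add_re, Complex.ofReal_re, Complex.re_ofReal_mul, Complex.I_re, mul_zero,
        add_zero, mem_preimage, uIcc_of_le hab] at this
      exact ha.trans_le this.1
  have hz : Tendsto (fun T : ℝ => C * (1 + T ^ 2)⁻¹ * (b - a)) atTop (𝓝 0) := by
    have : Tendsto (fun T : ℝ => (1 + T ^ 2)⁻¹) atTop (𝓝 0) :=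
      tendsto_inv_atTop_zero.comp
        (tendsto_atTop_add_const_left _ _ (tendsto_pow_atTop two_ne_zero))
    simpa using (this.const_mul C).mul_const (b - a)
  have hside : ∀ T : ℝ, ‖∫ σ in a..b, f (σ + T * Complex.I)‖ ≤ C * (1 + T ^ 2)⁻¹ * (b - a) := by
    intro T
    have := intervalIntegral.norm_integral_le_of_norm_le_const (a := a) (b := b)
      (f := fun σ : ℝ => f (σ + T * Complex.I)) (C := C * (1 + T ^ 2)⁻¹) (fun σ hσ => by
        rw [uIoc_of_le hab] at hσ
        exact hle σ ⟨hσ.1.le, hσ.2⟩ T)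
    rwa [abs_of_nonneg (by linarith)] at this
  have h1 : Tendsto (fun T : ℝ => ∫ σ in a..b, f (σ + T * Complex.I)) atTop (𝓝 0) :=
    squeeze_zero_norm hside hz
  have h2 : Tendsto (fun T : ℝ => ∫ σ in a..b, f (σ + (-T : ℝ) * Complex.I)) atTop (𝓝 0) :=
    squeeze_zero_norm (fun T => by simpa only [neg_sq] using hside (-T)) hz
  have h_int := fun σ (hσ : σ ∈ Icc a b) => integrable_vertical_of_le hf ha hle hσ
  have l1 := intervalIntegral_tendsto_integral (h_int b ⟨hab, le_rfl⟩) tendsto_neg_atTop_atBot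
    tendsto_id
  have l2 := intervalIntegral_tendsto_integral (h_int a ⟨le_rfl, hab⟩) tendsto_neg_atTop_atBot
    tendsto_id
  have h3 := (h2.sub h1).const_mul Complex.I
  simp only [id, sub_self, mul_zero] at l1 l2 h3
  have := tendsto_nhds_unique (l1.sub l2) (h3.congr fun T => (hrect T).symm)
  exact (sub_eq_zero.1 this).symm

theorem one_add_abs_im_le {z : ℂ} (hz : 1 / 2 ≤ z.re) (i : ℕ) : (1 + |z.im|) / 4 ≤ ‖z + i‖ := by
  have h1 := Complex.abs_im_le_norm (z + i)
  have h2 := Complex.re_le_norm (z + i)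
  simp only [Complex.add_im, Complex.natCast_im, add_zero, Complex.add_re, Complex.natCast_re]
    at h1 h2
  have : (0 : ℝ) ≤ i := i.cast_nonneg
  have := abs_nonneg z.im
  linarith

theorem exists_norm_Gamma_le_decay (B : ℝ) (m : ℕ) : ∃ C > 0, ∀ z : ℂ, 1 / 2 ≤ z.re → z.re ≤ B →
    ‖Complex.Gamma z‖ ≤ C * ((1 + |z.im|) ^ m)⁻¹ := by
  have hc : ContinuousOn (fun r : ℝ => Real.Gamma (r + m)) (Icc (1 / 2) B) := by
    intro r hr
    have hpos : 0 < r + m := by have := hr.1; have : (0:ℝ) ≤ m := Nat.cast_nonneg m; linarith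
    refine ContinuousAt.continuousWithinAt ?_
    refine ContinuousAt.comp (g := Real.Gamma) (f := fun r : ℝ => r + m) ?_ (by fun_prop)
    refine (Real.differentiableAt_Gamma fun k => ?_).continuousAt
    have : (0 : ℝ) ≤ k := k.cast_nonneg
    linarith
  obtain ⟨C, hC⟩ := (isCompact_Icc.image_of_continuousOn hc).bddAbove
  refine ⟨4 ^ m * max C 1, by positivity, fun z hz hB => ?_⟩
  have hpos : 0 < z.re := by linarith
  have h1 := Gamma_add_natCast hpos m
  have h2 : ‖Complex.Gamma (z + m)‖ ≤ max C 1 := by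
    refine (norm_Gamma_le_Gamma_re ?_).trans (le_max_of_le_left ?_)
    · simp; positivity
    · refine hC ⟨z.re, ⟨hz, hB⟩, by simp⟩
  rw [h1, norm_mul, norm_prod] at h2
  have h3 : ((1 + |z.im|) / 4) ^ m ≤ ∏ i ∈ Finset.range m, ‖z + i‖ := by
    have := Finset.prod_le_prod (s := Finset.range m) (f := fun _ => (1 + |z.im|) / 4)
      (g := fun i : ℕ => ‖z + i‖) (fun _ _ => by positivity) fun i _ => one_add_abs_im_le hz i
    simpa [div_pow] using this
  have h4 : ((1 + |z.im|) / 4) ^ m * ‖Complex.Gamma z‖ ≤ max C 1 :=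
    (mul_le_mul_of_nonneg_right h3 (norm_nonneg _)).trans h2
  rw [div_pow] at h4
  have : 0 < (1 + |z.im|) ^ m := by positivity
  rw [← div_eq_mul_inv, le_div_iff₀ this]
  rw [div_mul_eq_mul_div, div_le_iff₀ (by positivity)] at h4
  linarith

theorem exists_norm_gTU_le {M : ℕ} (hM : 2 ≤ M) {ν : ℕ → ℕ} {κ : ℕ} (hκ : ν 1 < κ) {n : ℕ} (B : ℝ)
    (hn : 1 ≤ n) (m : ℕ) : ∃ C > 0, ∀ s : ℂ, -(1 / 2) ≤ s.re → s.re ≤ B →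
    ‖gTU M ν κ n s‖ ≤ C * ((1 + |s.im|) ^ m)⁻¹ := by
  choose C hC0 hC using fun j : ℕ => exists_norm_Gamma_le_decay (B + ν j + 1) m
  obtain ⟨k, hk⟩ : ∃ k, n + κ = ν 1 + 1 + k := ⟨n + κ - (ν 1 + 1), by omega⟩
  obtain ⟨M, rfl⟩ : ∃ M', M = M' + 1 + 1 := ⟨M - 2, by omega⟩
  refine ⟨2 ^ k * ∏ j ∈ Finset.range (M + 1), C (j + 2),
    mul_pos (by positivity) (Finset.prod_pos fun _ _ => hC0 _), fun s hs hB => ?_⟩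
  set z : ℂ := s + ν 1 + 1 with hz
  have hzre : 1 / 2 ≤ z.re := by
    simp only [hz, Complex.add_re, Complex.natCast_re, Complex.one_re]
    have : (0 : ℝ) ≤ ν 1 := Nat.cast_nonneg _
    linarith
  have hden : s + n + κ = z + k := by
    have : (n : ℂ) + κ = ν 1 + 1 + k := by exact_mod_cast hk
    rw [hz]; linear_combination this
  have hG0 : Complex.Gamma z ≠ 0 := Complex.Gamma_ne_zero_of_re_pos (by linarith)
  have e : gTU (M + 1 + 1) ν κ n s = (∏ i ∈ Finset.range k, (z + i))⁻¹ *
      ∏ j ∈ Finset.range (M + 1), Complex.Gamma (s + ν (j + 2) + 1) := by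
    rw [gTU, Finset.prod_range_succ', hden, Gamma_add_natCast (by linarith), zero_add, ← hz, mul_inv]
    field_simp
  rw [e, norm_mul, norm_inv, norm_prod, norm_prod]
  have h1 : (∏ i ∈ Finset.range k, ‖z + i‖)⁻¹ ≤ 2 ^ k := by
    rw [← inv_inv ((2 : ℝ) ^ k)]
    refine inv_anti₀ (by positivity) ?_
    have := Finset.prod_le_prod (s := Finset.range k) (f := fun _ => (2 : ℝ)⁻¹)
      (g := fun i : ℕ => ‖z + i‖) (fun _ _ => by positivity) fun i _ => by
        refine le_trans ?_ (Complex.re_le_norm _)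
        simp only [Complex.add_re, Complex.natCast_re]
        have : (0 : ℝ) ≤ i := Nat.cast_nonneg _
        linarith
    simpa using this
  have h2 : ∏ j ∈ Finset.range (M + 1), ‖Complex.Gamma (s + ν (j + 2) + 1)‖ ≤
      (∏ j ∈ Finset.range (M + 1), C (j + 2)) * (((1 + |s.im|) ^ m)⁻¹) ^ (M + 1) := by
    have := Finset.prod_le_prod (s := Finset.range (M + 1))
      (f := fun j => ‖Complex.Gamma (s + ν (j + 2) + 1)‖)
      (g := fun j => C (j + 2) * ((1 + |s.im|) ^ m)⁻¹) (fun _ _ => norm_nonneg _) fun j _ => by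
        have := hC (j + 2) (s + ν (j + 2) + 1) (by
          simp only [Complex.add_re, Complex.natCast_re, Complex.one_re]
          have : (0 : ℝ) ≤ ν (j + 2) := Nat.cast_nonneg _
          linarith) (by
          simp only [Complex.add_re, Complex.natCast_re, Complex.one_re]
          linarith)
        simpa using this
    rwa [Finset.prod_mul_distrib, Finset.prod_const, Finset.card_range] at this
  have h3 : (((1 + |s.im|) ^ m)⁻¹) ^ (M + 1) ≤ ((1 + |s.im|) ^ m)⁻¹ :=
    pow_le_of_le_one (by positivity)
      (inv_le_one_of_one_le₀ (one_le_pow₀ (by linarith [abs_nonneg s.im]))) (by omega)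
  have hP : 0 < ∏ j ∈ Finset.range (M + 1), C (j + 2) := Finset.prod_pos fun _ _ => hC0 _
  calc _ ≤ 2 ^ k * ((∏ j ∈ Finset.range (M + 1), C (j + 2)) * ((1 + |s.im|) ^ m)⁻¹) :=
        mul_le_mul h1 (h2.trans (mul_le_mul_of_nonneg_left h3 hP.le))
          (Finset.prod_nonneg fun _ _ => norm_nonneg _) (by positivity)
    _ = _ := by ring

theorem norm_polynomial_eval_le (P : Polynomial ℂ) (z : ℂ) :
    ‖P.eval z‖ ≤ (∑ i ∈ Finset.range (P.natDegree + 1), ‖P.coeff i‖) * (1 + ‖z‖) ^ P.natDegree := by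
  rw [Polynomial.eval_eq_sum_range, Finset.sum_mul]
  refine (norm_sum_le _ _).trans (Finset.sum_le_sum fun i hi => ?_)
  rw [norm_mul, norm_pow]
  refine mul_le_mul_of_nonneg_left ?_ (norm_nonneg _)
  have : i ≤ P.natDegree := by simpa [Nat.lt_succ_iff] using hi
  calc ‖z‖ ^ i ≤ (1 + ‖z‖) ^ i := pow_le_pow_left₀ (norm_nonneg _) (by linarith) i
    _ ≤ _ := pow_le_pow_right₀ (by linarith [norm_nonneg z]) this

/-- The integrand of the single contour integral representing the kernel. -/
noncomputable def kernF (M : ℕ) (ν : ℕ → ℕ) (κ n : ℕ) (x y : ℝ) (s : ℂ) : ℂ :=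
  gTU M ν κ n s * (nodeL n (numTU M ν κ n x)).eval s * Complex.exp (-(s + 1) * Real.log y)

theorem kernF_differentiableOn (M : ℕ) (ν : ℕ → ℕ) (κ n : ℕ) (x y : ℝ) :
    DifferentiableOn ℂ (kernF M ν κ n x y) halfPl := by
  refine ((gTU_differentiableOn M ν κ).mul (Polynomial.differentiable _).differentiableOn).mul ?_
  fun_prop

theorem exists_norm_kernF_le {M : ℕ} (hM : 2 ≤ M) {ν : ℕ → ℕ} {κ : ℕ} (hκ : ν 1 < κ) {n : ℕ}
    (hn : 1 ≤ n) (x y B : ℝ) : ∃ C, ∀ σ ∈ Icc (-(1 / 2)) B, ∀ τ : ℝ,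
    ‖kernF M ν κ n x y (σ + τ * Complex.I)‖ ≤ C * (1 + τ ^ 2)⁻¹ := by
  set P := nodeL n (numTU M ν κ n x) with hP
  obtain ⟨C, hC0, hC⟩ := exists_norm_gTU_le (M := M) hM hκ B hn (P.natDegree + 2)
  set A := ∑ i ∈ Finset.range (P.natDegree + 1), ‖P.coeff i‖ with hA
  have hA0 : 0 ≤ A := Finset.sum_nonneg fun _ _ => norm_nonneg _
  refine ⟨C * (A * (2 + |B|) ^ P.natDegree) * Real.exp ((|B| + 1) * |Real.log y|),
    fun σ hσ τ => ?_⟩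
  set s : ℂ := σ + τ * Complex.I with hs
  have hre : s.re = σ := by simp [hs]
  have him : s.im = τ := by simp [hs]
  have hB : B ≤ |B| := le_abs_self B
  have hσB : |σ| ≤ |B| + 1 / 2 := abs_le.2 ⟨by linarith [hσ.1, abs_nonneg B], by linarith [hσ.2]⟩
  have hτ := abs_nonneg τ
  have h1 := hC s (by rw [hre]; exact hσ.1) (by rw [hre]; exact hσ.2)
  rw [him] at h1
  have h2 : ‖P.eval s‖ ≤ A * (2 + |B|) ^ P.natDegree * (1 + |τ|) ^ P.natDegree := by
    refine (norm_polynomial_eval_le P s).trans ?_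
    rw [mul_assoc, ← mul_pow]
    refine mul_le_mul_of_nonneg_left (pow_le_pow_left₀ (by positivity) ?_ _) hA0
    have := Complex.norm_le_abs_re_add_abs_im s
    rw [hre, him] at this
    nlinarith [abs_nonneg B]
  have h3 : ‖Complex.exp (-(s + 1) * Real.log y)‖ ≤ Real.exp ((|B| + 1) * |Real.log y|) := by
    rw [Complex.norm_exp, Complex.re_mul_ofReal, Complex.neg_re, Complex.add_re, hre, Complex.one_re]
    refine Real.exp_le_exp.2 ((le_abs_self _).trans ?_)
    rw [abs_mul, abs_neg]
    refine mul_le_mul_of_nonneg_right ?_ (abs_nonneg _)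
    rw [abs_of_nonneg (by linarith [hσ.1])]
    linarith [hσ.2]
  have h4 : ((1 + |τ|) ^ 2)⁻¹ ≤ (1 + τ ^ 2)⁻¹ := by
    refine inv_anti₀ (by positivity) ?_
    nlinarith [sq_abs τ]
  have e : ((1 + |τ|) ^ (P.natDegree + 2))⁻¹ * (1 + |τ|) ^ P.natDegree = ((1 + |τ|) ^ 2)⁻¹ := by
    rw [pow_add, mul_inv]
    field_simp
  rw [kernF, norm_mul, norm_mul]
  calc _ ≤ (C * ((1 + |τ|) ^ (P.natDegree + 2))⁻¹) *
        (A * (2 + |B|) ^ P.natDegree * (1 + |τ|) ^ P.natDegree) *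
        Real.exp ((|B| + 1) * |Real.log y|) := by gcongr
    _ = C * (A * (2 + |B|) ^ P.natDegree) * Real.exp ((|B| + 1) * |Real.log y|) *
        (((1 + |τ|) ^ (P.natDegree + 2))⁻¹ * (1 + |τ|) ^ P.natDegree) := by ring
    _ ≤ _ := by rw [e]; gcongr

theorem integrable_kernF {M : ℕ} (hM : 2 ≤ M) {ν : ℕ → ℕ} {κ : ℕ} (hκ : ν 1 < κ) {n : ℕ}
    (hn : 1 ≤ n) (x y : ℝ) {b : ℝ} (hb : -(1 / 2) ≤ b) :
    Integrable fun τ : ℝ => kernF M ν κ n x y (b + τ * Complex.I) := by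
  obtain ⟨C, hC⟩ := exists_norm_kernF_le hM hκ hn x y b
  exact integrable_vertical_of_le (kernF_differentiableOn M ν κ n x y) (by norm_num) hC ⟨hb, le_rfl⟩

theorem KnTU_eq_integral_shift {M : ℕ} (hM : 2 ≤ M) {ν : ℕ → ℕ} (hν0 : ν 0 = 0) {κ : ℕ}
    (hκ : ν 1 < κ) {n : ℕ} (hn : 1 ≤ n) (x y : ℝ) {u : ℝ} (hu : 0 ≤ u) :
    KnTU M ν κ n x y = n / (2 * π) *
      ∫ τ : ℝ, kernF M ν κ n x y (n * (u + τ * Complex.I) - 1 / 2) := by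
  obtain ⟨C, hC⟩ := exists_norm_kernF_le hM hκ hn x y (n * u - 1 / 2)
  have hle : -(1 / 2) ≤ n * u - 1 / 2 := by
    have : 0 ≤ n * u := by positivity
    linarith
  have h := integral_vertical_eq hle (kernF_differentiableOn M ν κ n x y) (by norm_num) hC
  have hn0 : (0 : ℝ) < n := by exact_mod_cast hn
  have hsub := Measure.integral_comp_mul_left
    (fun τ : ℝ => kernF M ν κ n x y ((n * u - 1 / 2 : ℝ) + τ * Complex.I)) n
  rw [abs_of_pos (inv_pos.2 hn0), Complex.real_smul] at hsub
  have e : ∀ τ : ℝ, (n : ℂ) * (u + τ * Complex.I) - 1 / 2 =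
      (n * u - 1 / 2 : ℝ) + (n * τ : ℝ) * Complex.I := by
    intro τ; push_cast; ring
  simp only [e]
  rw [hsub, ← h, KnTU_eq_integral hn M hν0 κ x y]
  have e2 : ∀ σ : ℝ, gTU M ν κ n (sC σ) * (nodeL n (numTU M ν κ n x)).eval (sC σ) *
      Complex.exp (-(sC σ + 1) * Real.log y) =
      kernF M ν κ n x y ((-(1 / 2) : ℝ) + σ * Complex.I) := by
    intro σ
    have : ((-(1 / 2) : ℝ) : ℂ) + σ * Complex.I = sC σ := by rw [sC]; push_cast; ring
    rw [this, kernF]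
  simp only [e2]
  have : (n : ℂ) ≠ 0 := by exact_mod_cast hn0.ne'
  generalize (∫ σ : ℝ, kernF M ν κ n x y ((-(1 / 2) : ℝ) + σ * Complex.I)) = J
  rw [Complex.ofReal_inv, Complex.ofReal_natCast]
  field_simp

section ArcGeometry

variable {M : ℕ}

theorem measurable_arcR : Measurable (arcR M) := by
  refine Measurable.sqrt (Measurable.div ?_ ?_)
  · exact ((Polynomial.continuous_eval₂ _ _).comp Real.continuous_cos).measurable
  · exact ((Polynomial.continuous_eval₂ _ _).comp Real.continuous_cos).measurable

theorem measurable_arcZ : Measurable (arcZ M) := by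
  unfold arcZ
  exact (Complex.measurable_ofReal.comp measurable_arcR).mul (by fun_prop)

theorem measurable_arcZ' : Measurable (arcZ' M) := by
  unfold arcZ'
  exact ((Complex.measurable_ofReal.comp (measurable_deriv (arcR M))).add
    ((Complex.measurable_ofReal.comp measurable_arcR).mul measurable_const)).mul (by fun_prop)

variable (hM : 2 ≤ M)
include hM

omit hM in
theorem norm_arcZ'_neg (α : ℝ) : ‖arcZ' M (-α)‖ = ‖arcZ' M α‖ := by
  have : arcZ' M (-α) = -(starRingEnd ℂ) (arcZ' M α) := by
    apply Complex.ext
    · simp [arcZ'_re, deriv_arcR_neg_eq, arcR_neg]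
      ring
    · simp [arcZ'_im, deriv_arcR_neg_eq, arcR_neg]
  rw [this, norm_neg, Complex.norm_conj]

theorem exists_norm_arcZ'_le {b : ℝ} (hb : b ∈ Ioo 0 (arcMax M)) :
    ∃ C > 0, ∀ α ∈ Ico b (arcMax M), ‖arcZ' M α‖ ≤ C * -(arcZ' M α).re := by
  have hle := arcMax_le hM
  have hpi := Real.pi_pos
  have hs := (sin_pos_of_le_arcMax hM ⟨hb.1, hb.2.le⟩).1
  have hm : 0 < min (1 / 2) (Real.sin b) := lt_min (by norm_num) hs
  refine ⟨(min (1 / 2) (Real.sin b))⁻¹, inv_pos.2 hm, fun α hα => ?_⟩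
  have h0 : 0 < α := hb.1.trans_le hα.1
  have hd := deriv_arcR_neg hM ⟨h0, hα.2⟩
  have hR := arcR_nonneg (M := M) α
  have hcos : 1 / 2 ≤ Real.cos α := by
    rw [← Real.cos_pi_div_three]
    exact Real.cos_le_cos_of_nonneg_of_le_pi h0.le (by linarith) (by linarith [hα.2])
  have hsin : Real.sin b ≤ Real.sin α :=
    Real.sin_le_sin_of_le_of_le_pi_div_two (by linarith [hb.1]) (by linarith [hα.2]) hα.1
  refine (norm_arcZ'_le α).trans ?_
  rw [abs_of_neg hd, arcZ'_re, inv_mul_eq_div, le_div_iff₀ hm]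
  have h1 : -deriv (arcR M) α * min (1 / 2) (Real.sin b) ≤ -deriv (arcR M) α * Real.cos α :=
    mul_le_mul_of_nonneg_left ((min_le_left _ _).trans hcos) (by linarith)
  have h2 : arcR M α * min (1 / 2) (Real.sin b) ≤ arcR M α * Real.sin α :=
    mul_le_mul_of_nonneg_left ((min_le_right _ _).trans hsin) hR
  linarith

variable {β : ℝ} (hβ : β ∈ Ioo 0 (arcMax M))
include hβ

theorem exists_abs_arcZ_im_sub_le : ∃ C ≥ 0, ∀ α ∈ Icc 0 (arcMax M),
    |(arcZ M α).im - (arcZ M β).im| ≤ C * |(arcZ M α).re - (arcZ M β).re| := by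
  have hp := arcMax_pos hM
  have hanti := strictAntiOn_arcZ_re hM
  have hb : β / 2 ∈ Ioo 0 (arcMax M) := ⟨by linarith [hβ.1], by linarith [hβ.1, hβ.2]⟩
  have mβ : β ∈ Icc 0 (arcMax M) := ⟨hβ.1.le, hβ.2.le⟩
  obtain ⟨C, hC0, hC⟩ := exists_norm_arcZ'_le hM hb
  have hd : 0 < (arcZ M (β / 2)).re - (arcZ M β).re :=
    sub_pos.2 (hanti ⟨hb.1.le, hb.2.le⟩ mβ (by linarith [hβ.1]))
  have hR0 := arcR_nonneg (M := M) 0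
  have key : ∀ e : ℝ, |e| ≤ 1 →
      AntitoneOn (fun a => C * (arcZ M a).re + e * (arcZ M a).im) (Icc (β / 2) (arcMax M)) := by
    intro e he
    have hder : ∀ x ∈ Ioo (β / 2) (arcMax M), HasDerivAt
        (fun a => C * (arcZ M a).re + e * (arcZ M a).im)
        (C * (arcZ' M x).re + e * (arcZ' M x).im) x := fun x hx =>
      ((hasDerivAt_arcZ_re hM ⟨by linarith [hx.1, hb.1], hx.2⟩).const_mul C).add
        ((hasDerivAt_arcZ_im hM ⟨by linarith [hx.1, hb.1], hx.2⟩).const_mul e)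
    refine antitoneOn_of_deriv_nonpos (convex_Icc _ _) ?_ ?_ ?_
    · have := (continuousOn_arcZ hM).mono (Icc_subset_Icc (by linarith [hb.1]) le_rfl :
        Icc (β / 2) (arcMax M) ⊆ _)
      exact (continuousOn_const.mul (Complex.continuous_re.comp_continuousOn this)).add
        (continuousOn_const.mul (Complex.continuous_im.comp_continuousOn this))
    · rw [interior_Icc]
      exact fun x hx => (hder x hx).differentiableAt.differentiableWithinAt
    · rw [interior_Icc]
      intro x hx
      rw [(hder x hx).deriv]
      have h1 := hC x ⟨hx.1.le, hx.2⟩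
      have h2 := Complex.abs_im_le_norm (arcZ' M x)
      have h3 : e * (arcZ' M x).im ≤ |(arcZ' M x).im| := by
        refine (le_abs_self _).trans ?_
        rw [abs_mul]
        exact mul_le_of_le_one_left (abs_nonneg _) he
      linarith
  refine ⟨max C (2 * arcR M 0 / ((arcZ M (β / 2)).re - (arcZ M β).re)),
    hC0.le.trans (le_max_left _ _), fun α hα => ?_⟩
  rcases le_total α (β / 2) with h | h
  · have h1 : (arcZ M (β / 2)).re ≤ (arcZ M α).re := hanti.antitoneOn hα ⟨hb.1.le, hb.2.le⟩ h
    have h2 : ∀ a ∈ Icc 0 (arcMax M), |(arcZ M a).im| ≤ arcR M 0 := fun a ha =>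
      (Complex.abs_im_le_norm _).trans
        ((norm_arcZ a).le.trans (arcR_le hM ⟨by linarith [ha.1], ha.2⟩))
    calc |(arcZ M α).im - (arcZ M β).im| ≤ |(arcZ M α).im| + |(arcZ M β).im| := abs_sub _ _
      _ ≤ 2 * arcR M 0 := by linarith [h2 α hα, h2 β mβ]
      _ = 2 * arcR M 0 / ((arcZ M (β / 2)).re - (arcZ M β).re) *
          ((arcZ M (β / 2)).re - (arcZ M β).re) := by field_simp
      _ ≤ _ := by
        refine mul_le_mul (le_max_right _ _) ((sub_le_sub_right h1 _).trans (le_abs_self _)) hd.le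
          (hC0.le.trans (le_max_left _ _))
  · refine le_trans ?_ (mul_le_mul_of_nonneg_right (le_max_left _ _) (abs_nonneg _))
    have mα : α ∈ Icc (β / 2) (arcMax M) := ⟨h, hα.2⟩
    have mβ' : β ∈ Icc (β / 2) (arcMax M) := ⟨by linarith [hβ.1], hβ.2.le⟩
    rcases le_total α β with h' | h'
    · have k1 := key 1 (by simp) mα mβ' h'
      have k2 := key (-1) (by simp) mα mβ' h'
      have k3 := le_abs_self ((arcZ M α).re - (arcZ M β).re)
      have k4 := mul_le_mul_of_nonneg_left k3 hC0.le
      simp only at k1 k2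
      exact abs_le.2 ⟨by linarith, by linarith⟩
    · have k1 := key 1 (by simp) mβ' mα h'
      have k2 := key (-1) (by simp) mβ' mα h'
      have k3 := neg_le_abs ((arcZ M α).re - (arcZ M β).re)
      have k4 := mul_le_mul_of_nonneg_left k3 hC0.le
      simp only at k1 k2
      exact abs_le.2 ⟨by linarith, by linarith⟩

theorem arcZ_re_ne {α : ℝ} (hα : α ∈ Icc (-arcMax M) (arcMax M)) (h : |α| ≠ β) :
    (arcZ M β).re - (arcZ M α).re ≠ 0 := by
  rw [← arcZ_re_abs α, sub_ne_zero]
  exact fun he => h ((strictAntiOn_arcZ_re hM).injOn ⟨abs_nonneg _, abs_le.2 hα⟩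
    ⟨hβ.1.le, hβ.2.le⟩ he.symm)

theorem exists_inv_norm_sub_arcZ_le : ∃ C > 0, ∀ α ∈ Icc (-arcMax M) (arcMax M), |α| ≠ β →
    ∀ τ : ℝ, τ ≠ (arcZ M β).im → τ ≠ -(arcZ M β).im →
    ‖((arcZ M β).re + τ * Complex.I : ℂ) - arcZ M α‖⁻¹ ≤
      C * |(arcZ M β).re - (arcZ M α).re| ^ (-(1 / 2) : ℝ) *
      (|τ - (arcZ M β).im| ^ (-(1 / 2) : ℝ) + |τ + (arcZ M β).im| ^ (-(1 / 2) : ℝ)) := by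
  obtain ⟨C, hC0, hC⟩ := exists_abs_arcZ_im_sub_le hM hβ
  refine ⟨(1 + C) ^ (1 / 2 : ℝ), by positivity, fun α hα hne τ h1 h2 => ?_⟩
  set w : ℂ := (arcZ M β).re + τ * Complex.I with hw
  set u := (arcZ M β).re with hu
  set σ := (arcZ M β).im with hσ
  have hre : |u - (arcZ M α).re| ≤ ‖w - arcZ M α‖ := by
    have := Complex.abs_re_le_norm (w - arcZ M α)
    simpa [hw] using this
  have him : |τ - (arcZ M α).im| ≤ ‖w - arcZ M α‖ := by
    have := Complex.abs_im_le_norm (w - arcZ M α)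
    simpa [hw] using this
  have hre0 : 0 < |u - (arcZ M α).re| := abs_pos.2 (arcZ_re_ne hM hβ hα hne)
  have hpos : 0 < ‖w - arcZ M α‖ := hre0.trans_le hre
  have hbase := hC |α| ⟨abs_nonneg _, abs_le.2 hα⟩
  rw [arcZ_re_abs, abs_sub_comm (arcZ M α).re] at hbase
  have hcl : |τ - σ| ≤ (1 + C) * ‖w - arcZ M α‖ ∨ |τ + σ| ≤ (1 + C) * ‖w - arcZ M α‖ := by
    have hb' : |(arcZ M |α|).im - σ| ≤ C * ‖w - arcZ M α‖ :=
      hbase.trans (mul_le_mul_of_nonneg_left hre hC0)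
    rcases abs_choice α with h | h
    · left
      rw [h] at hb'
      have := abs_sub_le τ (arcZ M α).im σ
      linarith
    · right
      rw [h, arcZ_neg, Complex.conj_im] at hb'
      have := abs_sub_le τ (arcZ M α).im (-σ)
      rw [sub_neg_eq_add, sub_neg_eq_add] at this
      have e : |(arcZ M α).im + σ| = |-(arcZ M α).im - σ| := by rw [← abs_neg]; ring_nf
      linarith
  have fin : ∀ d : ℝ, 0 < d → d ≤ (1 + C) * ‖w - arcZ M α‖ →
      ‖w - arcZ M α‖ ^ (-(1 / 2) : ℝ) ≤ (1 + C) ^ (1 / 2 : ℝ) * d ^ (-(1 / 2) : ℝ) := by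
    intro d hd hle
    have := Real.rpow_le_rpow_of_nonpos hd hle (by norm_num : (-(1 / 2) : ℝ) ≤ 0)
    rw [Real.mul_rpow (by positivity) hpos.le, Real.rpow_neg (by positivity), inv_mul_eq_div,
      div_le_iff₀ (by positivity)] at this
    linarith
  have hA : ‖w - arcZ M α‖ ^ (-(1 / 2) : ℝ) ≤ |u - (arcZ M α).re| ^ (-(1 / 2) : ℝ) :=
    Real.rpow_le_rpow_of_nonpos hre0 hre (by norm_num)
  have hB : ‖w - arcZ M α‖ ^ (-(1 / 2) : ℝ) ≤ (1 + C) ^ (1 / 2 : ℝ) *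
      (|τ - σ| ^ (-(1 / 2) : ℝ) + |τ + σ| ^ (-(1 / 2) : ℝ)) := by
    rcases hcl with h | h
    · refine (fin _ (abs_pos.2 (sub_ne_zero.2 h1)) h).trans ?_
      gcongr
      exact le_add_of_nonneg_right (by positivity)
    · refine (fin _ (abs_pos.2 fun h0 => h2 (by linarith)) h).trans ?_
      gcongr
      exact le_add_of_nonneg_left (by positivity)
  calc ‖w - arcZ M α‖⁻¹ = ‖w - arcZ M α‖ ^ (-(1 / 2) : ℝ) * ‖w - arcZ M α‖ ^ (-(1 / 2) : ℝ) := by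
        rw [← Real.rpow_add hpos]; norm_num [Real.rpow_neg_one]
    _ ≤ _ := mul_le_mul hA hB (by positivity) (by positivity)
    _ = _ := by ring

theorem intervalIntegrable_norm_arcZ'_mul_rpow : IntervalIntegrable
    (fun α => ‖arcZ' M α‖ * |(arcZ M β).re - (arcZ M α).re| ^ (-(1 / 2) : ℝ)) volume
    (-arcMax M) (arcMax M) := by
  have hp := arcMax_pos hM
  have hanti := strictAntiOn_arcZ_re hM
  have mβ : β ∈ Icc 0 (arcMax M) := ⟨hβ.1.le, hβ.2.le⟩
  set u := (arcZ M β).re with hu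
  have hb : β / 2 ∈ Ioo 0 (arcMax M) := ⟨by linarith [hβ.1], by linarith [hβ.1, hβ.2]⟩
  obtain ⟨C, hC0, hC⟩ := exists_norm_arcZ'_le hM hb
  have hcont : ContinuousOn (fun a => (arcZ M a).re) (Icc 0 (arcMax M)) :=
    Complex.continuous_re.comp_continuousOn
      ((continuousOn_arcZ hM).mono (Icc_subset_Icc (by linarith) le_rfl))
  have i1 : IntervalIntegrable
      (fun α => -(arcZ' M α).re * |u - (arcZ M α).re| ^ (-(1 / 2) : ℝ)) volume (β / 2) β := by
    have hle : β / 2 ≤ β := by linarith [hβ.1]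
    have hsub : Icc (β / 2) β ⊆ Icc 0 (arcMax M) := Icc_subset_Icc hb.1.le hβ.2.le
    refine intervalIntegral.intervalIntegrable_deriv_of_nonneg
      (g := fun a => -2 * ((arcZ M a).re - u) ^ (1 / 2 : ℝ)) ?_ ?_ ?_
    · rw [uIcc_of_le hle]
      exact continuousOn_const.mul (((hcont.mono hsub).sub continuousOn_const).rpow_const
        fun x _ => Or.inr (by norm_num))
    · rw [min_eq_left hle, max_eq_right hle]
      intro x hx
      have hlt : 0 < (arcZ M x).re - u := sub_pos.2 (hanti (hsub ⟨hx.1.le, hx.2.le⟩) mβ hx.2)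
      refine ((((hasDerivAt_arcZ_re hM ⟨by linarith [hx.1, hb.1], hx.2.trans hβ.2⟩).sub_const
        u).rpow_const (p := 1 / 2) (Or.inl hlt.ne')).const_mul (-2)).congr_deriv ?_
      rw [abs_sub_comm, abs_of_pos hlt]
      norm_num
      ring
    · rw [min_eq_left hle, max_eq_right hle]
      intro x hx
      have := arcZ'_re_neg hM (α := x) ⟨hb.1.trans hx.1, hx.2.trans hβ.2⟩
      exact mul_nonneg (by linarith) (by positivity)
  have i2 : IntervalIntegrable
      (fun α => -(arcZ' M α).re * |u - (arcZ M α).re| ^ (-(1 / 2) : ℝ)) volume β (arcMax M) := by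
    have hle : β ≤ arcMax M := hβ.2.le
    have hsub : Icc β (arcMax M) ⊆ Icc 0 (arcMax M) := Icc_subset_Icc hβ.1.le le_rfl
    refine intervalIntegral.intervalIntegrable_deriv_of_nonneg
      (g := fun a => 2 * (u - (arcZ M a).re) ^ (1 / 2 : ℝ)) ?_ ?_ ?_
    · rw [uIcc_of_le hle]
      exact continuousOn_const.mul ((continuousOn_const.sub (hcont.mono hsub)).rpow_const
        fun x _ => Or.inr (by norm_num))
    · rw [min_eq_left hle, max_eq_right hle]
      intro x hx
      have hlt : 0 < u - (arcZ M x).re := sub_pos.2 (hanti mβ (hsub ⟨hx.1.le, hx.2.le⟩) hx.1)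
      refine ((((hasDerivAt_arcZ_re hM ⟨by linarith [hx.1, hβ.1], hx.2⟩).const_sub
        u).rpow_const (p := 1 / 2) (Or.inl hlt.ne')).const_mul 2).congr_deriv ?_
      rw [abs_of_pos hlt]
      norm_num
      ring
    · rw [min_eq_left hle, max_eq_right hle]
      intro x hx
      have := arcZ'_re_neg hM (α := x) ⟨hβ.1.trans hx.1, hx.2⟩
      exact mul_nonneg (by linarith) (by positivity)
  have hmeas : Measurable
      (fun α => ‖arcZ' M α‖ * |u - (arcZ M α).re| ^ (-(1 / 2) : ℝ)) := by
    refine measurable_arcZ'.norm.mul (Measurable.pow_const ?_ _)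
    exact (measurable_const.sub (Complex.measurable_re.comp measurable_arcZ)).abs
  have i3 : IntervalIntegrable
      (fun α => ‖arcZ' M α‖ * |u - (arcZ M α).re| ^ (-(1 / 2) : ℝ)) volume (β / 2) (arcMax M) := by
    refine ((i1.trans i2).const_mul C).mono_fun' hmeas.aestronglyMeasurable ?_
    rw [uIoc_of_le hb.2.le, ← restrict_Ioo_eq_restrict_Ioc]
    refine (ae_restrict_iff' measurableSet_Ioo).2 (Eventually.of_forall fun α hα => ?_)
    show ‖‖arcZ' M α‖ * |u - (arcZ M α).re| ^ (-(1 / 2) : ℝ)‖ ≤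
      C * (-(arcZ' M α).re * |u - (arcZ M α).re| ^ (-(1 / 2) : ℝ))
    rw [Real.norm_of_nonneg (by positivity), ← mul_assoc]
    exact mul_le_mul_of_nonneg_right (hC α ⟨hα.1.le, hα.2⟩) (by positivity)
  have i4 : IntervalIntegrable
      (fun α => ‖arcZ' M α‖ * |u - (arcZ M α).re| ^ (-(1 / 2) : ℝ)) volume 0 (β / 2) := by
    refine IntervalIntegrable.mul_continuousOn ?_ ?_
    · refine ((intervalIntegrable_arcZ' hM).mono_set ?_).norm
      rw [uIcc_of_le hb.1.le, uIcc_of_le (by linarith)]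
      exact Icc_subset_Icc (by linarith) hb.2.le
    · rw [uIcc_of_le hb.1.le]
      have hsub : Icc 0 (β / 2) ⊆ Icc 0 (arcMax M) := Icc_subset_Icc le_rfl hb.2.le
      refine ContinuousOn.rpow_const (continuousOn_const.sub (hcont.mono hsub)).abs
        fun x hx => Or.inl (abs_ne_zero.2 ?_)
      refine arcZ_re_ne hM hβ ⟨by linarith [hx.1], (hsub hx).2⟩ ?_
      rw [abs_of_nonneg hx.1]
      linarith [hx.2, hβ.1]
  have i5 := i4.trans i3
  refine IntervalIntegrable.trans (b := 0) ?_ i5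
  have h2 := (IntervalIntegrable.iff_comp_neg enorm_ne_top).1 i5
  simp only [norm_arcZ'_neg, neg_zero, arcZ_neg, Complex.conj_re] at h2
  exact h2.symm

end ArcGeometry

theorem pow_le_factorial_mul_exp (N : ℕ) {c x : ℝ} (hc : 0 < c) (hx : 0 ≤ x) :
    x ^ N ≤ N.factorial * (c⁻¹) ^ N * Real.exp (c * x) := by
  have h := Real.pow_div_factorial_le_exp (c * x) (by positivity) N
  rw [div_le_iff₀ (by positivity), mul_pow] at h
  calc x ^ N = (c⁻¹) ^ N * (c ^ N * x ^ N) := by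
        rw [← mul_assoc, ← mul_pow, inv_mul_cancel₀ hc.ne', one_pow, one_mul]
    _ ≤ (c⁻¹) ^ N * (Real.exp (c * x) * N.factorial) := by gcongr
    _ = _ := by ring

/-- An integrable bump with an inverse square root singularity at the origin. -/
noncomputable def sqrtBump (c t : ℝ) : ℝ := |t| ^ (-(1 / 2) : ℝ) * Real.exp (-c * |t|)

theorem sqrtBump_nonneg (c t : ℝ) : 0 ≤ sqrtBump c t := by unfold sqrtBump; positivity

theorem integrable_sqrtBump {c : ℝ} (hc : 0 < c) : Integrable (sqrtBump c) := by
  have h : IntegrableOn (sqrtBump c) (Ioi 0) := by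
    refine (integrableOn_rpow_mul_exp_neg_mul_rpow (p := 1) (s := -(1 / 2)) (by norm_num)
      one_pos hc).congr_fun (fun t ht => ?_) measurableSet_Ioi
    simp only [sqrtBump, abs_of_pos (mem_Ioi.1 ht), Real.rpow_one]
  have h2 : IntegrableOn (sqrtBump c) (Iio 0) := by
    have := ((Measure.measurePreserving_neg (volume : Measure ℝ)).integrableOn_comp_preimage
      (Homeomorph.neg ℝ).measurableEmbedding).2 h
    have e : sqrtBump c ∘ Neg.neg = sqrtBump c := by funext t; simp [sqrtBump]
    rw [e] at this
    simpa using this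
  rw [← integrableOn_univ, ← Iic_union_Ioi (a := (0 : ℝ))]
  exact ((integrableOn_Iic_iff_integrableOn_Iio enorm_ne_top).2 h2).union h

/-- The weight along the arc coming from the ratio of the gamma factors. -/
noncomputable def arcWeight (M : ℕ) (x0 β : ℝ) (N n : ℕ) (α : ℝ) : ℝ :=
  (n : ℝ) ^ N * ((max (1 / 2) (n * (arcZ M α).re)) ^ N)⁻¹ *
    Real.exp (n * (phaseG M x0 (arcZ M α) - phaseG M x0 (arcZ M β)))

theorem arcWeight_nonneg (M : ℕ) (x0 β : ℝ) (N n : ℕ) (α : ℝ) : 0 ≤ arcWeight M x0 β N n α := by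
  unfold arcWeight
  have : (0 : ℝ) ≤ max (1 / 2) (n * (arcZ M α).re) := le_max_of_le_left (by norm_num)
  positivity

theorem arcWeight_abs (M : ℕ) (x0 β : ℝ) (N n : ℕ) (α : ℝ) :
    arcWeight M x0 β N n |α| = arcWeight M x0 β N n α := by
  rcases abs_choice α with h | h <;> rw [h]
  simp [arcWeight, arcZ_neg, phaseG_conj]

theorem measurable_stirlingT : Measurable stirlingT := by
  unfold stirlingT
  exact (measurable_id.mul Complex.measurable_log).sub measurable_id

theorem measurable_arcWeight (M : ℕ) (x0 β : ℝ) (N n : ℕ) : Measurable (arcWeight M x0 β N n) := by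
  have h1 := Complex.measurable_re.comp (measurable_arcZ (M := M))
  have h2 : Measurable (phaseG M x0) := by
    unfold phaseG
    have := measurable_stirlingT
    exact (((Complex.measurable_re.mul_const _).add (Complex.measurable_re.comp
      (measurable_stirlingT.comp (measurable_id.sub_const 1)))).add (Complex.measurable_re.comp
      (measurable_stirlingT.comp (measurable_id.add_const 1)))).sub
      ((Complex.measurable_re.comp measurable_stirlingT).const_mul _)
  refine (((measurable_const.max (h1.const_mul _)).pow_const N).inv.const_mul _).mul
    (Real.measurable_exp.comp (Measurable.const_mul ?_ _))
  exact (h2.comp measurable_arcZ).sub_const _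

section Estimates

variable {M : ℕ} (hM : 2 ≤ M)
include hM

variable {β x0 : ℝ} (hβ : β ∈ Ioo 0 (arcMax M))
include hβ

omit hβ in
theorem arcWeight_le {N n : ℕ} (hn : 1 ≤ n) {α : ℝ} (hα : α ∈ Ioo (-arcMax M) (arcMax M)) :
    arcWeight M x0 β N n α ≤ ((arcZ M α).re⁻¹) ^ N *
      Real.exp (n * (phaseG M x0 (arcZ M α) - phaseG M x0 (arcZ M β))) := by
  have hr := arcZ_re_pos hM hα
  have hn0 : (0 : ℝ) < n := by exact_mod_cast hn
  refine mul_le_mul_of_nonneg_right ?_ (Real.exp_pos _).le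
  rw [← inv_pow, ← mul_pow]
  refine pow_le_pow_left₀ (mul_nonneg hn0.le (inv_nonneg.2 (le_max_of_le_left (by norm_num)))) ?_ N
  rw [← div_eq_mul_inv, div_le_iff₀ (lt_max_of_lt_left (by norm_num))]
  calc (n : ℝ) = (arcZ M α).re⁻¹ * (n * (arcZ M α).re) := by field_simp
    _ ≤ _ := mul_le_mul_of_nonneg_left (le_max_right _ _) (inv_nonneg.2 hr.le)

variable (hx0 : Real.log x0 = saddleLog M β)
include hx0

theorem phaseG_arcZ_lt {α : ℝ} (hα : α ∈ Ioo 0 (arcMax M)) (h : α ≠ β) :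
    phaseG M x0 (arcZ M α) < phaseG M x0 (arcZ M β) := by
  rcases h.lt_or_gt with h | h
  · exact strictMonoOn_phaseG_arcZ hM hβ hx0 ⟨hα.1, h.le⟩ ⟨hβ.1, le_rfl⟩ h
  · exact strictAntiOn_phaseG_arcZ hM hβ hx0 ⟨le_rfl, hβ.2⟩ ⟨h.le, hα.2⟩ h

theorem phaseG_arcZ_le {α : ℝ} (hα : α ∈ Ioo 0 (arcMax M)) :
    phaseG M x0 (arcZ M α) ≤ phaseG M x0 (arcZ M β) := by
  rcases eq_or_ne α β with h | h
  · rw [h]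
  · exact (phaseG_arcZ_lt hM hβ hx0 hα h).le

omit hM hβ hx0 in
theorem abs_mem_Ioo_arcMax {α : ℝ} (hα : α ∈ Ioo (-arcMax M) (arcMax M)) (h : α ≠ 0) :
    |α| ∈ Ioo 0 (arcMax M) := ⟨abs_pos.2 h, abs_lt.2 hα⟩

theorem tendsto_arcWeight (N : ℕ) {α : ℝ} (hα : α ∈ Ioo (-arcMax M) (arcMax M)) (h0 : α ≠ 0)
    (h : |α| ≠ β) : Tendsto (fun n => arcWeight M x0 β N n α) atTop (𝓝 0) := by
  have hm := abs_mem_Ioo_arcMax hα h0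
  have hlt := phaseG_arcZ_lt hM hβ hx0 hm h
  set δ := phaseG M x0 (arcZ M |α|) - phaseG M x0 (arcZ M β) with hδ
  have hz : Tendsto (fun n : ℕ => ((arcZ M |α|).re⁻¹) ^ N * Real.exp (n * δ)) atTop (𝓝 0) := by
    have : Tendsto (fun n : ℕ => Real.exp (n * δ)) atTop (𝓝 0) :=
      Real.tendsto_exp_atBot.comp
        (tendsto_natCast_atTop_atTop.atTop_mul_const_of_neg (sub_neg.2 hlt))
    simpa using this.const_mul (((arcZ M |α|).re⁻¹) ^ N)
  refine squeeze_zero' (Eventually.of_forall fun n => arcWeight_nonneg _ _ _ _ _ _) ?_ hz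
  filter_upwards [eventually_ge_atTop 1] with n hn
  rw [← arcWeight_abs]
  exact arcWeight_le hM hn ⟨by linarith [hm.1, hm.2], hm.2⟩

theorem exists_arcWeight_le (N : ℕ) : ∃ Q > 0, ∀ n : ℕ, 1 ≤ n → ∀ α ∈ Ioo (-arcMax M) (arcMax M),
    α ≠ 0 → arcWeight M x0 β N n α ≤ Q := by
  obtain ⟨e, he⟩ : ∃ e, e ∈ Ioo β (arcMax M) := exists_between hβ.2
  have me : e ∈ Ioo 0 (arcMax M) := ⟨hβ.1.trans he.1, he.2⟩
  have hlt := phaseG_arcZ_lt hM hβ hx0 me he.1.ne'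
  set δ := phaseG M x0 (arcZ M β) - phaseG M x0 (arcZ M e) with hδ
  have hδ0 : 0 < δ := sub_pos.2 hlt
  have hre := arcZ_re_pos hM (α := e) ⟨by linarith [me.1, me.2], me.2⟩
  refine ⟨((arcZ M e).re⁻¹) ^ N + 2 ^ N * (N.factorial * (δ⁻¹) ^ N), by positivity,
    fun n hn α hα h0 => ?_⟩
  rw [← arcWeight_abs]
  have hm := abs_mem_Ioo_arcMax hα h0
  rcases le_total |α| e with h | h
  · refine (arcWeight_le hM hn ⟨by linarith [hm.1, hm.2], hm.2⟩).trans ?_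
    have h1 : (arcZ M e).re ≤ (arcZ M |α|).re :=
      (strictAntiOn_arcZ_re hM).antitoneOn ⟨hm.1.le, hm.2.le⟩ ⟨me.1.le, me.2.le⟩ h
    have h2 := phaseG_arcZ_le hM hβ hx0 hm
    have h3 : Real.exp (n * (phaseG M x0 (arcZ M |α|) - phaseG M x0 (arcZ M β))) ≤ 1 :=
      Real.exp_le_one_iff.2 (mul_nonpos_of_nonneg_of_nonpos n.cast_nonneg (by linarith))
    have h4 : ((arcZ M |α|).re⁻¹) ^ N ≤ ((arcZ M e).re⁻¹) ^ N := by
      have := hre.trans_le h1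
      gcongr
    calc _ ≤ ((arcZ M e).re⁻¹) ^ N * 1 := mul_le_mul h4 h3 (Real.exp_pos _).le (by positivity)
      _ ≤ _ := by rw [mul_one]; exact le_add_of_nonneg_right (by positivity)
  · have h1 : phaseG M x0 (arcZ M |α|) ≤ phaseG M x0 (arcZ M e) :=
      (strictAntiOn_phaseG_arcZ hM hβ hx0).antitoneOn ⟨he.1.le, he.2⟩
        ⟨he.1.le.trans h, hm.2⟩ h
    have h2 : ((max (1 / 2) (n * (arcZ M |α|).re)) ^ N)⁻¹ ≤ 2 ^ N := by
      rw [← inv_pow]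
      refine pow_le_pow_left₀ (inv_nonneg.2 (le_max_of_le_left (by norm_num))) ?_ N
      rw [← inv_inv (2 : ℝ)]
      exact inv_anti₀ (by norm_num) (le_max_of_le_left (by norm_num))
    have h3 := pow_le_factorial_mul_exp N hδ0 (n.cast_nonneg (α := ℝ))
    have h4 : Real.exp (n * (phaseG M x0 (arcZ M |α|) - phaseG M x0 (arcZ M β))) ≤
        Real.exp (-(δ * n)) := by
      refine Real.exp_le_exp.2 ?_
      have : (0 : ℝ) ≤ n := n.cast_nonneg
      nlinarith
    calc arcWeight M x0 β N n |α| ≤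
          (N.factorial * (δ⁻¹) ^ N * Real.exp (δ * n)) * 2 ^ N * Real.exp (-(δ * n)) := by
          unfold arcWeight
          have : (0 : ℝ) ≤ ((max (1 / 2) (n * (arcZ M |α|).re)) ^ N)⁻¹ :=
            inv_nonneg.2 (pow_nonneg (le_max_of_le_left (by norm_num)) _)
          gcongr
      _ = 2 ^ N * (N.factorial * (δ⁻¹) ^ N) * (Real.exp (δ * n) * Real.exp (-(δ * n))) := by ring
      _ ≤ _ := by
        rw [← Real.exp_add, add_neg_cancel, Real.exp_zero, mul_one]
        exact le_add_of_nonneg_left (by positivity)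

omit hβ hx0 in
theorem ae_mem_uIoc_arcMax (β : ℝ) : ∀ᵐ α : ℝ, α ∈ uIoc (-arcMax M) (arcMax M) →
    α ∈ Ioo (-arcMax M) (arcMax M) ∧ α ≠ 0 ∧ |α| ≠ β := by
  have hp := arcMax_pos hM
  have hfin : ({0, β, -β, arcMax M} : Set ℝ).Finite := by simp
  filter_upwards [hfin.countable.ae_notMem volume] with α hα hm
  rw [uIoc_of_le (by linarith)] at hm
  simp only [mem_insert_iff, mem_singleton_iff, not_or] at hα
  refine ⟨⟨hm.1, lt_of_le_of_ne hm.2 hα.2.2.2⟩, hα.1, fun h => ?_⟩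
  rcases abs_choice α with h' | h' <;> rw [h'] at h
  · exact hα.2.1 h
  · exact hα.2.2.1 (by linarith)

/-- The integrated weight along the arc tends to zero. -/
theorem tendsto_integral_arcWeight (N : ℕ) : Tendsto (fun n : ℕ => ∫ α in -arcMax M..arcMax M,
      ‖arcZ' M α‖ * |(arcZ M β).re - (arcZ M α).re| ^ (-(1 / 2) : ℝ) * arcWeight M x0 β N n α)
    atTop (𝓝 0) := by
  have hp := arcMax_pos hM
  obtain ⟨Q, hQ0, hQ⟩ := exists_arcWeight_le hM hβ hx0 N
  have h_int := (intervalIntegrable_norm_arcZ'_mul_rpow hM hβ).mul_const Q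
  have hne := ae_mem_uIoc_arcMax hM β
  have := intervalIntegral.tendsto_integral_filter_of_dominated_convergence (μ := volume)
    (a := -arcMax M) (b := arcMax M) (l := atTop)
    (F := fun (n : ℕ) α => ‖arcZ' M α‖ * |(arcZ M β).re - (arcZ M α).re| ^ (-(1 / 2) : ℝ) *
      arcWeight M x0 β N n α) (f := fun _ => (0 : ℝ)) _ ?_ ?_ h_int ?_
  · simpa using this
  · refine Eventually.of_forall fun n => Measurable.aestronglyMeasurable ?_
    refine (measurable_arcZ'.norm.mul (Measurable.pow_const ?_ _)).mul (measurable_arcWeight _ _ _ _ _)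
    exact (measurable_const.sub (Complex.measurable_re.comp measurable_arcZ)).abs
  · filter_upwards [eventually_ge_atTop 1] with n hn
    filter_upwards [hne] with α hα hm
    obtain ⟨h1, h2, h3⟩ := hα hm
    rw [Real.norm_of_nonneg (mul_nonneg (by positivity) (arcWeight_nonneg _ _ _ _ _ _))]
    exact mul_le_mul_of_nonneg_left (hQ n hn α h1 h2) (by positivity)
  · filter_upwards [hne] with α hα hm
    obtain ⟨h1, h2, h3⟩ := hα hm
    simpa using (tendsto_arcWeight hM hβ hx0 N h1 h2 h3).const_mul
      (‖arcZ' M α‖ * |(arcZ M β).re - (arcZ M α).re| ^ (-(1 / 2) : ℝ))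

omit hx0 in
theorem exists_vertical_weight_le (x0 : ℝ) (N : ℕ) : ∃ C > 0, ∃ c > 0, ∀ n : ℕ, 1 ≤ n → ∀ τ : ℝ, τ ≠ 0 →
    (1 + ‖((arcZ M β).re + τ * Complex.I : ℂ)‖) ^ N *
      Real.exp (-(n * (phaseG M x0 ((arcZ M β).re + τ * Complex.I) - phaseG M x0 (arcZ M β)))) ≤
    C * Real.exp (-c * |τ|) := by
  obtain ⟨c, hc, K, hK⟩ := exists_phaseG_vertical_growth hM x0 hβ
  have hu := arcZ_re_pos hM (α := β) ⟨by linarith [hβ.1, hβ.2], hβ.2⟩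
  set u := (arcZ M β).re with hu'
  refine ⟨N.factorial * ((c / 2)⁻¹) ^ N * Real.exp (c / 2 * (1 + u)) * Real.exp K, by positivity,
    c / 2, by positivity, fun n hn τ hτ => ?_⟩
  have h1 : 1 + ‖(u + τ * Complex.I : ℂ)‖ ≤ 1 + u + |τ| := by
    have := Complex.norm_le_abs_re_add_abs_im (u + τ * Complex.I : ℂ)
    simp only [Complex.add_re, Complex.add_im, Complex.ofReal_re, Complex.ofReal_im,
      Complex.re_ofReal_mul, Complex.im_ofReal_mul, Complex.I_re, Complex.I_im, mul_zero,
      mul_one, add_zero, zero_add, abs_of_pos hu] at this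
    linarith
  have h2 := pow_le_factorial_mul_exp N (c := c / 2) (by positivity) (x := 1 + u + |τ|) (by positivity)
  have h3 : -(n * (phaseG M x0 (u + τ * Complex.I) - phaseG M x0 (arcZ M β))) ≤ K - c * |τ| := by
    have g1 := hK τ hτ
    have g2 := phaseG_vertical_ge hM x0 hβ hτ
    have : (1 : ℝ) ≤ n := by exact_mod_cast hn
    nlinarith
  calc _ ≤ (N.factorial * ((c / 2)⁻¹) ^ N * Real.exp (c / 2 * (1 + u + |τ|))) *
        Real.exp (K - c * |τ|) := by
        refine mul_le_mul ?_ (Real.exp_le_exp.2 h3) (Real.exp_pos _).le (by positivity)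
        exact (pow_le_pow_left₀ (by positivity) h1 N).trans h2
    _ = N.factorial * ((c / 2)⁻¹) ^ N *
        (Real.exp (c / 2 * (1 + u + |τ|)) * Real.exp (K - c * |τ|)) := by ring
    _ = N.factorial * ((c / 2)⁻¹) ^ N * (Real.exp (c / 2 * (1 + u)) * Real.exp K *
        Real.exp (-(c / 2) * |τ|)) := by
        rw [← Real.exp_add, ← Real.exp_add, ← Real.exp_add]
        ring_nf
    _ = _ := by ring

end Estimates

section ErrorBound

variable {M : ℕ} (hM : 2 ≤ M)
include hM

theorem exists_norm_integrandTU_le (ν : ℕ → ℕ) {κ : ℕ} (hκ : 1 ≤ κ) (x0 β D : ℝ)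
    {u : ℝ} (hu : 0 ≤ u) :
    ∃ C > 0, ∀ n : ℕ, 1 ≤ n → ∀ x y : ℝ,
      |Real.log x - (Real.log x0 + (M - 1) * Real.log n)| ≤ D / n →
      |Real.log y - (Real.log x0 + (M - 1) * Real.log n)| ≤ D / n →
      ∀ τ : ℝ, ∀ α ∈ Ioo (-arcMax M) (arcMax M), α ≠ 0 →
      ‖(n : ℂ) * integrandTU M ν κ n x y (n * (u + τ * Complex.I) - 1 / 2)
          (n * arcZ M α - 1 / 2)‖ * Real.exp (Real.log x0 + (M - 1) * Real.log n) ≤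
        C * ((1 + ‖(u + τ * Complex.I : ℂ)‖) ^ (∑ j ∈ Finset.range (M + 1), ν j) *
          Real.exp (-(n * (phaseG M x0 (u + τ * Complex.I) - phaseG M x0 (arcZ M β))))) *
          arcWeight M x0 β (∑ j ∈ Finset.range (M + 1), ν j) n α *
          ‖(u + τ * Complex.I : ℂ) - arcZ M α‖⁻¹ := by
  obtain ⟨C1, hC1, h1⟩ := exists_norm_factorTU_le M ν hκ x0
  obtain ⟨c, hc, hg⟩ := exists_le_norm_inv_Gamma_arcZ hM
  have hp := arcMax_pos hM
  have hR0 : 0 ≤ arcR M 0 := (norm_nonneg _).trans_eq (norm_arcZ (M := M) 0)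
  obtain ⟨C2, hC2, h2⟩ := exists_le_norm_factorTU M ν hκ x0
    (B := arcR M 0 + 1) (c := c) (by positivity) hc
  refine ⟨C1 * C2⁻¹ * Real.exp ((arcR M 0 + u + 2) * D), by positivity,
    fun n hn x y hx hy τ α hα h0 => ?_⟩
  set N := ∑ j ∈ Finset.range (M + 1), ν j with hN
  set L := Real.log x0 + (M - 1) * Real.log n with hL
  set w : ℂ := u + τ * Complex.I with hw
  set z := arcZ M α with hz
  have hwre : w.re = u := by simp [hw]
  have hn0 : (0 : ℝ) < n := by exact_mod_cast hn
  have hzre : 0 < z.re := arcZ_re_pos hM hα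
  have hznorm : ‖z‖ ≤ arcR M 0 := (norm_arcZ α).trans_le (arcR_le hM (Ioo_subset_Icc_self hα))
  have hzre' : z.re ≤ arcR M 0 := (Complex.re_le_norm z).trans hznorm
  have hA := h1 n hn w (hwre ▸ hu)
  have hB := h2 n hn z hzre.le (hznorm.trans (by linarith)) (hg n hn α hα h0)
  set m := max (1 / 2) (n * z.re) with hm
  have hm0 : 0 < m := lt_max_of_lt_left (by norm_num)
  have hk : (0 : ℝ) < (n : ℝ) ^ (κ - 1) := by positivity
  have hAB : ‖factorTU M ν κ n (n * w - 1 / 2)‖ * ‖factorTU M ν κ n (n * z - 1 / 2)‖⁻¹ ≤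
      (C1 * (n * (1 + ‖w‖)) ^ N * Real.exp (-(n * phaseG M x0 w) + n * u * L)) *
      (C2 * m ^ N * Real.exp (-(n * phaseG M x0 z) + n * z.re * L))⁻¹ := by
    rw [hwre] at hA
    calc _ = (‖factorTU M ν κ n (n * w - 1 / 2)‖ * n ^ (κ - 1)) *
        (‖factorTU M ν κ n (n * z - 1 / 2)‖ * n ^ (κ - 1))⁻¹ := by
          rw [mul_inv]
          field_simp
      _ ≤ _ := by
          refine mul_le_mul hA (inv_anti₀ (by positivity) hB) (by positivity) (by positivity)
  have hx' : ‖Complex.exp ((n * z - 1 / 2) * Real.log x)‖ ≤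
      Real.exp ((n * z.re - 1 / 2) * L + (arcR M 0 + 1) * D) := by
    have e : ((n * z - 1 / 2) * Real.log x : ℂ).re = (n * z.re - 1 / 2) * Real.log x := by
      rw [Complex.re_mul_ofReal]
      simp
    rw [Complex.norm_exp, e, Real.exp_le_exp]
    have h3 : (n * z.re - 1 / 2) * (Real.log x - L) ≤ (arcR M 0 + 1) * n * (D / n) := by
      refine (le_abs_self _).trans ?_
      rw [abs_mul]
      refine mul_le_mul ?_ hx (abs_nonneg _) (by positivity)
      have : (1 : ℝ) ≤ n := by exact_mod_cast hn
      rw [abs_le]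
      constructor <;> nlinarith
    have h4 : (arcR M 0 + 1) * n * (D / n) = (arcR M 0 + 1) * D := by field_simp
    linarith
  have hy' : ‖Complex.exp (-((n * w - 1 / 2) + 1) * Real.log y)‖ ≤
      Real.exp (-(n * u + 1 / 2) * L + (u + 1) * D) := by
    have e : (-((n * w - 1 / 2) + 1) * Real.log y : ℂ).re = -(n * u + 1 / 2) * Real.log y := by
      rw [Complex.re_mul_ofReal]
      simp [hwre]
      left
      ring
    rw [Complex.norm_exp, e, Real.exp_le_exp]
    have h3 : -(n * u + 1 / 2) * (Real.log y - L) ≤ (u + 1) * n * (D / n) := by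
      refine (le_abs_self _).trans ?_
      rw [abs_mul]
      refine mul_le_mul ?_ hy (abs_nonneg _) (by positivity)
      have : (1 : ℝ) ≤ n := by exact_mod_cast hn
      rw [abs_neg, abs_of_nonneg (by positivity)]
      nlinarith
    have h4 : (u + 1) * n * (D / n) = (u + 1) * D := by field_simp
    linarith
  have hst : (n * w - 1 / 2 - (n * z - 1 / 2) : ℂ) = n * (w - z) := by ring
  rw [integrandTU_eq, hst]
  rw [norm_mul, norm_div, norm_mul, norm_mul, norm_mul, norm_inv, norm_mul, Complex.norm_natCast]
  calc _ = (‖factorTU M ν κ n (n * w - 1 / 2)‖ * ‖factorTU M ν κ n (n * z - 1 / 2)‖⁻¹) *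
      ‖Complex.exp ((n * z - 1 / 2) * Real.log x)‖ *
      ‖Complex.exp (-((n * w - 1 / 2) + 1) * Real.log y)‖ * ‖w - z‖⁻¹ * Real.exp L := by
        rw [div_eq_mul_inv, mul_inv]
        field_simp
    _ ≤ ((C1 * (n * (1 + ‖w‖)) ^ N * Real.exp (-(n * phaseG M x0 w) + n * u * L)) *
      (C2 * m ^ N * Real.exp (-(n * phaseG M x0 z) + n * z.re * L))⁻¹) *
      Real.exp ((n * z.re - 1 / 2) * L + (arcR M 0 + 1) * D) *
      Real.exp (-(n * u + 1 / 2) * L + (u + 1) * D) * ‖w - z‖⁻¹ * Real.exp L := by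
        gcongr
    _ = (C1 * C2⁻¹ * (1 + ‖w‖) ^ N * n ^ N * (m ^ N)⁻¹ * ‖w - z‖⁻¹) *
        (Real.exp (-(n * phaseG M x0 w) + n * u * L) *
        (Real.exp (-(n * phaseG M x0 z) + n * z.re * L))⁻¹ *
        Real.exp ((n * z.re - 1 / 2) * L + (arcR M 0 + 1) * D) *
        Real.exp (-(n * u + 1 / 2) * L + (u + 1) * D) * Real.exp L) := by
        rw [mul_inv, mul_inv, mul_pow]; ring
    _ = (C1 * C2⁻¹ * (1 + ‖w‖) ^ N * n ^ N * (m ^ N)⁻¹ * ‖w - z‖⁻¹) *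
        (Real.exp ((arcR M 0 + u + 2) * D) *
        Real.exp (-(n * (phaseG M x0 w - phaseG M x0 (arcZ M β)))) *
        Real.exp (n * (phaseG M x0 z - phaseG M x0 (arcZ M β)))) := by
        rw [← Real.exp_neg, ← Real.exp_add, ← Real.exp_add, ← Real.exp_add, ← Real.exp_add,
          ← Real.exp_add, ← Real.exp_add]
        ring_nf
    _ = _ := by
        unfold arcWeight
        ring

end ErrorBound

section ArcBound

variable {M : ℕ} (hM : 2 ≤ M)
include hM
variable {β x0 : ℝ} (hβ : β ∈ Ioo 0 (arcMax M))
include hβ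

omit hM hβ in
theorem exp_neg_mul_abs_le {c : ℝ} (hc : 0 < c) (τ σ : ℝ) :
    Real.exp (-c * |τ|) ≤ Real.exp (c * |σ|) * Real.exp (-c * |τ + σ|) := by
  rw [← Real.exp_add, Real.exp_le_exp]
  nlinarith [abs_add_le τ σ]

variable (hx0 : Real.log x0 = saddleLog M β)
include hx0

theorem intervalIntegrable_arcWeight {N n : ℕ} (hn : 1 ≤ n) : IntervalIntegrable (fun α =>
      ‖arcZ' M α‖ * |(arcZ M β).re - (arcZ M α).re| ^ (-(1 / 2) : ℝ) * arcWeight M x0 β N n α)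
    volume (-arcMax M) (arcMax M) := by
  have hp := arcMax_pos hM
  obtain ⟨Q, hQ0, hQ⟩ := exists_arcWeight_le hM hβ hx0 N
  refine ((intervalIntegrable_norm_arcZ'_mul_rpow hM hβ).mul_const Q).mono_fun ?_ ?_
  · refine Measurable.aestronglyMeasurable ?_
    refine (measurable_arcZ'.norm.mul (Measurable.pow_const ?_ _)).mul (measurable_arcWeight _ _ _ _ _)
    exact (measurable_const.sub (Complex.measurable_re.comp measurable_arcZ)).abs
  · rw [EventuallyLE, ae_restrict_iff' measurableSet_uIoc]
    filter_upwards [ae_mem_uIoc_arcMax hM β] with α hα hm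
    obtain ⟨h1, h2, h3⟩ := hα hm
    rw [Real.norm_of_nonneg (mul_nonneg (by positivity) (arcWeight_nonneg _ _ _ _ _ _)),
      Real.norm_of_nonneg (by positivity)]
    exact mul_le_mul_of_nonneg_left (hQ n hn α h1 h2) (by positivity)

theorem exists_norm_integral_arc_le (ν : ℕ → ℕ) {κ : ℕ} (hκ : 1 ≤ κ) (D : ℝ) :
    ∃ C > 0, ∃ c > 0, ∀ n : ℕ, 1 ≤ n → ∀ x y : ℝ,
      |Real.log x - (Real.log x0 + (M - 1) * Real.log n)| ≤ D / n →
      |Real.log y - (Real.log x0 + (M - 1) * Real.log n)| ≤ D / n →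
      ∀ τ : ℝ, τ ≠ 0 → τ ≠ (arcZ M β).im → τ ≠ -(arcZ M β).im →
      ‖∫ α in -arcMax M..arcMax M, n * arcZ' M α * integrandTU M ν κ n x y
          (n * ((arcZ M β).re + τ * Complex.I) - 1 / 2) (n * arcZ M α - 1 / 2)‖ *
        Real.exp (Real.log x0 + (M - 1) * Real.log n) ≤
      C * (∫ α in -arcMax M..arcMax M,
        ‖arcZ' M α‖ * |(arcZ M β).re - (arcZ M α).re| ^ (-(1 / 2) : ℝ) *
          arcWeight M x0 β (∑ j ∈ Finset.range (M + 1), ν j) n α) *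
        (sqrtBump c (τ - (arcZ M β).im) + sqrtBump c (τ + (arcZ M β).im)) := by
  have hp := arcMax_pos hM
  have hu := arcZ_re_pos hM (α := β) ⟨by linarith [hβ.1, hβ.2], hβ.2⟩
  obtain ⟨C1, hC1, h1⟩ := exists_norm_integrandTU_le hM ν hκ x0 β D hu.le
  obtain ⟨C2, hC2, c, hc, h2⟩ := exists_vertical_weight_le hM hβ x0
    (∑ j ∈ Finset.range (M + 1), ν j)
  obtain ⟨C3, hC3, h3⟩ := exists_inv_norm_sub_arcZ_le hM hβ
  set N := ∑ j ∈ Finset.range (M + 1), ν j with hN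
  set u := (arcZ M β).re with hu'
  set σ := (arcZ M β).im with hσ
  refine ⟨C1 * C2 * C3 * Real.exp (c * |σ|), by positivity, c, hc,
    fun n hn x y hx hy τ hτ0 hτ1 hτ2 => ?_⟩
  set L := Real.log x0 + (M - 1) * Real.log n with hL
  set W := fun α => ‖arcZ' M α‖ * |u - (arcZ M α).re| ^ (-(1 / 2) : ℝ) * arcWeight M x0 β N n α
    with hW
  set J := sqrtBump c (τ - σ) + sqrtBump c (τ + σ) with hJ
  set K := C1 * C2 * C3 * Real.exp (c * |σ|) with hK
  have hJe : Real.exp (-c * |τ|) * (|τ - σ| ^ (-(1 / 2) : ℝ) + |τ + σ| ^ (-(1 / 2) : ℝ)) ≤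
      Real.exp (c * |σ|) * J := by
    have e1 := exp_neg_mul_abs_le hc τ σ
    have e2 := exp_neg_mul_abs_le hc τ (-σ)
    rw [abs_neg, ← sub_eq_add_neg] at e2
    rw [hJ, mul_add, mul_add]
    unfold sqrtBump
    have p1 : 0 ≤ |τ - σ| ^ (-(1 / 2) : ℝ) := by positivity
    have p2 : 0 ≤ |τ + σ| ^ (-(1 / 2) : ℝ) := by positivity
    nlinarith [mul_le_mul_of_nonneg_left e2 p1, mul_le_mul_of_nonneg_left e1 p2]
  have hb : ∀ᵐ α : ℝ, α ∈ Ioc (-arcMax M) (arcMax M) →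
      ‖n * arcZ' M α * integrandTU M ν κ n x y
          (n * (u + τ * Complex.I) - 1 / 2) (n * arcZ M α - 1 / 2)‖ ≤
        K * J * Real.exp (-L) * W α := by
    filter_upwards [ae_mem_uIoc_arcMax hM β] with α hα hm
    obtain ⟨m1, m2, m3⟩ := hα (by rwa [uIoc_of_le (by linarith)])
    have k1 := h1 n hn x y hx hy τ α m1 m2
    have k2 := h2 n hn τ hτ0
    have k3 := h3 α (Ioo_subset_Icc_self m1) m3 τ hτ1 hτ2
    have kw := arcWeight_nonneg M x0 β N n α
    rw [mul_assoc, mul_left_comm, norm_mul]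
    have k4 : ‖(n : ℂ) * integrandTU M ν κ n x y (n * (u + τ * Complex.I) - 1 / 2)
          (n * arcZ M α - 1 / 2)‖ ≤ K * J * Real.exp (-L) *
          (|u - (arcZ M α).re| ^ (-(1 / 2) : ℝ) * arcWeight M x0 β N n α) := by
      rw [Real.exp_neg, ← div_eq_mul_inv, div_mul_eq_mul_div, le_div_iff₀ (Real.exp_pos _)]
      refine k1.trans ?_
      calc _ ≤ C1 * (C2 * Real.exp (-c * |τ|)) * arcWeight M x0 β N n α *
            (C3 * |u - (arcZ M α).re| ^ (-(1 / 2) : ℝ) *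
              (|τ - σ| ^ (-(1 / 2) : ℝ) + |τ + σ| ^ (-(1 / 2) : ℝ))) := by gcongr
        _ = (C1 * C2 * C3 * (|u - (arcZ M α).re| ^ (-(1 / 2) : ℝ) * arcWeight M x0 β N n α)) *
            (Real.exp (-c * |τ|) * (|τ - σ| ^ (-(1 / 2) : ℝ) + |τ + σ| ^ (-(1 / 2) : ℝ))) := by ring
        _ ≤ (C1 * C2 * C3 * (|u - (arcZ M α).re| ^ (-(1 / 2) : ℝ) * arcWeight M x0 β N n α)) *
            (Real.exp (c * |σ|) * J) := mul_le_mul_of_nonneg_left hJe (by positivity)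
        _ = _ := by rw [hK]; ring
    calc _ ≤ ‖arcZ' M α‖ * _ := mul_le_mul_of_nonneg_left k4 (norm_nonneg _)
      _ = _ := by simp only [hW]; ring
  have h_int := (intervalIntegrable_arcWeight hM hβ hx0 (N := N) hn).const_mul (K * J * Real.exp (-L))
  have := intervalIntegral.norm_integral_le_of_norm_le (by linarith) hb h_int
  rw [intervalIntegral.integral_const_mul] at this
  calc _ ≤ (K * J * Real.exp (-L) * ∫ α in -arcMax M..arcMax M, W α) * Real.exp L :=
        mul_le_mul_of_nonneg_right this (Real.exp_pos _).le
    _ = K * (∫ α in -arcMax M..arcMax M, W α) * J * (Real.exp (-L) * Real.exp L) := by ring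
    _ = _ := by rw [← Real.exp_add, neg_add_cancel, Real.exp_zero, mul_one]

end ArcBound

theorem integral_exp_mul_ofReal_mul_I (a σ : ℝ) :
    ∫ τ in -σ..σ, Complex.exp (τ * a * Complex.I) = 2 * σ * Real.sinc (a * σ) := by
  rcases eq_or_ne a 0 with rfl | ha
  · simp
    ring
  · have h := intervalIntegral.integral_comp_mul_right
      (f := fun t : ℝ => Complex.exp (t * Complex.I)) (a := -σ) (b := σ) ha
    rw [neg_mul, integral_exp_mul_I_eq_sinc] at h
    calc _ = ∫ τ in -σ..σ, Complex.exp ((τ * a : ℝ) * Complex.I) := by push_cast; rfl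
      _ = _ := by
        rw [h, mul_comm σ a]
        have : (a : ℂ) ≠ 0 := by exact_mod_cast ha
        simp only [Complex.real_smul, Complex.ofReal_inv, Complex.ofReal_mul]
        field_simp

section Residue

theorem integral_residue (n : ℕ) (lx ly u : ℝ) {σ : ℝ} (hσ : 0 < σ) :
    (n / (2 * Real.pi) : ℂ) * ∫ τ : ℝ, (if |τ| < σ then
      Complex.exp ((n * (u + τ * Complex.I) - 1 / 2) * lx) *
        Complex.exp (-((n * (u + τ * Complex.I) - 1 / 2) + 1) * ly) else 0) =
      ((n * σ / Real.pi * Real.exp ((n * u - 1 / 2) * (lx - ly) - ly) *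
        Real.sinc (n * (lx - ly) * σ) : ℝ) : ℂ) := by
  have e : (fun τ : ℝ => if |τ| < σ then
      Complex.exp ((n * (u + τ * Complex.I) - 1 / 2) * lx) *
        Complex.exp (-((n * (u + τ * Complex.I) - 1 / 2) + 1) * ly) else 0) =
      (Ioo (-σ) σ).indicator fun τ : ℝ =>
        Complex.exp ((n * u - 1 / 2) * (lx - ly) - ly) *
          Complex.exp (τ * (n * (lx - ly) : ℝ) * Complex.I) := by
    funext τ
    simp only [indicator, mem_Ioo, abs_lt]
    refine if_congr Iff.rfl ?_ rfl
    rw [← Complex.exp_add, ← Complex.exp_add]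
    congr 1
    push_cast
    ring
  rw [e, integral_indicator measurableSet_Ioo, ← integral_Ioc_eq_integral_Ioo,
    ← intervalIntegral.integral_of_le (by linarith), intervalIntegral.integral_const_mul,
    integral_exp_mul_ofReal_mul_I]
  push_cast
  have : (Real.pi : ℂ) ≠ 0 := by exact_mod_cast Real.pi_ne_zero
  field_simp

theorem integrable_residue (n : ℕ) (lx ly u : ℝ) (σ : ℝ) :
    Integrable fun τ : ℝ => (if |τ| < σ then
      Complex.exp ((n * (u + τ * Complex.I) - 1 / 2) * lx) *
        Complex.exp (-((n * (u + τ * Complex.I) - 1 / 2) + 1) * ly) else 0) := by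
  have e : (fun τ : ℝ => if |τ| < σ then
      Complex.exp ((n * (u + τ * Complex.I) - 1 / 2) * lx) *
        Complex.exp (-((n * (u + τ * Complex.I) - 1 / 2) + 1) * ly) else 0) =
      (Ioo (-σ) σ).indicator fun τ : ℝ =>
        Complex.exp ((n * (u + τ * Complex.I) - 1 / 2) * lx) *
        Complex.exp (-((n * (u + τ * Complex.I) - 1 / 2) + 1) * ly) := by
    funext τ
    simp only [indicator, mem_Ioo, abs_lt]
  rw [e, integrable_indicator_iff measurableSet_Ioo]
  refine (Continuous.integrableOn_Icc ?_).mono_set Ioo_subset_Icc_self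
  fun_prop

variable {M : ℕ} (hM : 2 ≤ M)
include hM

theorem exists_norm_KnTU_sub_le {β x0 : ℝ} (hβ : β ∈ Ioo 0 (arcMax M))
    (hx0 : Real.log x0 = saddleLog M β) {ν : ℕ → ℕ} (hν0 : ν 0 = 0) {κ : ℕ} (hκ : ν 1 < κ) (D : ℝ) :
    ∃ C > 0, ∀ n : ℕ, 1 ≤ n → ∀ x y : ℝ,
      |Real.log x - (Real.log x0 + (M - 1) * Real.log n)| ≤ D / n →
      |Real.log y - (Real.log x0 + (M - 1) * Real.log n)| ≤ D / n →
      ‖KnTU M ν κ n x y - ((n * (arcZ M β).im / Real.pi *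
          Real.exp ((n * (arcZ M β).re - 1 / 2) * (Real.log x - Real.log y) - Real.log y) *
          Real.sinc (n * (Real.log x - Real.log y) * (arcZ M β).im) : ℝ) : ℂ)‖ *
        Real.exp (Real.log x0 + (M - 1) * Real.log n) ≤
      C * n * ∫ α in -arcMax M..arcMax M,
        ‖arcZ' M α‖ * |(arcZ M β).re - (arcZ M α).re| ^ (-(1 / 2) : ℝ) *
          arcWeight M x0 β (∑ j ∈ Finset.range (M + 1), ν j) n α := by
  obtain ⟨C, hC, c, hc, h⟩ := exists_norm_integral_arc_le hM hβ hx0 ν (κ := κ) (by omega) D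
  have hu := arcZ_re_pos hM (α := β) ⟨by linarith [hβ.1, hβ.2], hβ.2⟩
  have hσ := arcZ_im_pos hM hβ
  set u := (arcZ M β).re with hu'
  set σ := (arcZ M β).im with hσ'
  have hb := integrable_sqrtBump hc
  set B := ∫ t, sqrtBump c t with hB
  have hB0 : 0 ≤ B := integral_nonneg (sqrtBump_nonneg c)
  refine ⟨C * B + 1, by positivity, fun n hn x y hx hy => ?_⟩
  have hn0 : (0 : ℝ) < n := by exact_mod_cast hn
  set A := ∫ α in -arcMax M..arcMax M,
        ‖arcZ' M α‖ * |u - (arcZ M α).re| ^ (-(1 / 2) : ℝ) *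
          arcWeight M x0 β (∑ j ∈ Finset.range (M + 1), ν j) n α with hA
  have hA0 : 0 ≤ A := intervalIntegral.integral_nonneg (by linarith [arcMax_pos hM])
    fun α _ => mul_nonneg (by positivity) (arcWeight_nonneg _ _ _ _ _ _)
  set L := Real.log x0 + (M - 1) * Real.log n with hL
  have hk : Integrable fun τ : ℝ => kernF M ν κ n x y (n * (u + τ * Complex.I) - 1 / 2) := by
    have := (integrable_kernF hM hκ hn x y (b := n * u - 1 / 2)
      (by have := mul_pos hn0 hu; linarith)).comp_mul_left' hn0.ne'
    refine this.congr (Eventually.of_forall fun τ => ?_)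
    simp only
    congr 1
    push_cast
    ring
  rw [KnTU_eq_integral_shift hM hν0 hκ hn x y hu.le, ← integral_residue n _ _ u hσ, ← mul_sub,
    ← integral_sub hk (integrable_residue n _ _ u σ)]
  have hae : ∀ᵐ τ : ℝ, ‖kernF M ν κ n x y (n * (u + τ * Complex.I) - 1 / 2) -
      (if |τ| < σ then Complex.exp ((n * (u + τ * Complex.I) - 1 / 2) * Real.log x) *
        Complex.exp (-((n * (u + τ * Complex.I) - 1 / 2) + 1) * Real.log y) else 0)‖ ≤
      C * A * Real.exp (-L) * (sqrtBump c (τ - σ) + sqrtBump c (τ + σ)) := by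
    have hfin : ({0, σ, -σ} : Set ℝ).Finite := by simp
    filter_upwards [hfin.countable.ae_notMem volume] with τ hτ
    simp only [mem_insert_iff, mem_singleton_iff, not_or] at hτ
    have k := integral_arc_integrandTU hM hν0 κ hn x y hβ hτ.1 hτ.2.1 hτ.2.2
    simp only at k
    rw [kernF, k, add_sub_cancel_left, norm_mul]
    have k2 := h n hn x y hx hy τ hτ.1 hτ.2.1 hτ.2.2
    rw [← le_div_iff₀ (Real.exp_pos _), ← hL, ← hA] at k2
    have k3 : ‖(1 / (2 * Real.pi * Complex.I) : ℂ)‖ ≤ 1 := by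
      simp only [one_div, norm_inv, norm_mul, Complex.norm_I, Complex.norm_real, mul_one,
        Complex.norm_ofNat, Real.norm_eq_abs, abs_of_pos Real.pi_pos]
      exact inv_le_one_of_one_le₀ (by linarith [Real.pi_gt_three])
    calc _ ≤ 1 * _ := mul_le_mul k3 k2 (norm_nonneg _) zero_le_one
      _ = _ := by rw [Real.exp_neg]; ring
  have hi : Integrable fun τ => C * A * Real.exp (-L) * (sqrtBump c (τ - σ) + sqrtBump c (τ + σ)) :=
    ((hb.comp_sub_right σ).add (hb.comp_add_right σ)).const_mul _
  have key := norm_integral_le_of_norm_le hi hae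
  rw [integral_const_mul, integral_add (hb.comp_sub_right σ) (hb.comp_add_right σ),
    integral_sub_right_eq_self (sqrtBump c) σ, integral_add_right_eq_self (sqrtBump c) σ, ← hB] at key
  rw [norm_mul]
  have k4 : ‖(n / (2 * Real.pi) : ℂ)‖ = n / (2 * Real.pi) := by
    rw [norm_div, norm_mul, Complex.norm_natCast, Complex.norm_ofNat, Complex.norm_real,
      Real.norm_of_nonneg Real.pi_pos.le]
  rw [k4]
  calc _ ≤ n / (2 * Real.pi) * (C * A * Real.exp (-L) * (B + B)) * Real.exp L := by gcongr
    _ = n / (2 * Real.pi) * (C * A * (2 * B)) * (Real.exp (-L) * Real.exp L) := by ring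
    _ = (C * B * n * A) / Real.pi := by
      rw [← Real.exp_add, neg_add_cancel, Real.exp_zero]; field_simp
    _ ≤ C * B * n * A := div_le_self (by positivity) (by linarith [Real.pi_gt_three])
    _ ≤ _ := by
      have : 0 ≤ n * A := by positivity
      nlinarith

end Residue

theorem log_eq_mul_dslope (t : ℝ) : Real.log t = (t - 1) * dslope Real.log 1 t := by
  have := sub_smul_dslope Real.log 1 t
  rw [Real.log_one, sub_zero, smul_eq_mul] at this
  exact this.symm

theorem continuousOn_dslope_log : ContinuousOn (dslope Real.log 1) (Ioi 0) :=
  (continuousOn_dslope (Ioi_mem_nhds one_pos)).2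
    ⟨fun _ ht => (Real.continuousAt_log (mem_Ioi.1 ht).ne').continuousWithinAt,
      Real.differentiableAt_log one_ne_zero⟩

/-- The difference quotient of `log (1 + h a) - log (1 + h b)` in `h`, extended to `h = 0`. -/
noncomputable def logQuot (h : ℝ) (p : ℝ × ℝ) : ℝ :=
  p.1 * dslope Real.log 1 (1 + h * p.1) - p.2 * dslope Real.log 1 (1 + h * p.2)

theorem mul_logQuot (h : ℝ) (p : ℝ × ℝ) :
    h * logQuot h p = Real.log (1 + h * p.1) - Real.log (1 + h * p.2) := by
  rw [log_eq_mul_dslope (1 + h * p.1), log_eq_mul_dslope (1 + h * p.2), logQuot]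
  ring

/-- The rescaled residue contribution to the kernel. -/
noncomputable def scaledResidue (u σ h : ℝ) (p : ℝ × ℝ) : ℝ :=
  Real.exp (-(u * (p.1 - p.2))) * Real.exp ((u - h / 2) * logQuot h p) / (1 + h * p.2) *
    Real.sinc (logQuot h p * σ)

theorem scaledResidue_zero (u σ : ℝ) (p : ℝ × ℝ) :
    scaledResidue u σ 0 p = Real.sinc ((p.1 - p.2) * σ) := by
  have : logQuot 0 p = p.1 - p.2 := by simp [logQuot]
  rw [scaledResidue, this, ← Real.exp_add]
  simp

theorem exists_subset_abs_le {K : Set (ℝ × ℝ)} (hK : IsCompact K) :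
    ∃ R > 0, ∀ p ∈ K, |p.1| ≤ R ∧ |p.2| ≤ R := by
  obtain ⟨R, hR, h⟩ := hK.isBounded.exists_pos_norm_le
  exact ⟨R, hR, fun p hp => ⟨(norm_fst_le p).trans (h p hp), (norm_snd_le p).trans (h p hp)⟩⟩

theorem eventually_abs_scaledResidue_sub_lt (u σ : ℝ) {K : Set (ℝ × ℝ)} (hK : IsCompact K)
    {ε : ℝ} (hε : 0 < ε) : ∀ᶠ n : ℕ in atTop, ∀ p ∈ K,
      |scaledResidue u σ (n : ℝ)⁻¹ p - Real.sinc ((p.1 - p.2) * σ)| < ε := by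
  obtain ⟨R, hR, hRK⟩ := exists_subset_abs_le hK
  have hpos : ∀ h ∈ Metric.ball (0 : ℝ) (R⁻¹), ∀ a : ℝ, |a| ≤ R → 0 < 1 + h * a := by
    intro h hh a ha
    rw [mem_ball_zero_iff, Real.norm_eq_abs] at hh
    have : |h * a| < 1 := by
      rw [abs_mul]
      calc |h| * |a| ≤ |h| * R := by gcongr
        _ < R⁻¹ * R := by gcongr
        _ = 1 := inv_mul_cancel₀ hR.ne'
    linarith [(abs_lt.1 this).1]
  have hc : ContinuousOn (Function.uncurry (scaledResidue u σ)) (Metric.ball 0 R⁻¹ ×ˢ K) := by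
    have h1 : ContinuousOn (fun q : ℝ × ℝ × ℝ => dslope Real.log 1 (1 + q.1 * q.2.1))
        (Metric.ball 0 R⁻¹ ×ˢ K) :=
      continuousOn_dslope_log.comp (by fun_prop) fun q hq => hpos _ hq.1 _ (hRK _ hq.2).1
    have h2 : ContinuousOn (fun q : ℝ × ℝ × ℝ => dslope Real.log 1 (1 + q.1 * q.2.2))
        (Metric.ball 0 R⁻¹ ×ˢ K) :=
      continuousOn_dslope_log.comp (by fun_prop) fun q hq => hpos _ hq.1 _ (hRK _ hq.2).2
    have h3 : ContinuousOn (fun q : ℝ × ℝ × ℝ => logQuot q.1 q.2) (Metric.ball 0 R⁻¹ ×ˢ K) := by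
      unfold logQuot
      fun_prop
    have h4 := Real.continuous_sinc
    unfold scaledResidue Function.uncurry
    refine ContinuousOn.mul (ContinuousOn.div (by fun_prop) (by fun_prop) fun q hq =>
      (hpos _ hq.1 _ (hRK _ hq.2).2).ne') (by fun_prop)
  obtain ⟨v, hv, hv'⟩ := hK.mem_uniformity_of_prod hc (Metric.mem_ball_self (by positivity))
    (Metric.dist_mem_uniformity hε)
  rw [nhdsWithin_eq_nhds.2 (Metric.ball_mem_nhds _ (by positivity))] at hv
  filter_upwards [tendsto_inv_atTop_nhds_zero_nat (𝕜 := ℝ) hv] with n hn p hp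
  have := hv' _ hn p hp
  rwa [scaledResidue_zero, mem_ofPred_eq, Real.dist_eq] at this

theorem abs_log_one_add_le {t : ℝ} (ht : |t| ≤ 1 / 2) : |Real.log (1 + t)| ≤ 2 * |t| := by
  have h := abs_le.1 ht
  have h1 := Real.log_le_sub_one_of_pos (x := 1 + t) (by linarith)
  have h2 := Real.one_sub_inv_le_log_of_pos (x := 1 + t) (by linarith)
  rw [abs_le]
  have h3 : 1 - (1 + t)⁻¹ = t / (1 + t) := by
    have : 1 + t ≠ 0 := by linarith
    field_simp
    ring
  have h4 : -(2 * |t|) ≤ t / (1 + t) := by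
    rw [le_div_iff₀ (by linarith)]
    nlinarith [neg_abs_le t, abs_nonneg t]
  exact ⟨by linarith, by linarith [le_abs_self t, abs_nonneg t]⟩

section Parameters

variable {M : ℕ} (hM : 2 ≤ M) {x0 φ : ℝ}
  (hφ : φ ∈ Ioo (0 : ℝ) (2 * Real.pi / ((M : ℝ) + 1)))
include hM hφ

omit hM in
theorem half_mem_Ioo_arcMax : φ / 2 ∈ Ioo 0 (arcMax M) := by
  refine ⟨by linarith [hφ.1], ?_⟩
  have := hφ.2
  rw [mul_div_assoc] at this
  unfold arcMax
  linarith

theorem log_eq_saddleLog (hpar : x0 =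
      Real.sin (((M : ℝ) + 1) * φ / 2) ^ (((M : ℝ) + 1)/2) /
        (Real.sin φ * Real.sin (((M : ℝ) - 1) * φ / 2) ^ (((M : ℝ) - 1)/2))) :
    Real.log x0 = saddleLog M (φ / 2) := by
  have hβ := half_mem_Ioo_arcMax hφ
  obtain ⟨-, h1, h2, -⟩ := sin_pos_of_le_arcMax hM (Ioo_subset_Ioc_self hβ)
  have h3 := sin_add_one_pos hM hβ
  rw [← mul_div_assoc] at h1 h3
  rw [mul_div_cancel₀ φ two_ne_zero] at h2
  rw [hpar, Real.log_div (by positivity) (by positivity), Real.log_mul (by positivity)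
    (by positivity), Real.log_rpow h3, Real.log_rpow h1, saddleLog, mul_div_cancel₀ φ two_ne_zero,
    ← mul_div_assoc, ← mul_div_assoc]
  ring

theorem arcZ_half_im (hx0 : 0 < x0) :
    (arcZ M (φ / 2)).im = Real.pi * x0 * ρTU M x0 φ := by
  have hβ := half_mem_Ioo_arcMax hφ
  have h := arcR_sq hM (Ioo_subset_Ioc_self hβ)
  rw [← mul_div_assoc, ← mul_div_assoc] at h
  rw [arcZ_im, ρTU, ← h, ← Real.sqrt_eq_rpow, Real.sqrt_sq (arcR_nonneg _)]
  have := Real.pi_pos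
  field_simp

theorem arcZ_half_re (hx0 : 0 < x0) :
    (arcZ M (φ / 2)).re = Real.pi * x0 * ρTU M x0 φ * (Real.cos (φ / 2) / Real.sin (φ / 2)) := by
  have hβ := half_mem_Ioo_arcMax hφ
  have h := (sin_pos_of_le_arcMax hM (Ioo_subset_Ioc_self hβ)).1
  rw [← arcZ_half_im hM hφ hx0, arcZ_re, arcZ_im]
  field_simp

end Parameters

theorem Ksin_eq_sinc (ξ η : ℝ) : Ksin ξ η = Real.sinc (Real.pi * (ξ - η)) := by
  unfold Ksin Real.sinc
  simp [Real.pi_ne_zero, sub_eq_zero]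

section Scaling

variable {M : ℕ} (hM : 2 ≤ M) {x0 ρ : ℝ} (hx0 : 0 < x0) (hρ : 0 < ρ) {n : ℕ} (hn : 1 ≤ n)
include hM hx0 hρ hn

omit hM in
theorem rescaled_point_eq (ξ : ℝ) : (n : ℝ) ^ (M - 1) * (x0 + ξ / (n * ρ)) =
    n ^ (M - 1) * x0 * (1 + (n : ℝ)⁻¹ * (ξ / (ρ * x0))) := by
  have : (0 : ℝ) < n := by exact_mod_cast hn
  field_simp

theorem log_rescaled_point {ξ : ℝ} (h : 0 < 1 + (n : ℝ)⁻¹ * (ξ / (ρ * x0))) :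
    Real.log ((n : ℝ) ^ (M - 1) * (x0 + ξ / (n * ρ))) =
      Real.log x0 + (M - 1) * Real.log n + Real.log (1 + (n : ℝ)⁻¹ * (ξ / (ρ * x0))) := by
  have : (0 : ℝ) < n := by exact_mod_cast hn
  rw [rescaled_point_eq hx0 hρ hn, Real.log_mul (by positivity) h.ne',
    Real.log_mul (by positivity) hx0.ne', Real.log_pow, Nat.cast_sub (by omega), Nat.cast_one]
  ring

theorem residue_eq_scaledResidue {u σ ct : ℝ} (hσ : σ = Real.pi * x0 * ρ) (hu : u = σ * ct)
    {ξ η : ℝ} (hξ : 0 < 1 + (n : ℝ)⁻¹ * (ξ / (ρ * x0))) (hη : 0 < 1 + (n : ℝ)⁻¹ * (η / (ρ * x0))) :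
    Real.exp (-Real.pi * (ξ - η) * ct) * ((n : ℝ) ^ (M - 2) / ρ) *
      (n * σ / Real.pi * Real.exp ((n * u - 1 / 2) *
        (Real.log ((n : ℝ) ^ (M - 1) * (x0 + ξ / (n * ρ))) -
          Real.log ((n : ℝ) ^ (M - 1) * (x0 + η / (n * ρ)))) -
          Real.log ((n : ℝ) ^ (M - 1) * (x0 + η / (n * ρ)))) *
        Real.sinc (n * (Real.log ((n : ℝ) ^ (M - 1) * (x0 + ξ / (n * ρ))) -
          Real.log ((n : ℝ) ^ (M - 1) * (x0 + η / (n * ρ)))) * σ)) =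
      scaledResidue u σ (n : ℝ)⁻¹ (ξ / (ρ * x0), η / (ρ * x0)) := by
  have hn0 : (0 : ℝ) < n := by exact_mod_cast hn
  have hδ : Real.log ((n : ℝ) ^ (M - 1) * (x0 + ξ / (n * ρ))) -
      Real.log ((n : ℝ) ^ (M - 1) * (x0 + η / (n * ρ))) =
      (n : ℝ)⁻¹ * logQuot (n : ℝ)⁻¹ (ξ / (ρ * x0), η / (ρ * x0)) := by
    rw [log_rescaled_point hM hx0 hρ hn hξ, log_rescaled_point hM hx0 hρ hn hη, mul_logQuot]
    ring
  rw [hδ, Real.exp_sub, Real.exp_log (by rw [rescaled_point_eq hx0 hρ hn]; positivity),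
    rescaled_point_eq hx0 hρ hn, mul_inv_cancel_left₀ hn0.ne', scaledResidue]
  set q := logQuot (n : ℝ)⁻¹ (ξ / (ρ * x0), η / (ρ * x0))
  have e1 : -Real.pi * (ξ - η) * ct = -(u * (ξ / (ρ * x0) - η / (ρ * x0))) := by
    rw [hu, hσ]; field_simp
  have e2 : (n * u - 1 / 2) * ((n : ℝ)⁻¹ * q) = (u - (n : ℝ)⁻¹ / 2) * q := by field_simp
  rw [e1, e2]
  have e3 : (n : ℝ) ^ (M - 1) = n ^ (M - 2) * n := by rw [← pow_succ]; congr 1; omega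
  rw [e3, hσ]
  have := Real.pi_pos
  generalize 1 + (n : ℝ)⁻¹ * (η / (ρ * x0)) = b at *
  generalize Real.exp (-(u * (ξ / (ρ * x0) - η / (ρ * x0)))) = E
  field_simp

omit hρ in
theorem exp_log_add_mul_log :
    Real.exp (Real.log x0 + (M - 1) * Real.log n) = x0 * (n ^ (M - 2) * n) := by
  have hn0 : (0 : ℝ) < n := by exact_mod_cast hn
  have e3 : (n : ℝ) ^ (M - 1) = n ^ (M - 2) * n := by rw [← pow_succ]; congr 1; omega
  rw [← e3, Real.exp_add, Real.exp_log hx0, ← Real.rpow_natCast, Real.rpow_def_of_pos hn0,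
    Nat.cast_sub (by omega), Nat.cast_one, mul_comm (Real.log _)]

end Scaling

/-- Bulk universality for the product of `M-1` Ginibre matrices with one truncated
unitary matrix (Theorem 4.2). -/
theorem bulk_universality_truncated_unitary
    (M : ℕ) (hM : 2 ≤ M) (ν : ℕ → ℕ) (hν0 : ν 0 = 0) (κ : ℕ) (hκ : ν 1 < κ)
    (x0 : ℝ)
    (hx0 : x0 ∈ Set.Ioo (0 : ℝ)
      (((M : ℝ) + 1) ^ (((M : ℝ) + 1)/2) / (2 * ((M : ℝ) - 1) ^ (((M : ℝ) - 1)/2))))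
    (φ : ℝ) (hφ : φ ∈ Set.Ioo (0 : ℝ) (2 * Real.pi / ((M : ℝ) + 1)))
    (hpar : x0 =
      Real.sin (((M : ℝ) + 1) * φ / 2) ^ (((M : ℝ) + 1)/2) /
        (Real.sin φ * Real.sin (((M : ℝ) - 1) * φ / 2) ^ (((M : ℝ) - 1)/2)))
    (S : Set (ℝ × ℝ)) (hS : IsCompact S) :
    TendstoUniformlyOn
      (fun (n : ℕ) (p : ℝ × ℝ) =>
        ((Real.exp (-Real.pi * (p.1 - p.2) * (Real.cos (φ/2) / Real.sin (φ/2))) *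
            ((n : ℝ) ^ (M - 2) / ρTU M x0 φ) : ℝ) : ℂ) *
          KnTU M ν κ n
            ((n : ℝ) ^ (M - 1) * (x0 + p.1 / (n * ρTU M x0 φ)))
            ((n : ℝ) ^ (M - 1) * (x0 + p.2 / (n * ρTU M x0 φ))))
      (fun p => ((Ksin p.1 p.2 : ℝ) : ℂ)) atTop S := by
  have hx0' := hx0.1
  have hβ := half_mem_Ioo_arcMax hφ
  have hlog := log_eq_saddleLog hM hφ hpar
  have hσ := arcZ_half_im hM hφ hx0'
  have hu : (arcZ M (φ / 2)).re = (arcZ M (φ / 2)).im * (Real.cos (φ / 2) / Real.sin (φ / 2)) := by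
    rw [hσ, arcZ_half_re hM hφ hx0']
  have hσ0 := arcZ_im_pos hM hβ
  have hu0 := arcZ_re_pos hM (α := φ / 2) ⟨by linarith [hβ.1, hβ.2], hβ.2⟩
  have hρ : 0 < ρTU M x0 φ := by
    rw [hσ] at hσ0
    exact pos_of_mul_pos_right hσ0 (by positivity)
  set ρ := ρTU M x0 φ with hρ'
  set u := (arcZ M (φ / 2)).re with hu'
  set σ := (arcZ M (φ / 2)).im with hσ'
  set ct := Real.cos (φ / 2) / Real.sin (φ / 2) with hct
  set q : ℝ × ℝ → ℝ × ℝ := fun p => (p.1 / (ρ * x0), p.2 / (ρ * x0)) with hq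
  have hK : IsCompact (q '' S) := hS.image (by fun_prop)
  obtain ⟨R, hR, hRK⟩ := exists_subset_abs_le hK
  obtain ⟨C, hC, herr⟩ := exists_norm_KnTU_sub_le hM hβ hlog hν0 hκ (2 * R)
  set A : ℕ → ℝ := fun n => ∫ α in -arcMax M..arcMax M,
    ‖arcZ' M α‖ * |u - (arcZ M α).re| ^ (-(1 / 2) : ℝ) *
      arcWeight M x0 (φ / 2) (∑ j ∈ Finset.range (M + 1), ν j) n α with hA
  have hA0 : Tendsto (fun n => Real.exp (2 * R * u) * C / (ρ * x0) * A n) atTop (𝓝 0) := by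
    have := (tendsto_integral_arcWeight hM hβ hlog
      (∑ j ∈ Finset.range (M + 1), ν j)).const_mul (Real.exp (2 * R * u) * C / (ρ * x0))
    rwa [mul_zero] at this
  rw [Metric.tendstoUniformlyOn_iff]
  intro ε hε
  filter_upwards [eventually_ge_atTop 1, eventually_ge_atTop ⌈2 * R⌉₊,
    eventually_abs_scaledResidue_sub_lt u σ hK (half_pos hε), hA0.eventually_lt_const (half_pos hε)]
    with n hn hnR hmain hAn p hp
  have hn0 : (0 : ℝ) < n := by exact_mod_cast hn
  have hqp := mem_image_of_mem q hp
  obtain ⟨ha, hb⟩ := hRK _ hqp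
  have hscale : ∀ a : ℝ, |a| ≤ R → |(n : ℝ)⁻¹ * a| ≤ 1 / 2 ∧ 0 < 1 + (n : ℝ)⁻¹ * a ∧
      |Real.log (1 + (n : ℝ)⁻¹ * a)| ≤ 2 * R / n := by
    intro a ha
    have h1 : |(n : ℝ)⁻¹ * a| ≤ R / n := by
      rw [abs_mul, abs_of_pos (inv_pos.2 hn0), div_eq_inv_mul]
      gcongr
    have h2 : R / n ≤ 1 / 2 := by
      rw [div_le_iff₀ hn0]
      linarith [Nat.ceil_le.1 hnR]
    have h3 := h1.trans h2
    refine ⟨h3, by linarith [(abs_le.1 h3).1], (abs_log_one_add_le h3).trans ?_⟩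
    rw [mul_div_assoc]
    linarith
  obtain ⟨-, ha1, ha2⟩ := hscale _ ha
  obtain ⟨-, hb1, hb2⟩ := hscale _ hb
  have hm := hmain _ hqp
  set x := (n : ℝ) ^ (M - 1) * (x0 + p.1 / (n * ρ)) with hx
  set y := (n : ℝ) ^ (M - 1) * (x0 + p.2 / (n * ρ)) with hy
  have hlx := log_rescaled_point hM hx0' hρ hn ha1
  have hly := log_rescaled_point hM hx0' hρ hn hb1
  rw [← hx] at hlx
  rw [← hy] at hly
  have he := herr n hn x y (by rw [hlx, add_sub_cancel_left]; exact ha2)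
    (by rw [hly, add_sub_cancel_left]; exact hb2)
  have hres := residue_eq_scaledResidue hM hx0' hρ hn hσ hu ha1 hb1
  rw [← hx, ← hy] at hres
  rw [exp_log_add_mul_log hM hx0' hn] at he
  set m : ℝ := n * σ / Real.pi * Real.exp ((n * u - 1 / 2) * (Real.log x - Real.log y) -
    Real.log y) * Real.sinc (n * (Real.log x - Real.log y) * σ) with hmdef
  set P : ℝ := Real.exp (-Real.pi * (p.1 - p.2) * ct) * ((n : ℝ) ^ (M - 2) / ρ) with hP
  have hP0 : 0 ≤ P := by positivity
  have hK1 : Ksin p.1 p.2 = Real.sinc (((q p).1 - (q p).2) * σ) := by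
    rw [Ksin_eq_sinc, hσ, hq]
    congr 1
    field_simp
  have hexp : Real.exp (-Real.pi * (p.1 - p.2) * ct) ≤ Real.exp (2 * R * u) := by
    rw [Real.exp_le_exp]
    have e1 : -Real.pi * (p.1 - p.2) * ct = u * ((q p).2 - (q p).1) := by
      rw [hu, hσ, hq]
      field_simp
      ring
    rw [e1]
    have := (abs_le.1 ha).1
    have := (abs_le.1 hb).2
    nlinarith
  have hA0' : 0 ≤ A n := intervalIntegral.integral_nonneg (by linarith [arcMax_pos hM])
    fun α _ => mul_nonneg (by positivity) (arcWeight_nonneg _ _ _ _ _ _)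
  have hErr : P * ‖KnTU M ν κ n x y - (m : ℂ)‖ ≤ Real.exp (2 * R * u) * C / (ρ * x0) * A n := by
    rw [← le_div_iff₀ (by positivity)] at he
    calc P * ‖KnTU M ν κ n x y - (m : ℂ)‖ ≤ (Real.exp (2 * R * u) * ((n : ℝ) ^ (M - 2) / ρ)) *
          (C * n * A n / (x0 * (n ^ (M - 2) * n))) := by
          refine mul_le_mul ?_ he (norm_nonneg _) (by positivity)
          exact mul_le_mul_of_nonneg_right hexp (by positivity)
      _ = _ := by field_simp
  rw [dist_comm, dist_eq_norm]
  calc ‖(P : ℂ) * KnTU M ν κ n x y - (Ksin p.1 p.2 : ℂ)‖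
      = ‖(P : ℂ) * (KnTU M ν κ n x y - (m : ℂ)) + ((P * m - Ksin p.1 p.2 : ℝ) : ℂ)‖ := by
        congr 1
        push_cast
        ring
    _ ≤ P * ‖KnTU M ν κ n x y - (m : ℂ)‖ + |P * m - Ksin p.1 p.2| := by
        refine (norm_add_le _ _).trans_eq ?_
        rw [norm_mul, Complex.norm_real, Complex.norm_real, Real.norm_of_nonneg hP0, Real.norm_eq_abs]
    _ < ε / 2 + ε / 2 := by
        refine add_lt_add (hErr.trans_lt hAn) ?_
        rw [hres, hK1]
        exact hm
    _ = ε := add_halves ε
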